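/- Let φ be a norm on ℝ², let Ω ⊆ ℝ² be a bounded convex open set, let m ∈ (0, |Ω|), and let E be a minimizer of problem (10) (the constrained isoperimetric problem). Then E is convex, in the sense that its set of Lebesgue-density-1 points is a convex set. -/

import Mathlib

open MeasureTheory Set ENNReal Filter

noncomputable section

/-- `φ` is a norm on `ℝⁿ` (represented as `Fin n → ℝ`). -/
structure IsNorm {n : ℕ} (φ : (Fin n → ℝ) → ℝ) : Prop where
  nonneg : ∀ x, 0 ≤ φ x
  eq_zero_iff : ∀ x, φ x = 0 ↔ x = 0
  smul_eq : ∀ (a : ℝ) (x : Fin n → ℝ), φ (a • x) = |a| * φ x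
  add_le : ∀ x y, φ (x + y) ≤ φ x + φ y

/-- The divergence of a vector field `η : ℝⁿ → ℝⁿ`. -/
def diverg {n : ℕ} (η : (Fin n → ℝ) → (Fin n → ℝ)) (x : Fin n → ℝ) : ℝ :=
  ∑ i, fderiv ℝ η x (Pi.single i 1) i

/-- The anisotropic total variation `∫ φ*(Du)` of `u : ℝⁿ → ℝ`:
`sup { ∫ u div η dx : η ∈ C¹_c(ℝⁿ;ℝⁿ), φ(η(x)) ≤ 1 ∀ x }`, as an extended real. -/
def anisoTV {n : ℕ} (φ : (Fin n → ℝ) → ℝ) (u : (Fin n → ℝ) → ℝ) : ℝ≥0∞ :=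
  ⨆ η ∈ {η : (Fin n → ℝ) → (Fin n → ℝ) |
      ContDiff ℝ 1 η ∧ HasCompactSupport η ∧ ∀ x, φ (η x) ≤ 1},
    ENNReal.ofReal (∫ x, u x * diverg η x)

/-- `u ∈ BV(ℝⁿ)` (with respect to the anisotropic total variation). -/
def IsBV {n : ℕ} (φ : (Fin n → ℝ) → ℝ) (u : (Fin n → ℝ) → ℝ) : Prop :=
  Integrable u volume ∧ anisoTV φ u ≠ ⊤

/-- `u` is admissible for problem (1): `u ∈ BV(ℝⁿ)`, `u = 0` a.e. outside `Ω`,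
`u` is a.e. `ℕ`-valued, and `∫_Ω u = m`. -/
def Admissible {n : ℕ} (φ : (Fin n → ℝ) → ℝ) (Ω : Set (Fin n → ℝ)) (m : ℝ)
    (u : (Fin n → ℝ) → ℝ) : Prop :=
  IsBV φ u ∧ (∀ᵐ x ∂volume, x ∉ Ω → u x = 0) ∧
    (∀ᵐ x ∂volume, ∃ k : ℕ, u x = k) ∧ (∫ x in Ω, u x) = m

/-- `u` is a minimizer of problem (1). -/
def IsMinimizer {n : ℕ} (φ : (Fin n → ℝ) → ℝ) (Ω : Set (Fin n → ℝ)) (m : ℝ)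
    (u : (Fin n → ℝ) → ℝ) : Prop :=
  Admissible φ Ω m u ∧ ∀ v, Admissible φ Ω m v → anisoTV φ u ≤ anisoTV φ v

/-- The anisotropic perimeter `P_φ(E)` of a set `E ⊆ ℝⁿ`. -/
def anisoPerimeter {n : ℕ} (φ : (Fin n → ℝ) → ℝ) (E : Set (Fin n → ℝ)) : ℝ≥0∞ :=
  anisoTV φ (E.indicator (1 : (Fin n → ℝ) → ℝ))

/-- The Wulff ball `W_r(x) = {y : φ(y-x) < r}`. -/
def wulffBall {n : ℕ} (φ : (Fin n → ℝ) → ℝ) (x : Fin n → ℝ) (r : ℝ) : Set (Fin n → ℝ) :=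
  {y | φ (y - x) < r}

/-- `E` satisfies the `rW_φ`-condition. -/
def rWCond {n : ℕ} (φ : (Fin n → ℝ) → ℝ) (E : Set (Fin n → ℝ)) (r : ℝ) : Prop :=
  ∀ x ∈ frontier E, ∃ y, wulffBall φ y r ⊆ E ∧ x ∈ frontier (wulffBall φ y r)

/-- The Wulff plaquette `E^r`, the union of all Wulff balls of radius `r` contained
in `E` (with `E^0 = E`). -/
def plaquette {n : ℕ} (φ : (Fin n → ℝ) → ℝ) (E : Set (Fin n → ℝ)) (r : ℝ) :
    Set (Fin n → ℝ) :=
  if r = 0 then E else ⋃ (x) (_ : wulffBall φ x r ⊆ E), wulffBall φ x r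

/-- `R_Ω`: the maximal `R > 0` such that some Wulff ball of radius `R` is contained in `Ω`. -/
def maxInradius {n : ℕ} (φ : (Fin n → ℝ) → ℝ) (Ω : Set (Fin n → ℝ)) : ℝ :=
  sSup {R | 0 < R ∧ ∃ x, wulffBall φ x R ⊆ Ω}

/-- `r_Ω`: the maximal `r > 0` such that `Ω` satisfies the `rW_φ`-condition
(`0` if there is none, since `sSup ∅ = 0`). -/
def maxRollRadius {n : ℕ} (φ : (Fin n → ℝ) → ℝ) (Ω : Set (Fin n → ℝ)) : ℝ :=
  sSup {r | 0 < r ∧ rWCond φ Ω r}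

/-- The set of points of Lebesgue density `1` of `E`. -/
def densityPoints {n : ℕ} (E : Set (Fin n → ℝ)) : Set (Fin n → ℝ) :=
  {x | Tendsto (fun r : ℝ => volume (E ∩ Metric.ball x r) / volume (Metric.ball x r))
    (nhdsWithin 0 (Ioi 0)) (nhds 1)}

/-- `E` is a minimizer of problem (10): the constrained isoperimetric problem
minimizing `P_φ` among measurable subsets of `Ω` of prescribed measure `m`. -/
def IsIsopMinimizer {n : ℕ} (φ : (Fin n → ℝ) → ℝ) (Ω : Set (Fin n → ℝ)) (m : ℝ)
    (E : Set (Fin n → ℝ)) : Prop :=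
  MeasurableSet E ∧ E ⊆ Ω ∧ (volume E).toReal = m ∧
    ∀ F, MeasurableSet F → F ⊆ Ω → (volume F).toReal = m →
      anisoPerimeter φ E ≤ anisoPerimeter φ F

/-- The Euclidean norm on `ℝ²`. -/
def euclNorm (v : Fin 2 → ℝ) : ℝ := Real.sqrt (v 0 ^ 2 + v 1 ^ 2)

/-- The crystalline norm `φ(ν) = |ν₁| + |ν₂|` on `ℝ²`. -/
def crysNorm (v : Fin 2 → ℝ) : ℝ := |v 0| + |v 1|

/-- The open unit square `(0,1)² ⊆ ℝ²`. -/
def unitSquare : Set (Fin 2 → ℝ) := univ.pi fun _ => Ioo (0 : ℝ) 1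

/-- The closed unit square `[0,1]² ⊆ ℝ²`. -/
def closedUnitSquare : Set (Fin 2 → ℝ) := univ.pi fun _ => Icc (0 : ℝ) 1

/-- `j` is the essential supremum `‖u‖_∞` of `u`. -/
def IsEssSup (u : (Fin 2 → ℝ) → ℝ) (j : ℕ) : Prop :=
  (∀ᵐ x ∂volume, u x ≤ (j : ℝ)) ∧ ∀ c : ℝ, (∀ᵐ x ∂volume, u x ≤ c) → (j : ℝ) ≤ c

/-- The linear functional `x ↦ x ∧ g` on the plane; it is constant along the direction `g`. -/
def wedge (g : Fin 2 → ℝ) : (Fin 2 → ℝ) →L[ℝ] ℝ :=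
  g 1 • ContinuousLinearMap.proj (R := ℝ) (φ := fun _ : Fin 2 => ℝ) 0 -
    g 0 • ContinuousLinearMap.proj (R := ℝ) (φ := fun _ : Fin 2 => ℝ) 1

lemma wedge_apply (g x : Fin 2 → ℝ) : wedge g x = x 0 * g 1 - x 1 * g 0 := by
  simp [wedge, mul_comm]

lemma wedge_self (g : Fin 2 → ℝ) : wedge g g = 0 := by rw [wedge_apply]; ring

/-- A vector transverse to `g`, normalized so that `wedge g (dualDir g) = 1`. -/
def dualDir (g : Fin 2 → ℝ) : Fin 2 → ℝ :=
  ![g 1 / (g 0 ^ 2 + g 1 ^ 2), -g 0 / (g 0 ^ 2 + g 1 ^ 2)]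

lemma sq_add_sq_pos_of_ne {g : Fin 2 → ℝ} (hg : g ≠ 0) : 0 < g 0 ^ 2 + g 1 ^ 2 := by
  have h : g 0 ≠ 0 ∨ g 1 ≠ 0 := by
    by_contra! h
    apply hg; ext i; fin_cases i <;> simp [h.1, h.2]
  rcases h with h | h <;> positivity

lemma wedge_dualDir {g : Fin 2 → ℝ} (hg : g ≠ 0) : wedge g (dualDir g) = 1 := by
  have := sq_add_sq_pos_of_ne hg
  simp only [wedge_apply, dualDir, Matrix.cons_val_zero, Matrix.cons_val_one]
  field_simp
  ring

/-- Coordinates on the plane adapted to the direction `g`. -/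
def sliceMap (g : Fin 2 → ℝ) (p : ℝ × ℝ) : Fin 2 → ℝ := p.1 • dualDir g + p.2 • g

lemma wedge_sliceMap {g : Fin 2 → ℝ} (hg : g ≠ 0) (p : ℝ × ℝ) : wedge g (sliceMap g p) = p.1 := by
  simp [sliceMap, wedge_dualDir hg, wedge_self]

lemma continuous_sliceMap (g : Fin 2 → ℝ) : Continuous (sliceMap g) := by
  unfold sliceMap; fun_prop

lemma sliceMap_wedge {g : Fin 2 → ℝ} (hg : g ≠ 0) (x : Fin 2 → ℝ) :
    ∃ s, sliceMap g (wedge g x, s) = x := by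
  have h := sq_add_sq_pos_of_ne hg
  refine ⟨(x 0 * g 0 + x 1 * g 1) / (g 0 ^ 2 + g 1 ^ 2), ?_⟩
  ext i
  fin_cases i <;> simp [sliceMap, dualDir, wedge_apply] <;> field_simp <;> ring

lemma measurePreserving_sliceMap {g : Fin 2 → ℝ} (hg : g ≠ 0) :
    MeasurePreserving (sliceMap g) volume volume := by
  have h := sq_add_sq_pos_of_ne hg
  let M : Matrix (Fin 2) (Fin 2) ℝ := !![dualDir g 0, g 0; dualDir g 1, g 1]
  have hM : M.det = 1 := by
    have := wedge_dualDir hg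
    rw [wedge_apply] at this
    simp only [M, Matrix.det_fin_two_of]
    linarith
  have h1 : MeasurePreserving (Matrix.toLin' M) volume volume := by
    refine ⟨(Matrix.toLin' M).continuous_of_finiteDimensional.measurable, ?_⟩
    rw [Real.map_matrix_volume_pi_eq_smul_volume_pi (by rw [hM]; norm_num), hM]
    simp
  have h2 := h1.comp (volume_preserving_finTwoArrow ℝ).symm
  convert h2 using 1
  ext p i
  fin_cases i <;>
    simp [sliceMap, M, Matrix.toLin'_apply, Matrix.mulVec, dotProduct, Fin.sum_univ_two,
      MeasurableEquiv.finTwoArrow, mul_comm]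

lemma lintegral_slice {g : Fin 2 → ℝ} (hg : g ≠ 0) {f : (Fin 2 → ℝ) → ℝ≥0∞} (hf : Measurable f) :
    ∫⁻ x, f x = ∫⁻ y, ∫⁻ s, f (sliceMap g (y, s)) := by
  rw [← (measurePreserving_sliceMap hg).lintegral_comp hf, Measure.volume_eq_prod]
  exact lintegral_prod (fun p => f (sliceMap g p))
    (hf.comp (continuous_sliceMap g).measurable).aemeasurable

lemma injective_sliceMap {g : Fin 2 → ℝ} (hg : g ≠ 0) : Function.Injective (sliceMap g) := by
  rintro ⟨a, b⟩ ⟨c, d⟩ h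
  have h1 : a = c := by simpa [wedge_sliceMap hg] using congrArg (wedge g) h
  subst h1
  have h2 : b • g = d • g := add_left_cancel h
  rw [smul_left_injective ℝ hg h2]

lemma integral_slice {g : Fin 2 → ℝ} (hg : g ≠ 0) {f : (Fin 2 → ℝ) → ℝ} (hf : Integrable f) :
    ∫ x, f x = ∫ y, ∫ s, f (sliceMap g (y, s)) ∧
      Integrable (fun p => f (sliceMap g p)) ∧
      Integrable (fun y => ∫ s, f (sliceMap g (y, s))) := by
  have h1 := measurePreserving_sliceMap hg
  have he : MeasurableEmbedding (sliceMap g) :=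
    (continuous_sliceMap g).measurable.measurableEmbedding (injective_sliceMap hg)
  have h2 : Integrable (fun p => f (sliceMap g p)) := (h1.integrable_comp_emb he).2 hf
  refine ⟨?_, h2, ?_⟩
  · rw [← h1.integral_comp he, Measure.volume_eq_prod, integral_prod]
    exact h2
  · exact Integrable.integral_prod_left h2

/-- The length of the shadow of `A` in the direction `g`, multiplied by the length of `g`. -/
def shadow (g : Fin 2 → ℝ) (A : Set (Fin 2 → ℝ)) : ℝ≥0∞ := volume (wedge g '' A)

lemma shadow_mono (g : Fin 2 → ℝ) {A B : Set (Fin 2 → ℝ)} (h : A ⊆ B) : shadow g A ≤ shadow g B :=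
  measure_mono (image_mono h)

lemma shadow_vadd (g v : Fin 2 → ℝ) (A : Set (Fin 2 → ℝ)) :
    shadow g ((fun x => x + v) '' A) = shadow g A := by
  have : wedge g '' ((fun x => x + v) '' A) = (fun y => y + wedge g v) '' (wedge g '' A) := by
    simp only [image_image, map_add]
  rw [shadow, this]
  simp [shadow]

lemma shadow_zero (A : Set (Fin 2 → ℝ)) : shadow 0 A = 0 := by
  have : wedge 0 '' A ⊆ {0} := by
    rintro _ ⟨x, -, rfl⟩; simp [wedge_apply]
  exact measure_mono_null this (by simp)

/-- Twice the sum of the shadows in the directions of a finite family of vectors. -/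
def zonoPer {n : ℕ} (g : Fin n → Fin 2 → ℝ) (A : Set (Fin 2 → ℝ)) : ℝ≥0∞ :=
  2 * ∑ j, shadow (g j) A

lemma wedge_isOpenMap {g : Fin 2 → ℝ} (hg : g ≠ 0) : IsOpenMap (wedge g) := by
  apply (wedge g).isOpenMap
  intro y
  exact ⟨y • dualDir g, by simp [wedge_dualDir hg]⟩

open scoped Convolution in
/-- Smooth approximations of indicator functions by mollification. -/
lemma exists_smooth_approx {E : Set (Fin 2 → ℝ)} (hE : MeasurableSet E)
    (hb : Bornology.IsBounded E) {ε : ℝ} (hε : 0 < ε) :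
    ∃ u : (Fin 2 → ℝ) → ℝ, ContDiff ℝ (⊤ : ℕ∞) u ∧ HasCompactSupport u ∧ (∀ x, 0 ≤ u x) ∧
      (∀ x, u x ≤ 1) ∧ (∀ x, u x ≠ 0 → ∃ y ∈ E, dist x y < ε) ∧
      ∫ x, |u x - E.indicator 1 x| ≤ ε ∧
      ∀ D : (Fin 2 → ℝ) → ℝ, Continuous D → HasCompactSupport D → ∀ M : ℝ,
        (∀ z, ∫ x in E, D (x + z) ≤ M) → ∫ x, u x * D x ≤ M := by
  let b : ℕ → ContDiffBump (0 : Fin 2 → ℝ) := fun n =>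
    ⟨1 / ((n : ℝ) + 1), 2 / ((n : ℝ) + 1), by positivity, by gcongr; norm_num⟩
  set f : (Fin 2 → ℝ) → ℝ := E.indicator 1 with hf
  have hEfin : volume E < ⊤ := hb.measure_lt_top
  have hfint : Integrable f := (integrable_indicator_iff hE).2 (integrableOn_const hEfin.ne)
  have hf01 : ∀ x, 0 ≤ f x ∧ f x ≤ 1 := by
    intro x; by_cases hx : x ∈ E <;> simp [hf, hx]
  let u : ℕ → (Fin 2 → ℝ) → ℝ := fun n =>
    (b n).normed volume ⋆[ContinuousLinearMap.lsmul ℝ ℝ, volume] f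
  have hu : ∀ n x, u n x = ∫ t, (b n).normed volume t * f (x - t) := fun n x => by
    simp [u, convolution_def]
  have hint : ∀ n x, Integrable fun t => (b n).normed volume t * f (x - t) := by
    intro n x
    refine ((b n).integrable_normed (μ := volume)).mul_bdd (c := 1) ?_ ?_
    · exact (hfint.comp_sub_left x).aestronglyMeasurable
    · refine Eventually.of_forall fun t => ?_
      rw [Real.norm_eq_abs, abs_of_nonneg (hf01 _).1]; exact (hf01 _).2
  have hu0 : ∀ n x, 0 ≤ u n x := fun n x => by
    rw [hu]; exact integral_nonneg fun t => mul_nonneg ((b n).nonneg_normed _) (hf01 _).1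
  have hu1 : ∀ n x, u n x ≤ 1 := fun n x => by
    rw [hu, ← (b n).integral_normed (μ := volume)]
    refine integral_mono (hint n x) (b n).integrable_normed fun t => ?_
    exact mul_le_of_le_one_right ((b n).nonneg_normed _) (hf01 _).2
  have hsupp : ∀ n x, u n x ≠ 0 → ∃ y ∈ E, dist x y < 2 / ((n : ℝ) + 1) := by
    intro n x hx
    by_contra! hcon
    apply hx
    rw [hu]
    refine integral_eq_zero_of_ae (Eventually.of_forall fun t => ?_)
    by_cases ht : x - t ∈ E
    · have h1 := hcon _ ht
      have h2 : t ∉ Function.support ((b n).normed volume) := by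
        rw [(b n).support_normed_eq]
        simpa [b, dist_eq_norm] using h1
      simp [Function.notMem_support.1 h2]
    · simp [hf, ht]
  have hsmooth : ∀ n, ContDiff ℝ (⊤ : ℕ∞) (u n) := fun n =>
    (b n).hasCompactSupport_normed.contDiff_convolution_left _ (b n).contDiff_normed
      hfint.locallyIntegrable
  obtain ⟨R, hR⟩ := hb.subset_closedBall 0
  have hsuppR : ∀ n x, u n x ≠ 0 → x ∈ Metric.closedBall 0 (R + 2) := by
    intro n x hx
    obtain ⟨y, hy, hxy⟩ := hsupp n x hx
    have h1 := hR hy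
    rw [Metric.mem_closedBall] at h1 ⊢
    have h2 : 2 / ((n : ℝ) + 1) ≤ 2 := by
      apply div_le_self <;> linarith [(Nat.cast_nonneg n : (0 : ℝ) ≤ n)]
    linarith [dist_triangle x y 0]
  have hcs : ∀ n, HasCompactSupport (u n) := fun n =>
    HasCompactSupport.intro (isCompact_closedBall 0 (R + 2)) fun x hx => by
      by_contra h; exact hx (hsuppR n x h)
  have hlim0 : Tendsto (fun n : ℕ => 2 / ((n : ℝ) + 1)) atTop (nhds 0) := by
    have := (tendsto_one_div_add_atTop_nhds_zero_nat (𝕜 := ℝ)).const_mul 2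
    simpa [div_eq_mul_inv] using this
  have hae : ∀ᵐ x, Tendsto (fun n => u n x) atTop (nhds (f x)) := by
    refine ContDiffBump.ae_convolution_tendsto_right_of_locallyIntegrable (K := 2) ?_ ?_
      hfint.locallyIntegrable
    · exact hlim0
    · refine Eventually.of_forall fun n => ?_
      simp only [b]; apply le_of_eq; ring
  have hL1 : Tendsto (fun n => ∫ x, |u n x - f x|) atTop (nhds 0) := by
    have : Tendsto (fun n => ∫ x, |u n x - f x|) atTop (nhds (∫ _ : Fin 2 → ℝ, (0 : ℝ))) := by
      refine tendsto_integral_of_dominated_convergence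
        ((Metric.closedBall (0 : Fin 2 → ℝ) (R + 2)).indicator 1) ?_ ?_ ?_ ?_
      · exact fun n => (((hsmooth n).continuous.aestronglyMeasurable).sub
          hfint.aestronglyMeasurable).norm
      · exact (integrable_indicator_iff measurableSet_closedBall).2
          (integrableOn_const (measure_closedBall_lt_top).ne)
      · refine fun n => Eventually.of_forall fun x => ?_
        rw [Real.norm_eq_abs, abs_abs]
        by_cases hx : x ∈ Metric.closedBall (0 : Fin 2 → ℝ) (R + 2)
        · simp only [hx, indicator_of_mem, Pi.one_apply]
          rw [abs_le]
          constructor <;> linarith [hu0 n x, hu1 n x, (hf01 x).1, (hf01 x).2]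
        · have h1 : u n x = 0 := by by_contra h; exact hx (hsuppR n x h)
          have h2 : f x = 0 := by
            apply indicator_of_notMem
            exact fun h => hx (Metric.closedBall_subset_closedBall (by linarith) (hR h))
          simp [h1, h2, hx]
      · filter_upwards [hae] with x hx
        have := (hx.sub_const (f x)).abs
        simpa using this
    simpa using this
  obtain ⟨n, hn1, hn2⟩ := ((hL1.eventually_le_const hε).and
    (hlim0.eventually_lt_const hε)).exists
  refine ⟨u n, hsmooth n, hcs n, hu0 n, hu1 n, fun x hx => ?_, hn1, ?_⟩
  · obtain ⟨y, hy, h⟩ := hsupp n x hx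
    exact ⟨y, hy, h.trans hn2⟩
  · intro D hD hDc M hM
    have hDint : Integrable D := hD.integrable_of_hasCompactSupport hDc
    have hjoint : Integrable (fun p : (Fin 2 → ℝ) × (Fin 2 → ℝ) =>
        (b n).normed volume p.2 * f (p.1 - p.2) * D p.1) (volume.prod volume) := by
      have h1 : Integrable (fun p : (Fin 2 → ℝ) × (Fin 2 → ℝ) =>
          D p.1 * (b n).normed volume p.2) (volume.prod volume) :=
        hDint.mul_prod (b n).integrable_normed
      have h2 : AEStronglyMeasurable (fun p : (Fin 2 → ℝ) × (Fin 2 → ℝ) => f (p.1 - p.2))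
          (volume.prod volume) := by
        have : Measurable f := measurable_one.indicator hE
        exact (this.comp (measurable_fst.sub measurable_snd)).aestronglyMeasurable
      refine (h1.mul_bdd (c := 1) h2 (Eventually.of_forall fun p => ?_)).congr
        (Eventually.of_forall fun p => ?_)
      · rw [Real.norm_eq_abs, abs_of_nonneg (hf01 _).1]; exact (hf01 _).2
      · ring
    have e1 : ∫ x, u n x * D x
        = ∫ x, ∫ t, (b n).normed volume t * f (x - t) * D x := by
      congr 1; ext x; rw [hu, ← integral_mul_const]
    rw [e1, integral_integral_swap hjoint]
    have e2 : ∀ t, ∫ x, (b n).normed volume t * f (x - t) * D x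
        = (b n).normed volume t * ∫ x in E, D (x + t) := by
      intro t
      rw [← integral_indicator hE, ← integral_const_mul,
        ← integral_add_right_eq_self (fun x => (b n).normed volume t * f (x - t) * D x) t]
      congr 1; ext x
      by_cases hx : x ∈ E <;> simp [hf, hx]
    calc ∫ t, ∫ x, (b n).normed volume t * f (x - t) * D x
        ≤ ∫ t, (b n).normed volume t * M := by
          refine integral_mono ?_ ((b n).integrable_normed.mul_const M) fun t => ?_
          · exact hjoint.integral_prod_right
          · dsimp only
            rw [e2]
            exact mul_le_mul_of_nonneg_left (hM t) ((b n).nonneg_normed _)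
      _ = M := by rw [integral_mul_const, (b n).integral_normed, one_mul]

/-- A smooth approximation of the sign function. -/
def softSign (κ t : ℝ) : ℝ := t / √(t ^ 2 + κ ^ 2)

lemma contDiff_softSign {κ : ℝ} (hκ : 0 < κ) {n : WithTop ℕ∞} : ContDiff ℝ n (softSign κ) := by
  unfold softSign
  have h : ∀ t : ℝ, t ^ 2 + κ ^ 2 ≠ 0 := fun t => by positivity
  refine contDiff_id.div ((by fun_prop : ContDiff ℝ n fun t : ℝ => t ^ 2 + κ ^ 2).sqrt h) ?_
  intro t; have := h t; positivity

lemma abs_softSign_le {κ : ℝ} (hκ : 0 < κ) (t : ℝ) : |softSign κ t| ≤ 1 := by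
  unfold softSign
  have h : 0 < √(t ^ 2 + κ ^ 2) := by positivity
  rw [abs_div, abs_of_pos h, div_le_one h]
  apply Real.abs_le_sqrt; nlinarith

lemma softSign_zero (κ : ℝ) : softSign κ 0 = 0 := by simp [softSign]

lemma abs_sub_le_softSign_mul {κ : ℝ} (hκ : 0 < κ) (t : ℝ) : |t| - κ ≤ softSign κ t * t := by
  unfold softSign
  have h : 0 < √(t ^ 2 + κ ^ 2) := by positivity
  have h1 : √(t ^ 2 + κ ^ 2) ^ 2 = t ^ 2 + κ ^ 2 := Real.sq_sqrt (by positivity)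
  have h2 : √(t ^ 2 + κ ^ 2) ≤ |t| + κ := by
    apply Real.sqrt_le_iff.2
    refine ⟨by positivity, ?_⟩
    nlinarith [sq_abs t, abs_nonneg t]
  rw [div_mul_eq_mul_div, le_div_iff₀ h]
  rcases le_total (|t|) κ with hle | hle
  · nlinarith [sq_nonneg t]
  · nlinarith [sq_abs t, abs_nonneg t]

lemma contDiff_fderiv_apply_const {u : (Fin 2 → ℝ) → ℝ} (hu : ContDiff ℝ (⊤ : ℕ∞) u)
    (g : Fin 2 → ℝ) : ContDiff ℝ (⊤ : ℕ∞) fun x => fderiv ℝ u x g :=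
  (hu.fderiv_right (m := (⊤ : ℕ∞)) (by simp)).clm_apply contDiff_const

lemma hasCompactSupport_fderiv_apply_const {u : (Fin 2 → ℝ) → ℝ} (hu : HasCompactSupport u)
    (g : Fin 2 → ℝ) : HasCompactSupport fun x => fderiv ℝ u x g :=
  hu.fderiv_apply ℝ g

lemma contDiff_softSign_fderiv {u : (Fin 2 → ℝ) → ℝ} (hu : ContDiff ℝ (⊤ : ℕ∞) u)
    (g : Fin 2 → ℝ) {κ : ℝ} (hκ : 0 < κ) :
    ContDiff ℝ 1 fun x => softSign κ (fderiv ℝ u x g) :=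
  (contDiff_softSign hκ).comp ((contDiff_fderiv_apply_const hu g).of_le (by exact_mod_cast le_top))

/-- Integration by parts for the directional derivative. -/
lemma integral_mul_fderiv_apply {u w : (Fin 2 → ℝ) → ℝ} (hu : ContDiff ℝ 1 u)
    (huc : HasCompactSupport u) (hw : ContDiff ℝ 1 w) (g : Fin 2 → ℝ) :
    ∫ x, u x * fderiv ℝ w x g = - ∫ x, fderiv ℝ u x g * w x := by
  have hu' : Continuous fun x => fderiv ℝ u x g :=
    (hu.continuous_fderiv one_ne_zero).clm_apply continuous_const
  have hw' : Continuous fun x => fderiv ℝ w x g :=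
    (hw.continuous_fderiv one_ne_zero).clm_apply continuous_const
  refine integral_mul_fderiv_eq_neg_fderiv_mul_of_integrable ?_ ?_ ?_
    (fun x _ => (hu.differentiable one_ne_zero) x) fun x _ => (hw.differentiable one_ne_zero) x
  · exact (hu'.mul hw.continuous).integrable_of_hasCompactSupport
      ((hasCompactSupport_fderiv_apply_const huc g).mul_right)
  · exact (hu.continuous.mul hw').integrable_of_hasCompactSupport huc.mul_right
  · exact (hu.continuous.mul hw.continuous).integrable_of_hasCompactSupport huc.mul_right

lemma continuous_diverg {η : (Fin 2 → ℝ) → Fin 2 → ℝ} (h : ContDiff ℝ 1 η) :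
    Continuous (diverg η) := by
  unfold diverg
  refine continuous_finsetSum _ fun i _ => ?_
  exact (continuous_apply i).comp ((h.continuous_fderiv one_ne_zero).clm_apply continuous_const)

lemma hasCompactSupport_diverg {η : (Fin 2 → ℝ) → Fin 2 → ℝ} (h : HasCompactSupport η) :
    HasCompactSupport (diverg η) := by
  have h1 := h.fderiv (𝕜 := ℝ)
  exact h1.comp_left (g := fun L : (Fin 2 → ℝ) →L[ℝ] Fin 2 → ℝ => ∑ i, L (Pi.single i 1) i)
    (by simp)

lemma diverg_comp_add {η : (Fin 2 → ℝ) → Fin 2 → ℝ} (z x : Fin 2 → ℝ) :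
    diverg (fun y => η (y + z)) x = diverg η (x + z) := by
  simp [diverg, fderiv_comp_add_right]

lemma clm_eq_sum (ξ : (Fin 2 → ℝ) →L[ℝ] ℝ) (v : Fin 2 → ℝ) :
    ξ v = ∑ i, ξ (Pi.single i 1) * v i := by
  conv_lhs => rw [pi_eq_sum_univ' v]
  simp only [map_sum, map_smul, smul_eq_mul]
  exact Finset.sum_congr rfl fun i _ => mul_comm _ _

lemma integral_mul_diverg {u : (Fin 2 → ℝ) → ℝ} {η : (Fin 2 → ℝ) → Fin 2 → ℝ}
    (hu : ContDiff ℝ 1 u) (huc : HasCompactSupport u) (hη : ContDiff ℝ 1 η) :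
    ∫ x, u x * diverg η x = - ∫ x, fderiv ℝ u x (η x) := by
  have hηi : ∀ i, ContDiff ℝ 1 fun x => η x i := fun i => contDiff_pi.1 hη i
  have hd : ∀ x i, fderiv ℝ η x (Pi.single i 1) i
      = fderiv ℝ (fun y => η y i) x (Pi.single i 1) := fun x i => by
    have := fderiv_pi (𝕜 := ℝ) (φ := fun i y => η y i) (x := x)
      fun i => (hηi i).differentiable one_ne_zero x
    have h2 : fderiv ℝ η x = ContinuousLinearMap.pi fun i => fderiv ℝ (fun y => η y i) x := this
    rw [h2]; rfl
  have hu' : ∀ g, Continuous fun x => fderiv ℝ u x g := fun g =>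
    (hu.continuous_fderiv one_ne_zero).clm_apply continuous_const
  simp only [diverg, hd, Finset.mul_sum]
  rw [integral_finsetSum]
  · simp only [integral_mul_fderiv_apply hu huc (hηi _)]
    rw [Finset.sum_neg_distrib, ← integral_finsetSum]
    · simp only [← clm_eq_sum]
    · intro i _
      exact ((hu' _).mul (hηi i).continuous).integrable_of_hasCompactSupport
        ((hasCompactSupport_fderiv_apply_const huc _).mul_right)
  · intro i _
    exact (hu.continuous.mul (((hηi i).continuous_fderiv one_ne_zero).clm_apply
      continuous_const)).integrable_of_hasCompactSupport huc.mul_right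

lemma integral_abs_le_softSign {u : (Fin 2 → ℝ) → ℝ} (hu : ContDiff ℝ (⊤ : ℕ∞) u)
    (huc : HasCompactSupport u) (g : Fin 2 → ℝ) {κ : ℝ} (hκ : 0 < κ) :
    ∫ x, |fderiv ℝ u x g| ≤
      (∫ x, softSign κ (fderiv ℝ u x g) * fderiv ℝ u x g) + κ * volume.real (tsupport u) := by
  have hc := (contDiff_fderiv_apply_const hu g).continuous
  have hs := hasCompactSupport_fderiv_apply_const huc g
  have hK : MeasurableSet (tsupport u) := (isClosed_tsupport u).measurableSet
  have hKint : Integrable ((tsupport u).indicator fun _ => κ) :=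
    (integrable_indicator_iff hK).2 (integrableOn_const huc.isCompact.measure_lt_top.ne)
  have h1 : Integrable fun x => softSign κ (fderiv ℝ u x g) * fderiv ℝ u x g :=
    (((contDiff_softSign hκ (n := 1)).continuous.comp hc).mul hc).integrable_of_hasCompactSupport
      hs.mul_left
  calc ∫ x, |fderiv ℝ u x g|
      ≤ ∫ x, (softSign κ (fderiv ℝ u x g) * fderiv ℝ u x g + (tsupport u).indicator (fun _ => κ) x) := by
        refine integral_mono (hc.abs.integrable_of_hasCompactSupport
          (hs.comp_left (g := fun t : ℝ => |t|) (by simp))) (h1.add hKint) fun x => ?_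
        by_cases hx : x ∈ tsupport u
        · have := abs_sub_le_softSign_mul hκ (fderiv ℝ u x g)
          simp only [hx, indicator_of_mem]; linarith
        · have h0 : fderiv ℝ u x = 0 := by
            by_contra h
            exact hx (support_fderiv_subset ℝ h)
          simp [h0, hx, softSign_zero]
    _ = _ := by
        rw [integral_add h1 hKint, integral_indicator hK, setIntegral_const, smul_eq_mul, mul_comm κ]

lemma le_of_forall_pos_le_add_mul {a b C : ℝ} (hC : 0 ≤ C) (h : ∀ κ : ℝ, 0 < κ → a ≤ b + κ * C) :
    a ≤ b := by
  refine le_of_forall_pos_le_add fun ε hε => (h (ε / (C + 1)) (by positivity)).trans ?_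
  gcongr
  rw [div_mul_eq_mul_div, div_le_iff₀ (by positivity)]; nlinarith

/-- The total directional variation of a mollification is controlled by the perimeter. -/
lemma sum_integral_abs_fderiv_le {φ : (Fin 2 → ℝ) → ℝ} (hφ : IsNorm φ) {n : ℕ}
    {g : Fin n → Fin 2 → ℝ} {K : ℝ} (hK : 0 < K)
    (hg : ∀ c : Fin n → ℝ, (∀ j, |c j| ≤ 1) → φ (∑ j, c j • g j) ≤ K)
    {E : Set (Fin 2 → ℝ)} (hE : MeasurableSet E) (hP : anisoPerimeter φ E ≠ ⊤)
    {u : (Fin 2 → ℝ) → ℝ} (hu : ContDiff ℝ (⊤ : ℕ∞) u) (huc : HasCompactSupport u)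
    (hD : ∀ D : (Fin 2 → ℝ) → ℝ, Continuous D → HasCompactSupport D → ∀ M : ℝ,
        (∀ z, ∫ x in E, D (x + z) ≤ M) → ∫ x, u x * D x ≤ M) :
    ∑ j, ∫ x, |fderiv ℝ u x (g j)| ≤ K * (anisoPerimeter φ E).toReal := by
  have hu1 : ContDiff ℝ 1 u := hu.of_le (by exact_mod_cast le_top)
  refine le_of_forall_pos_le_add_mul (C := n * volume.real (tsupport u)) (by positivity)
    fun κ hκ => ?_
  have hsc := fun j => contDiff_softSign_fderiv hu (g j) hκ
  set η : (Fin 2 → ℝ) → Fin 2 → ℝ := fun x =>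
    (-K⁻¹) • ∑ j, softSign κ (fderiv ℝ u x (g j)) • g j with hη
  have hηC : ContDiff ℝ 1 η := by
    refine (contDiff_const (c := -K⁻¹)).smul (ContDiff.sum fun j _ => (hsc j).smul (contDiff_const (c := g j)))
  have hηs : HasCompactSupport η :=
    (huc.fderiv (𝕜 := ℝ)).comp_left (g := fun L : (Fin 2 → ℝ) →L[ℝ] ℝ =>
      (-K⁻¹) • ∑ j, softSign κ (L (g j)) • g j) (by simp [softSign_zero])
  have hηφ : ∀ x, φ (η x) ≤ 1 := fun x => by
    simp only [hη]
    rw [hφ.smul_eq, abs_neg, abs_of_pos (by positivity), inv_mul_le_one₀ hK]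
    exact hg _ fun j => abs_softSign_le hκ _
  have hmain : ∫ x, u x * diverg η x ≤ (anisoPerimeter φ E).toReal := by
    refine hD _ (continuous_diverg hηC) (hasCompactSupport_diverg hηs) _ fun z => ?_
    have hadm : (fun y => η (y + z)) ∈ {η : (Fin 2 → ℝ) → (Fin 2 → ℝ) |
      ContDiff ℝ 1 η ∧ HasCompactSupport η ∧ ∀ x, φ (η x) ≤ 1} := by
      refine ⟨hηC.comp (contDiff_id.add contDiff_const), ?_, fun x => hηφ _⟩
      exact hηs.comp_homeomorph (Homeomorph.addRight z)
    have h1 : ENNReal.ofReal (∫ x, E.indicator (1 : (Fin 2 → ℝ) → ℝ) x *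
        diverg (fun y => η (y + z)) x) ≤ anisoPerimeter φ E :=
      le_iSup₂ (f := fun (η : (Fin 2 → ℝ) → (Fin 2 → ℝ)) (_ : η ∈ {η : (Fin 2 → ℝ) → (Fin 2 → ℝ) |
      ContDiff ℝ 1 η ∧ HasCompactSupport η ∧ ∀ x, φ (η x) ≤ 1}) =>
        ENNReal.ofReal (∫ x, E.indicator (1 : (Fin 2 → ℝ) → ℝ) x * diverg η x)) _ hadm
    have h2 := (ENNReal.ofReal_le_iff_le_toReal hP).1 h1
    refine le_trans (le_of_eq ?_) h2
    rw [← integral_indicator hE]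
    congr 1; ext x
    by_cases hx : x ∈ E <;> simp [hx, diverg_comp_add]
  have hint : ∀ j, Integrable fun x => softSign κ (fderiv ℝ u x (g j)) * fderiv ℝ u x (g j) :=
    fun j => ((hsc j).continuous.mul
      (contDiff_fderiv_apply_const hu (g j)).continuous).integrable_of_hasCompactSupport
      (hasCompactSupport_fderiv_apply_const huc (g j)).mul_left
  rw [integral_mul_diverg hu1 huc hηC] at hmain
  have e : ∀ x, fderiv ℝ u x (η x)
      = (-K⁻¹) * ∑ j, softSign κ (fderiv ℝ u x (g j)) * fderiv ℝ u x (g j) := fun x => by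
    simp only [hη, map_smul, map_sum, smul_eq_mul]
  simp only [e] at hmain
  rw [integral_const_mul, integral_finsetSum _ fun j _ => hint j, neg_mul, neg_neg,
    inv_mul_le_iff₀ hK] at hmain
  calc ∑ j, ∫ x, |fderiv ℝ u x (g j)|
      ≤ ∑ j, ((∫ x, softSign κ (fderiv ℝ u x (g j)) * fderiv ℝ u x (g j))
          + κ * volume.real (tsupport u)) :=
        Finset.sum_le_sum fun j _ => integral_abs_le_softSign hu huc (g j) hκ
    _ ≤ _ := by
        rw [Finset.sum_add_distrib]
        simp only [Finset.sum_const, Finset.card_univ, Fintype.card_fin, nsmul_eq_mul]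
        nlinarith [hmain]

lemma exists_ae_eq_Ioc {S : Set ℝ} (hS : Convex ℝ S) (hb : Bornology.IsBounded S)
    (hne : S.Nonempty) : ∃ a b, a ≤ b ∧ S =ᵐ[volume] Ioc a b := by
  have h1 := (IsConnected.Ioo_csInf_csSup_subset ⟨hne, hS.isPreconnected⟩ hb.bddBelow hb.bddAbove)
  have h2 := subset_Icc_csInf_csSup hb.bddBelow hb.bddAbove
  refine ⟨sInf S, sSup S, csInf_le_csSup hne hb.bddBelow hb.bddAbove, ?_⟩
  have h3 : Ioo (sInf S) (sSup S) =ᵐ[volume] Ioc (sInf S) (sSup S) := Ioo_ae_eq_Ioc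
  have h4 : Ioo (sInf S) (sSup S) =ᵐ[volume] Icc (sInf S) (sSup S) := Ioo_ae_eq_Icc
  refine EventuallyLE.antisymm ?_ ?_
  · exact (LE.le.eventuallyLE h2).trans (h4.symm.trans h3).le
  · exact h3.symm.le.trans (LE.le.eventuallyLE h1)

lemma hasDerivAt_comp_sliceMap {w : (Fin 2 → ℝ) → ℝ} (hw : Differentiable ℝ w) (g : Fin 2 → ℝ)
    (y s : ℝ) : HasDerivAt (fun s => w (sliceMap g (y, s))) (fderiv ℝ w (sliceMap g (y, s)) g) s := by
  have h1 : HasDerivAt (fun s : ℝ => sliceMap g (y, s)) g s := by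
    have := ((hasDerivAt_id s).smul_const g).const_add (y • dualDir g)
    simpa [sliceMap] using this
  exact (hw _).hasFDerivAt.comp_hasDerivAt s h1

lemma isBounded_slice {g : Fin 2 → ℝ} (hg : g ≠ 0) {G : Set (Fin 2 → ℝ)}
    (hb : Bornology.IsBounded G) (y : ℝ) : Bornology.IsBounded {s | sliceMap g (y, s) ∈ G} := by
  obtain ⟨R, hR⟩ := hb.subset_closedBall 0
  refine (isBounded_iff_forall_norm_le).2 ⟨(R + ‖y • dualDir g‖) / ‖g‖, fun s hs => ?_⟩
  have h := hR hs
  rw [mem_closedBall_zero_iff] at h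
  rw [le_div_iff₀ (norm_pos_iff.2 hg), ← norm_smul]
  calc ‖s • g‖ = ‖sliceMap g (y, s) - y • dualDir g‖ := by simp [sliceMap]
    _ ≤ _ := (norm_sub_le _ _).trans (by gcongr)

lemma convex_slice {g : Fin 2 → ℝ} {G : Set (Fin 2 → ℝ)}
    (hG : Convex ℝ G) (y : ℝ) : Convex ℝ {s | sliceMap g (y, s) ∈ G} := by
  intro a ha b hb p q hp hq hpq
  have := hG ha hb hp hq hpq
  change sliceMap g (y, p • a + q • b) ∈ G
  convert this using 1
  simp only [sliceMap, smul_eq_mul]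
  have : y • dualDir g = (p + q) • (y • dualDir g) := by rw [hpq, one_smul]
  nth_rewrite 1 [this]
  module

lemma isBounded_wedge_image (g : Fin 2 → ℝ) {G : Set (Fin 2 → ℝ)}
    (hb : Bornology.IsBounded G) : Bornology.IsBounded (wedge g '' G) :=
  (wedge g).lipschitz.isBounded_image hb

lemma shadow_ne_top (g : Fin 2 → ℝ) {G : Set (Fin 2 → ℝ)}
    (hb : Bornology.IsBounded G) : shadow g G ≠ ⊤ :=
  (isBounded_wedge_image g hb).measure_lt_top.ne

lemma zonoPer_ne_top {n : ℕ} (g : Fin n → Fin 2 → ℝ) {G : Set (Fin 2 → ℝ)}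
    (hb : Bornology.IsBounded G) : zonoPer g G ≠ ⊤ :=
  ENNReal.mul_ne_top (by simp) (ENNReal.sum_ne_top.2 fun j _ => shadow_ne_top (g j) hb)

lemma setIntegral_fderiv_le_shadow {G : Set (Fin 2 → ℝ)} (hGo : IsOpen G)
    (hGb : Bornology.IsBounded G) (hG : Convex ℝ G) {w : (Fin 2 → ℝ) → ℝ} (hw : ContDiff ℝ 1 w)
    (hw1 : ∀ x, |w x| ≤ 1) (g : Fin 2 → ℝ) :
    ∫ x in G, fderiv ℝ w x g ≤ 2 * (shadow g G).toReal := by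
  rcases eq_or_ne g 0 with rfl | hg
  · simp
  have hc : Continuous fun x => fderiv ℝ w x g :=
    (hw.continuous_fderiv one_ne_zero).clm_apply continuous_const
  have hint : Integrable (G.indicator fun x => fderiv ℝ w x g) := by
    refine (integrable_indicator_iff hGo.measurableSet).2 ?_
    exact (hc.continuousOn.integrableOn_compact hGb.isCompact_closure).mono_set subset_closure
  obtain ⟨h1, h2, h3⟩ := integral_slice hg hint
  have hopen : IsOpen (wedge g '' G) := wedge_isOpenMap hg G hGo
  have hfin := shadow_ne_top g hGb
  rw [← integral_indicator hGo.measurableSet, h1]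
  calc _ ≤ ∫ y, (wedge g '' G).indicator (fun _ => (2 : ℝ)) y := by
        refine integral_mono h3 ?_ fun y => ?_
        · exact (integrable_indicator_iff hopen.measurableSet).2 (integrableOn_const hfin)
        · by_cases hy : y ∈ wedge g '' G
          · obtain ⟨x, hx, rfl⟩ := hy
            obtain ⟨s, hs⟩ := sliceMap_wedge hg x
            obtain ⟨a, b, hab, hae⟩ := exists_ae_eq_Ioc (convex_slice hG (wedge g x))
              (isBounded_slice hg hGb (wedge g x)) ⟨s, by simpa [hs] using hx⟩
            have hm : MeasurableSet {s | sliceMap g (wedge g x, s) ∈ G} :=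
              (hGo.preimage ((continuous_sliceMap g).comp (by fun_prop))).measurableSet
            have e : (∫ s, G.indicator (fun x => fderiv ℝ w x g) (sliceMap g (wedge g x, s)))
                = ∫ s in a..b, fderiv ℝ w (sliceMap g (wedge g x, s)) g := by
              rw [intervalIntegral.integral_of_le hab, ← setIntegral_congr_set hae,
                ← integral_indicator hm]
              rfl
            dsimp only
            rw [e, intervalIntegral.integral_eq_sub_of_hasDerivAt
              (fun s _ => hasDerivAt_comp_sliceMap (hw.differentiable one_ne_zero) g _ s)
              ((hc.comp ((continuous_sliceMap g).comp (by fun_prop))).intervalIntegrable _ _)]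
            rw [indicator_of_mem (mem_image_of_mem _ hx)]
            have ha := abs_le.1 (hw1 (sliceMap g (wedge g x, a)))
            have hb := abs_le.1 (hw1 (sliceMap g (wedge g x, b)))
            linarith
          · rw [indicator_of_notMem hy]
            refine (integral_eq_zero_of_ae (Eventually.of_forall fun s => ?_)).le
            refine indicator_of_notMem (fun hmem => hy ?_) _
            exact ⟨_, hmem, wedge_sliceMap hg _⟩
    _ = _ := by
        rw [integral_indicator hopen.measurableSet, setIntegral_const, smul_eq_mul, mul_comm]
        rfl

lemma integral_abs_fderiv_le_shadow {G : Set (Fin 2 → ℝ)} (hGo : IsOpen G)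
    (hGb : Bornology.IsBounded G) (hG : Convex ℝ G)
    {u : (Fin 2 → ℝ) → ℝ} (hu : ContDiff ℝ (⊤ : ℕ∞) u) (huc : HasCompactSupport u)
    (hD : ∀ D : (Fin 2 → ℝ) → ℝ, Continuous D → HasCompactSupport D → ∀ M : ℝ,
        (∀ z, ∫ x in G, D (x + z) ≤ M) → ∫ x, u x * D x ≤ M) (g : Fin 2 → ℝ) :
    ∫ x, |fderiv ℝ u x g| ≤ 2 * (shadow g G).toReal := by
  have hu1 : ContDiff ℝ 1 u := hu.of_le (by exact_mod_cast le_top)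
  refine le_of_forall_pos_le_add_mul (C := volume.real (tsupport u)) (by positivity)
    fun κ hκ => (integral_abs_le_softSign hu huc g hκ).trans ?_
  gcongr
  have hsc := contDiff_softSign_fderiv hu g hκ
  set w : (Fin 2 → ℝ) → ℝ := fun x => -softSign κ (fderiv ℝ u x g) with hw
  have hwC : ContDiff ℝ 1 w := hsc.neg
  have hws : HasCompactSupport w :=
    ((hasCompactSupport_fderiv_apply_const huc g).comp_left (g := fun t => -softSign κ t)
      (by simp [softSign_zero]))
  have := hD (fun x => fderiv ℝ w x g) ((hwC.continuous_fderiv one_ne_zero).clm_apply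
    continuous_const) (hasCompactSupport_fderiv_apply_const hws g) (2 * (shadow g G).toReal)
    fun z => by
      have h := setIntegral_fderiv_le_shadow hGo hGb hG (w := fun x => w (x + z))
        (hwC.comp (contDiff_id.add contDiff_const)) (fun x => by
          simp only [hw, abs_neg]; exact abs_softSign_le hκ _) g
      simpa [fderiv_comp_add_right] using h
  rw [integral_mul_fderiv_apply hu1 huc hwC] at this
  refine le_trans (le_of_eq ?_) this
  rw [← integral_neg]
  congr 1; ext x; simp [hw, mul_comm]

/-- The perimeter of a convex set is at most the zonotopal one, when the unit ball of `φ` is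
contained in the zonotope. -/
lemma anisoPerimeter_le_zonoPer {φ : (Fin 2 → ℝ) → ℝ} {n : ℕ} {g : Fin n → Fin 2 → ℝ}
    (hg : ∀ (ξ : (Fin 2 → ℝ) →L[ℝ] ℝ) (v : Fin 2 → ℝ), φ v ≤ 1 → ξ v ≤ ∑ j, |ξ (g j)|)
    {G : Set (Fin 2 → ℝ)} (hGo : IsOpen G) (hGb : Bornology.IsBounded G) (hG : Convex ℝ G) :
    anisoPerimeter φ G ≤ zonoPer g G := by
  refine iSup₂_le fun η hη => ?_
  obtain ⟨hηC, hηs, hηφ⟩ := hη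
  have hfin := zonoPer_ne_top g hGb
  rw [ENNReal.ofReal_le_iff_le_toReal hfin]
  have hdc := continuous_diverg hηC
  obtain ⟨C, hC⟩ := hdc.bounded_above_of_compact_support (hasCompactSupport_diverg hηs)
  have hC0 : 0 ≤ C := (norm_nonneg _).trans (hC 0)
  refine le_of_forall_pos_le_add_mul hC0 fun ε hε => ?_
  obtain ⟨u, hu, huc, hu0, hu1, -, hL1, hD⟩ := exists_smooth_approx hGo.measurableSet hGb hε
  have hu1' : ContDiff ℝ 1 u := hu.of_le (by exact_mod_cast le_top)
  have hdint : Integrable (diverg η) :=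
    hdc.integrable_of_hasCompactSupport (hasCompactSupport_diverg hηs)
  have hfint : Integrable (G.indicator (1 : (Fin 2 → ℝ) → ℝ)) :=
    (integrable_indicator_iff hGo.measurableSet).2 (integrableOn_const hGb.measure_lt_top.ne)
  have huint : Integrable u := hu.continuous.integrable_of_hasCompactSupport huc
  have hi1 : Integrable fun x => G.indicator (1 : (Fin 2 → ℝ) → ℝ) x * diverg η x :=
    hfint.mul_bdd hdc.aestronglyMeasurable (Eventually.of_forall hC)
  have hi2 : Integrable fun x => u x * diverg η x :=
    huint.mul_bdd hdc.aestronglyMeasurable (Eventually.of_forall hC)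
  have hi3 : Integrable fun x => |u x - G.indicator (1 : (Fin 2 → ℝ) → ℝ) x| := (huint.sub hfint).abs
  have hi4 : ∀ j, Integrable fun x => |fderiv ℝ u x (g j)| := fun j =>
    ((contDiff_fderiv_apply_const hu (g j)).continuous.abs).integrable_of_hasCompactSupport
      ((hasCompactSupport_fderiv_apply_const huc (g j)).comp_left (g := fun t : ℝ => |t|) (by simp))
  have hA : ∫ x, u x * diverg η x ≤ (zonoPer g G).toReal := by
    rw [integral_mul_diverg hu1' huc hηC, ← integral_neg]
    calc ∫ x, -fderiv ℝ u x (η x) ≤ ∫ x, ∑ j, |fderiv ℝ u x (g j)| := by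
          refine integral_mono (Integrable.neg ?_) (integrable_finsetSum _ fun j _ => hi4 j) fun x => ?_
          · exact ((hu1'.continuous_fderiv one_ne_zero).clm_apply
              hηC.continuous).integrable_of_hasCompactSupport (by
                refine HasCompactSupport.intro huc.isCompact fun x hx => ?_
                have : fderiv ℝ u x = 0 := by
                  by_contra h; exact hx (support_fderiv_subset ℝ h)
                simp [this])
          · have := hg (-fderiv ℝ u x) (η x) (hηφ x)
            simpa using this
      _ = ∑ j, ∫ x, |fderiv ℝ u x (g j)| := integral_finsetSum _ fun j _ => hi4 j
      _ ≤ ∑ j, 2 * (shadow (g j) G).toReal := Finset.sum_le_sum fun j _ =>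
          integral_abs_fderiv_le_shadow hGo hGb hG hu huc hD (g j)
      _ = _ := by
          rw [zonoPer, ENNReal.toReal_mul, ENNReal.toReal_sum fun j _ => shadow_ne_top (g j) hGb,
            Finset.mul_sum]
          simp
  have hB : (∫ x, G.indicator (1 : (Fin 2 → ℝ) → ℝ) x * diverg η x) - ∫ x, u x * diverg η x
      ≤ ε * C := by
    rw [← integral_sub hi1 hi2]
    calc _ ≤ ∫ x, |u x - G.indicator (1 : (Fin 2 → ℝ) → ℝ) x| * C := by
          refine integral_mono (hi1.sub hi2) (hi3.mul_const C) fun x => ?_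
          dsimp only
          rw [← sub_mul, abs_sub_comm]
          refine (le_abs_self _).trans ?_
          rw [abs_mul]
          exact mul_le_mul_of_nonneg_left (hC x) (abs_nonneg _)
      _ ≤ _ := by rw [integral_mul_const]; gcongr
  linarith

lemma exists_exit_right {f f' : ℝ → ℝ} (hf : ∀ x, HasDerivAt f (f' x) x) (hf' : Continuous f')
    {t t' s₀ s₁ : ℝ} (h0 : t' < f s₀) (h01 : s₀ < s₁) (h1 : f s₁ ≤ t) :
    ∃ c b, s₀ ≤ c ∧ (∀ x, s₀ ≤ x → x < b → t < f x) ∧ (∀ x ∈ Ioo c b, f x ≤ t') ∧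
      ENNReal.ofReal (t' - t) ≤ ∫⁻ x in Ioo c b, ‖f' x‖ₑ := by
  have hc : Continuous f := continuous_iff_continuousAt.2 fun x => (hf x).continuousAt
  set A := Ici s₀ ∩ {s | f s ≤ t} with hA
  have hAc : IsClosed A := isClosed_Ici.inter (isClosed_le hc continuous_const)
  have hAb : BddBelow A := ⟨s₀, fun x hx => hx.1⟩
  have hbA : sInf A ∈ A := hAc.csInf_mem ⟨s₁, h01.le, h1⟩ hAb
  set b := sInf A with hb
  have hbefore : ∀ x, s₀ ≤ x → x < b → t < f x := fun x hx hxb => by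
    by_contra! h
    exact absurd (csInf_le hAb ⟨hx, h⟩) (not_le.2 hxb)
  set B := Icc s₀ b ∩ {s | t' ≤ f s} with hB
  have hBc : IsClosed B := isClosed_Icc.inter (isClosed_le continuous_const hc)
  have hBb : BddAbove B := ⟨b, fun x hx => hx.1.2⟩
  have hcB : sSup B ∈ B := hBc.csSup_mem ⟨s₀, ⟨le_rfl, hbA.1⟩, h0.le⟩ hBb
  set c := sSup B with hcdef
  refine ⟨c, b, hcB.1.1, hbefore, fun x hx => ?_, ?_⟩
  · by_contra! h
    exact absurd (le_csSup hBb ⟨⟨hcB.1.1.trans hx.1.le, hx.2.le⟩, h.le⟩) (not_le.2 hx.1)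
  · have hint := intervalIntegral.integral_eq_sub_of_hasDerivAt (a := c) (b := b)
      (fun x _ => hf x) (hf'.intervalIntegrable _ _)
    rw [intervalIntegral.integral_of_le hcB.1.2] at hint
    have hfb : f b ≤ t := hbA.2
    have hfc : t' ≤ f c := hcB.2
    calc ENNReal.ofReal (t' - t) ≤ ENNReal.ofReal ‖∫ x in Ioc c b, f' x‖ := by
          apply ENNReal.ofReal_le_ofReal
          rw [hint, Real.norm_eq_abs, abs_sub_comm]
          exact le_trans (by linarith) (le_abs_self _)
      _ = ‖∫ x in Ioc c b, f' x‖ₑ := ofReal_norm _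
      _ ≤ ∫⁻ x in Ioc c b, ‖f' x‖ₑ := enorm_integral_le_lintegral_enorm _
      _ = _ := by rw [Measure.restrict_congr_set Ioo_ae_eq_Ioc]

lemma exists_exit_left {f f' : ℝ → ℝ} (hf : ∀ x, HasDerivAt f (f' x) x) (hf' : Continuous f')
    {t t' s₀ s₁ : ℝ} (h0 : t' < f s₀) (h01 : s₁ < s₀) (h1 : f s₁ ≤ t) :
    ∃ b c, c ≤ s₀ ∧ (∀ x, x ≤ s₀ → b < x → t < f x) ∧ (∀ x ∈ Ioo b c, f x ≤ t') ∧
      ENNReal.ofReal (t' - t) ≤ ∫⁻ x in Ioo b c, ‖f' x‖ₑ := by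
  have hd : ∀ x, HasDerivAt (fun y => f (-y)) (-f' (-x)) x := fun x => by
    have := (hf (-x)).scomp x (hasDerivAt_neg x)
    simpa [Function.comp_def] using this
  obtain ⟨c, b, h2, h3, h4, h5⟩ := exists_exit_right hd (by fun_prop)
    (s₀ := -s₀) (s₁ := -s₁) (by simpa using h0) (by linarith) (by simpa using h1)
  refine ⟨-b, -c, by linarith, fun x hx hbx => ?_, fun x hx => ?_, ?_⟩
  · simpa using h3 (-x) (by linarith) (by linarith)
  · simpa using h4 (-x) ⟨by linarith [hx.2], by linarith [hx.1]⟩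
  · refine h5.trans (le_of_eq ?_)
    have := (Measure.measurePreserving_neg (volume : Measure ℝ)).setLIntegral_comp_preimage_emb
      (Homeomorph.neg ℝ).measurableEmbedding (fun x => ‖f' x‖ₑ) (Ioo (-b) (-c))
    rw [← this]
    simp

/-- The slicing inequality on a connected component `U` of a superlevel set. -/
lemma shadow_component_le {u : (Fin 2 → ℝ) → ℝ} (hu : ContDiff ℝ 1 u) (huc : HasCompactSupport u)
    {t t' : ℝ} (ht : 0 ≤ t) {U : Set (Fin 2 → ℝ)} (hUo : IsOpen U)
    (hU : ∀ x ∈ U, ∀ S, IsPreconnected S → x ∈ S → (∀ y ∈ S, t < u y) → S ⊆ U)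
    (g : Fin 2 → ℝ) :
    ENNReal.ofReal (t' - t) * (2 * shadow g (U ∩ {x | t' < u x})) ≤
      ∫⁻ x in U ∩ {x | t < u x ∧ u x ≤ t'}, ‖fderiv ℝ u x g‖ₑ := by
  rcases eq_or_ne g 0 with rfl | hg
  · simp [shadow_zero]
  have hc := hu.continuous
  have hd : Continuous fun x => fderiv ℝ u x g :=
    (hu.continuous_fderiv one_ne_zero).clm_apply continuous_const
  have hMs : MeasurableSet (U ∩ {x | t < u x ∧ u x ≤ t'}) :=
    hUo.measurableSet.inter ((measurableSet_lt measurable_const hc.measurable).inter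
      (measurableSet_le hc.measurable measurable_const))
  have hVo : IsOpen (U ∩ {x | t' < u x}) := hUo.inter (isOpen_lt continuous_const hc)
  have hSo := wedge_isOpenMap hg _ hVo
  rw [← lintegral_indicator hMs, lintegral_slice hg
    ((hd.enorm.measurable).indicator hMs)]
  calc _ = ∫⁻ y, (wedge g '' (U ∩ {x | t' < u x})).indicator
        (fun _ => ENNReal.ofReal (t' - t) * 2) y := by
        rw [lintegral_indicator hSo.measurableSet, setLIntegral_const, shadow, mul_assoc]
    _ ≤ _ := by
        refine lintegral_mono fun y => ?_
        by_cases hy : y ∈ wedge g '' (U ∩ {x | t' < u x})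
        swap
        · rw [indicator_of_notMem hy]; exact zero_le
        rw [indicator_of_mem hy]
        obtain ⟨x, ⟨hxU, hxt⟩, rfl⟩ := hy
        obtain ⟨s₀, hs₀⟩ := sliceMap_wedge hg x
        set y := wedge g x with hydef
        have hslc : Continuous fun s => sliceMap g (y, s) :=
          (continuous_sliceMap g).comp (by fun_prop)
        have hder : ∀ s, HasDerivAt (fun s => u (sliceMap g (y, s)))
            (fderiv ℝ u (sliceMap g (y, s)) g) s :=
          hasDerivAt_comp_sliceMap (hu.differentiable one_ne_zero) g y
        have hbd := isBounded_slice hg huc.isCompact.isBounded y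
        have hout : ∀ s, s ∉ {s | sliceMap g (y, s) ∈ tsupport u} → u (sliceMap g (y, s)) ≤ t :=
          fun s hs => by rw [image_eq_zero_of_notMem_tsupport hs]; exact ht
        obtain ⟨R, hR⟩ := hbd.subset_closedBall s₀
        have hRs : ∀ s, R < |s - s₀| → u (sliceMap g (y, s)) ≤ t := fun s hs => hout s fun hmem => by
          have := hR hmem
          rw [Metric.mem_closedBall, Real.dist_eq] at this
          linarith
        have h0' : t' < u (sliceMap g (y, s₀)) := by rw [hs₀]; exact hxt
        have hR1 : R < |R| + 1 := by linarith [le_abs_self R]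
        obtain ⟨c, b, hc1, hc2, hc3, hc4⟩ := exists_exit_right hder (hd.comp hslc) h0'
          (s₁ := s₀ + (|R| + 1)) (by linarith [abs_nonneg R]) (hRs _ (by
            rw [add_sub_cancel_left, abs_of_pos (by positivity)]; exact hR1))
        obtain ⟨b', c', hc1', hc2', hc3', hc4'⟩ := exists_exit_left hder (hd.comp hslc) h0'
          (s₁ := s₀ - (|R| + 1)) (by linarith [abs_nonneg R]) (hRs _ (by
            rw [sub_sub_cancel_left, abs_neg, abs_of_pos (by positivity)]; exact hR1))
        have hUr : ∀ s, s₀ ≤ s → s < b → sliceMap g (y, s) ∈ U := fun s hs hsb => by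
          refine hU x hxU ((fun s => sliceMap g (y, s)) '' Icc s₀ s)
            (isPreconnected_Icc.image _ hslc.continuousOn) ⟨s₀, ⟨le_rfl, hs⟩, hs₀⟩ ?_
            ⟨s, ⟨hs, le_rfl⟩, rfl⟩
          rintro _ ⟨r, hr, rfl⟩
          exact hc2 r hr.1 (hr.2.trans_lt hsb)
        have hUl : ∀ s, s ≤ s₀ → b' < s → sliceMap g (y, s) ∈ U := fun s hs hsb => by
          refine hU x hxU ((fun s => sliceMap g (y, s)) '' Icc s s₀)
            (isPreconnected_Icc.image _ hslc.continuousOn) ⟨s₀, ⟨hs, le_rfl⟩, hs₀⟩ ?_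
            ⟨s, ⟨le_rfl, hs⟩, rfl⟩
          rintro _ ⟨r, hr, rfl⟩
          exact hc2' r hr.2 (hsb.trans_le hr.1)
        have hdisj : Disjoint (Ioo b' c') (Ioo c b) := by
          rw [Set.disjoint_left]
          intro s hs hs'
          linarith [hs.2, hs'.1]
        have hsub : ∀ s ∈ Ioo b' c' ∪ Ioo c b,
            sliceMap g (y, s) ∈ U ∩ {x | t < u x ∧ u x ≤ t'} := by
          rintro s (hs | hs)
          · exact ⟨hUl s (by linarith [hs.2]) hs.1, hc2' s (by linarith [hs.2]) hs.1, hc3' s hs⟩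
          · exact ⟨hUr s (by linarith [hs.1]) hs.2, hc2 s (by linarith [hs.1]) hs.2, hc3 s hs⟩
        calc ENNReal.ofReal (t' - t) * 2 = ENNReal.ofReal (t' - t) + ENNReal.ofReal (t' - t) :=
              mul_two _
          _ ≤ (∫⁻ s in Ioo b' c', ‖fderiv ℝ u (sliceMap g (y, s)) g‖ₑ) +
              ∫⁻ s in Ioo c b, ‖fderiv ℝ u (sliceMap g (y, s)) g‖ₑ := add_le_add hc4' hc4
          _ = ∫⁻ s in Ioo b' c' ∪ Ioo c b, ‖fderiv ℝ u (sliceMap g (y, s)) g‖ₑ :=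
              (lintegral_union measurableSet_Ioo hdisj).symm
          _ = ∫⁻ s, (Ioo b' c' ∪ Ioo c b).indicator
              (fun s => ‖fderiv ℝ u (sliceMap g (y, s)) g‖ₑ) s :=
              (lintegral_indicator (measurableSet_Ioo.union measurableSet_Ioo) _).symm
          _ ≤ _ := by
              refine lintegral_mono fun s => ?_
              by_cases hs : s ∈ Ioo b' c' ∪ Ioo c b
              · rw [indicator_of_mem hs, indicator_of_mem (hsub s hs)]
              · rw [indicator_of_notMem hs]; exact zero_le

lemma Antitone.exists_frequently_sub_le {W : ℝ → ℝ} (hW : Antitone W) {a b c : ℝ} (hab : a < b)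
    (hb : 0 ≤ W b) (hc0 : 0 ≤ c) (hc : W a < c * (b - a)) :
    ∃ t ∈ Ico a b, ∃ᶠ t' in nhdsWithin t (Ioi t), W t - W t' ≤ c * (t' - t) := by
  by_contra! hcon
  set S := {s ∈ Icc a b | c * (s - a) ≤ W a - W s} with hS
  have haS : a ∈ S := ⟨⟨le_rfl, hab.le⟩, by simp⟩
  have hSb : BddAbove S := ⟨b, fun s hs => hs.1.2⟩
  have hTa : a ≤ sSup S := le_csSup hSb haS
  have hTb : sSup S ≤ b := csSup_le ⟨a, haS⟩ fun s hs => hs.1.2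
  set T := sSup S with hT
  have hTS : c * (T - a) ≤ W a - W T := by
    have : ∀ s ∈ S, s ≤ T ∧ c * (s - a) ≤ W a - W T := fun s hs => by
      have h1 := le_csSup hSb hs
      exact ⟨h1, hs.2.trans (by linarith [hW h1])⟩
    refine le_of_forall_pos_le_add_mul (C := c) hc0 fun ε hε => ?_
    obtain ⟨s, hs, hlt⟩ := exists_lt_of_lt_csSup ⟨a, haS⟩ (sub_lt_self T hε)
    have := (this s hs).2
    nlinarith
  rcases hTb.eq_or_lt with h | h
  · rw [h] at hTS; linarith
  · have h1 := hcon T ⟨hTa, h⟩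
    have h2 : ∀ᶠ t' in nhdsWithin T (Ioi T), t' ∈ Ioo T b := Ioo_mem_nhdsGT h
    obtain ⟨t', h3, h4⟩ := (h1.and h2).exists
    have : t' ∈ S := ⟨⟨hTa.trans h4.1.le, h4.2.le⟩, by linarith⟩
    exact absurd (le_csSup hSb this) (not_le.2 h4.1)

lemma connectedComponentIn_absorb {O : Set (Fin 2 → ℝ)} {z x : Fin 2 → ℝ}
    (hx : x ∈ connectedComponentIn O z) {S : Set (Fin 2 → ℝ)} (hS : IsPreconnected S) (hxS : x ∈ S)
    (hSO : S ⊆ O) : S ⊆ connectedComponentIn O z := by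
  rw [connectedComponentIn_eq hx]
  exact hS.subset_connectedComponentIn hxS hSO

lemma tendsto_shadow_superlevel (g : Fin 2 → ℝ) {u : (Fin 2 → ℝ) → ℝ} {t : ℝ}
    {U : Set (Fin 2 → ℝ)} (hU : ∀ x ∈ U, t < u x) :
    Tendsto (fun n : ℕ => shadow g (U ∩ {x | t + 1 / ((n : ℝ) + 1) < u x})) atTop
      (nhds (shadow g U)) := by
  have hmono : Monotone fun n : ℕ => wedge g '' (U ∩ {x | t + 1 / ((n : ℝ) + 1) < u x}) := by
    intro n m hnm
    refine image_mono (inter_subset_inter_right _ fun x hx => ?_)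
    have hx' : t + 1 / ((n : ℝ) + 1) < u x := hx
    have : 1 / ((m : ℝ) + 1) ≤ 1 / ((n : ℝ) + 1) := by gcongr
    change t + 1 / ((m : ℝ) + 1) < u x
    linarith
  have hunion : ⋃ n : ℕ, wedge g '' (U ∩ {x | t + 1 / ((n : ℝ) + 1) < u x}) = wedge g '' U := by
    rw [← image_iUnion]
    congr 1
    refine Subset.antisymm (iUnion_subset fun n => inter_subset_left) fun x hx => ?_
    obtain ⟨n, hn⟩ := exists_nat_one_div_lt (sub_pos.2 (hU x hx))
    exact mem_iUnion.2 ⟨n, hx, by change t + 1 / ((n : ℝ) + 1) < u x; linarith⟩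
  have := tendsto_measure_iUnion_atTop (μ := (volume : Measure ℝ)) hmono
  rw [hunion] at this
  exact this

/-- A finite family of disjoint pieces of a superlevel set, with the slicing inequality for each
of them, has controlled zonotopal perimeter if the level is suitably chosen. -/
lemma sum_zonoPer_le_of_frequently {n : ℕ} {g : Fin n → Fin 2 → ℝ} {u : (Fin 2 → ℝ) → ℝ}
    (hu : ContDiff ℝ 1 u) (huc : HasCompactSupport u) {t c : ℝ} (ht : 0 ≤ t)
    (hfreq : ∃ᶠ t' in nhdsWithin t (Ioi t),
      (∫ x in {x | t < u x}, ∑ j, |fderiv ℝ u x (g j)|) -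
        (∫ x in {x | t' < u x}, ∑ j, |fderiv ℝ u x (g j)|) ≤ c * (t' - t))
    (𝒰 : Finset (Set (Fin 2 → ℝ))) (hUo : ∀ U ∈ 𝒰, IsOpen U) (hUt : ∀ U ∈ 𝒰, ∀ x ∈ U, t < u x)
    (hdisj : (𝒰 : Set (Set (Fin 2 → ℝ))).PairwiseDisjoint id)
    (hU : ∀ U ∈ 𝒰, ∀ x ∈ U, ∀ S, IsPreconnected S → x ∈ S → (∀ y ∈ S, t < u y) → S ⊆ U) :
    ∑ U ∈ 𝒰, zonoPer g U ≤ ENNReal.ofReal c := by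
  have hcont := hu.continuous
  set F : (Fin 2 → ℝ) → ℝ := fun x => ∑ j, |fderiv ℝ u x (g j)| with hF
  have hd : ∀ j, Continuous fun x => fderiv ℝ u x (g j) := fun j =>
    (hu.continuous_fderiv one_ne_zero).clm_apply continuous_const
  have hFc : Continuous F := continuous_finsetSum _ fun j _ => (hd j).abs
  have hFi : Integrable F := hFc.integrable_of_hasCompactSupport
    ((huc.fderiv (𝕜 := ℝ)).comp_left
      (g := fun L : (Fin 2 → ℝ) →L[ℝ] ℝ => ∑ j, |L (g j)|) (by simp))
  have hF0 : ∀ x, 0 ≤ F x := fun x => Finset.sum_nonneg fun j _ => abs_nonneg _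
  have hFe : ∀ x, ENNReal.ofReal (F x) = ∑ j, ‖fderiv ℝ u x (g j)‖ₑ := fun x => by
    rw [hF, ENNReal.ofReal_sum_of_nonneg fun j _ => abs_nonneg _]
    refine Finset.sum_congr rfl fun j _ => ?_
    rw [← Real.norm_eq_abs, ofReal_norm]
  have hlev : ∀ s, MeasurableSet {x | s < u x} := fun s =>
    measurableSet_lt measurable_const hcont.measurable
  have key : ∀ s, t < s → ∑ U ∈ 𝒰, zonoPer g (U ∩ {x | s < u x}) ≤ ENNReal.ofReal c := by
    intro s hs
    obtain ⟨t', ht', htm⟩ := (hfreq.and_eventually (Ioo_mem_nhdsGT hs)).exists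
    have hpos : 0 < t' - t := sub_pos.2 htm.1
    have hM : MeasurableSet {x | t < u x ∧ u x ≤ t'} :=
      (hlev t).inter (measurableSet_le hcont.measurable measurable_const)
    have h1 : ∑ U ∈ 𝒰, zonoPer g (U ∩ {x | s < u x}) ≤ ∑ U ∈ 𝒰, zonoPer g (U ∩ {x | t' < u x}) := by
      refine Finset.sum_le_sum fun U _ => ?_
      unfold zonoPer
      gcongr with j
      exact shadow_mono _ (inter_subset_inter_right _ fun x hx => htm.2.trans hx)
    refine h1.trans ?_
    have h2 : ENNReal.ofReal (t' - t) * ∑ U ∈ 𝒰, zonoPer g (U ∩ {x | t' < u x})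
        ≤ ENNReal.ofReal (t' - t) * ENNReal.ofReal c := by
      calc _ = ∑ U ∈ 𝒰, ∑ j, ENNReal.ofReal (t' - t) * (2 * shadow (g j) (U ∩ {x | t' < u x})) := by
            simp only [zonoPer, Finset.mul_sum]
        _ ≤ ∑ U ∈ 𝒰, ∑ j, ∫⁻ x in U ∩ {x | t < u x ∧ u x ≤ t'}, ‖fderiv ℝ u x (g j)‖ₑ :=
            Finset.sum_le_sum fun U hUm => Finset.sum_le_sum fun j _ =>
              shadow_component_le hu huc ht (hUo U hUm) (hU U hUm) (g j)
        _ = ∑ U ∈ 𝒰, ∫⁻ x in U ∩ {x | t < u x ∧ u x ≤ t'}, ENNReal.ofReal (F x) := by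
            refine Finset.sum_congr rfl fun U _ => ?_
            simp only [hFe]
            rw [lintegral_finsetSum _ fun j _ => (hd j).enorm.measurable]
        _ = ∫⁻ x in ⋃ U ∈ 𝒰, U ∩ {x | t < u x ∧ u x ≤ t'}, ENNReal.ofReal (F x) := by
            rw [lintegral_biUnion_finset]
            · exact fun U hU V hV hUV => (hdisj hU hV hUV).mono inter_subset_left inter_subset_left
            · exact fun U hUm => (hUo U hUm).measurableSet.inter hM
        _ ≤ ∫⁻ x in {x | t < u x ∧ u x ≤ t'}, ENNReal.ofReal (F x) :=
            lintegral_mono_set (iUnion₂_subset fun U _ => inter_subset_right)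
        _ = ENNReal.ofReal (∫ x in {x | t < u x ∧ u x ≤ t'}, F x) :=
            (ofReal_integral_eq_lintegral_ofReal hFi.integrableOn
              (Eventually.of_forall hF0)).symm
        _ ≤ ENNReal.ofReal (c * (t' - t)) := by
            apply ENNReal.ofReal_le_ofReal
            refine le_trans (le_of_eq ?_) ht'
            have hsub : {x | t' < u x} ⊆ {x | t < u x} := fun x hx => htm.1.trans hx
            rw [← setIntegral_sdiff (hlev t') hFi.integrableOn hsub]
            congr 2
            ext x; simp
        _ = _ := by rw [← ENNReal.ofReal_mul hpos.le, mul_comm]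
    exact (ENNReal.mul_le_mul_iff_right (by simpa using hpos) ENNReal.ofReal_ne_top).1 h2
  have hlim : Tendsto (fun k : ℕ => ∑ U ∈ 𝒰, zonoPer g (U ∩ {x | t + 1 / ((k : ℝ) + 1) < u x}))
      atTop (nhds (∑ U ∈ 𝒰, zonoPer g U)) := by
    refine tendsto_finsetSum _ fun U hUm => ENNReal.Tendsto.const_mul ?_ (Or.inr (by simp))
    exact tendsto_finsetSum _ fun j _ => tendsto_shadow_superlevel (g j) (hUt U hUm)
  exact le_of_tendsto' hlim fun k => key _ (by simp; positivity)

/-- Approximation of a set of finite perimeter by finitely many open connected sets. -/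
lemma exists_open_connected_approx {φ : (Fin 2 → ℝ) → ℝ} (hφ : IsNorm φ) {n : ℕ}
    {g : Fin n → Fin 2 → ℝ} {K : ℝ} (hK : 0 < K)
    (hg : ∀ c : Fin n → ℝ, (∀ j, |c j| ≤ 1) → φ (∑ j, c j • g j) ≤ K)
    {E : Set (Fin 2 → ℝ)} (hE : MeasurableSet E) (hEb : Bornology.IsBounded E)
    (hP : anisoPerimeter φ E ≠ ⊤) {ε : ℝ} (hε : 0 < ε) :
    ∃ 𝒰 : Finset (Set (Fin 2 → ℝ)),
      (∀ U ∈ 𝒰, IsOpen U ∧ IsConnected U ∧ ∀ x ∈ U, ∃ y ∈ E, dist x y < ε) ∧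
      volume (E \ ⋃ U ∈ 𝒰, U) ≤ ENNReal.ofReal ε ∧
      ∑ U ∈ 𝒰, zonoPer g U ≤ ENNReal.ofReal (K * (anisoPerimeter φ E).toReal + ε) := by
  classical
  set p := K * (anisoPerimeter φ E).toReal with hp
  have hp0 : 0 ≤ p := mul_nonneg hK.le ENNReal.toReal_nonneg
  set c := p + ε with hc
  have hc0 : 0 < c := by positivity
  set η := ε / (2 * c) with hη
  have hη0 : 0 < η := by positivity
  have hη1 : η ≤ 1 / 2 := by
    rw [hη, div_le_div_iff₀ (by positivity) (by norm_num)]; linarith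
  have hcη : c * η = ε / 2 := by rw [hη]; field_simp
  obtain ⟨u, hu, huc, hu0, hu1, hsupp, hL1, hD⟩ :=
    exists_smooth_approx hE hEb (ε := min ε (η * (ε / 2))) (by positivity)
  have hu1' : ContDiff ℝ 1 u := hu.of_le (by exact_mod_cast le_top)
  have hcont := hu.continuous
  have hsum := sum_integral_abs_fderiv_le hφ hK hg hE hP hu huc hD
  set F : (Fin 2 → ℝ) → ℝ := fun x => ∑ j, |fderiv ℝ u x (g j)| with hF
  have hd : ∀ j, Continuous fun x => fderiv ℝ u x (g j) := fun j =>
    (hu1'.continuous_fderiv one_ne_zero).clm_apply continuous_const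
  have hFc : Continuous F := continuous_finsetSum _ fun j _ => (hd j).abs
  have hFi : Integrable F := hFc.integrable_of_hasCompactSupport
    ((huc.fderiv (𝕜 := ℝ)).comp_left
      (g := fun L : (Fin 2 → ℝ) →L[ℝ] ℝ => ∑ j, |L (g j)|) (by simp))
  have hF0 : ∀ x, 0 ≤ F x := fun x => Finset.sum_nonneg fun j _ => abs_nonneg _
  have hFp : ∫ x, F x ≤ p := by
    rw [hF, integral_finsetSum _ fun j _ => ?_]
    · exact hsum
    · exact (hd j).abs.integrable_of_hasCompactSupport
        ((hasCompactSupport_fderiv_apply_const huc (g j)).comp_left (g := fun t : ℝ => |t|) (by simp))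
  set W : ℝ → ℝ := fun t => ∫ x in {x | t < u x}, F x with hW
  have hWa : Antitone W := fun s t hst =>
    setIntegral_mono_set hFi.integrableOn (Eventually.of_forall hF0)
      (LE.le.eventuallyLE fun x hx => lt_of_le_of_lt hst hx)
  have hW0 : W 0 ≤ p := (setIntegral_le_integral hFi (Eventually.of_forall hF0)).trans hFp
  obtain ⟨t, ht, hfreq⟩ := hWa.exists_frequently_sub_le (a := 0) (b := 1 - η) (c := c)
    (by linarith) (integral_nonneg fun x => hF0 x) hc0.le (by nlinarith)
  set O := {x | t < u x} with hO
  have hOo : IsOpen O := isOpen_lt continuous_const hcont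
  have hOs : ∀ x ∈ O, u x ≠ 0 := fun x hx => (ht.1.trans_lt hx).ne'
  have hOfin : volume O ≠ ⊤ := ((measure_mono fun x hx => subset_tsupport u (hOs x hx)).trans_lt
    huc.isCompact.measure_lt_top).ne
  have hEO : volume (E \ O) ≤ ENNReal.ofReal (ε / 2) := by
    have hint : Integrable fun x => |u x - E.indicator (1 : (Fin 2 → ℝ) → ℝ) x| :=
      ((hcont.integrable_of_hasCompactSupport huc).sub
        ((integrable_indicator_iff hE).2 (integrableOn_const hEb.measure_lt_top.ne))).abs
    have h1 := mul_meas_ge_le_integral_of_nonneg (Eventually.of_forall fun x => abs_nonneg _) hint η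
    have h2 : volume.real {x | η ≤ |u x - E.indicator (1 : (Fin 2 → ℝ) → ℝ) x|} ≤ ε / 2 := by
      have h3 := h1.trans (hL1.trans (min_le_right _ _))
      exact le_of_mul_le_mul_left h3 hη0
    have h4 : E \ O ⊆ {x | η ≤ |u x - E.indicator (1 : (Fin 2 → ℝ) → ℝ) x|} := by
      rintro x ⟨hxE, hxO⟩
      have hx1 : u x ≤ t := not_lt.1 hxO
      simp only [mem_ofPred_eq, hxE, indicator_of_mem, Pi.one_apply]
      rw [abs_sub_comm]
      exact le_trans (by linarith [ht.2]) (le_abs_self _)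
    refine (measure_mono h4).trans ?_
    rw [← ENNReal.ofReal_toReal (hint.measure_ge_lt_top hη0).ne]
    exact ENNReal.ofReal_le_ofReal h2
  obtain ⟨C, hCO, hCc, hCm⟩ := hOo.measurableSet.exists_isCompact_sdiff_lt hOfin
    (ε := ENNReal.ofReal (ε / 2)) (by simpa using hε)
  obtain ⟨s, hsC, hCs⟩ := hCc.elim_nhds_subcover (connectedComponentIn O) fun x hx =>
    hOo.connectedComponentIn.mem_nhds (mem_connectedComponentIn (hCO hx))
  refine ⟨s.image (connectedComponentIn O), ?_, ?_, ?_⟩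
  · intro U hU
    obtain ⟨x, hx, rfl⟩ := Finset.mem_image.1 hU
    refine ⟨hOo.connectedComponentIn, isConnected_connectedComponentIn_iff.2 (hCO (hsC x hx)),
      fun y hy => ?_⟩
    obtain ⟨z, hz, hyz⟩ := hsupp y (hOs y (connectedComponentIn_subset _ _ hy))
    exact ⟨z, hz, hyz.trans_le (min_le_left _ _)⟩
  · have : E \ ⋃ U ∈ s.image (connectedComponentIn O), U ⊆ (E \ O) ∪ (O \ C) := by
      rintro x ⟨hxE, hx⟩
      by_cases hxO : x ∈ O
      · refine Or.inr ⟨hxO, fun hxC => hx ?_⟩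
        simpa using hCs hxC
      · exact Or.inl ⟨hxE, hxO⟩
    calc _ ≤ volume (E \ O) + volume (O \ C) := (measure_mono this).trans (measure_union_le _ _)
      _ ≤ ENNReal.ofReal (ε / 2) + ENNReal.ofReal (ε / 2) := add_le_add hEO hCm.le
      _ = _ := by rw [← ENNReal.ofReal_add (by positivity) (by positivity), add_halves]
  · refine sum_zonoPer_le_of_frequently hu1' huc ht.1 hfreq _ ?_ ?_ ?_ ?_
    · intro U hU
      obtain ⟨x, hx, rfl⟩ := Finset.mem_image.1 hU
      exact hOo.connectedComponentIn
    · intro U hU y hy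
      obtain ⟨x, hx, rfl⟩ := Finset.mem_image.1 hU
      exact connectedComponentIn_subset O x hy
    · intro U hU V hV hUV
      obtain ⟨x, hx, rfl⟩ := Finset.mem_image.1 hU
      obtain ⟨y, hy, rfl⟩ := Finset.mem_image.1 hV
      refine Set.disjoint_left.2 fun z hz hz' => hUV ?_
      exact (connectedComponentIn_eq hz).trans (connectedComponentIn_eq hz').symm
    · intro U hU y hy S hS hyS hSt
      obtain ⟨x, hx, rfl⟩ := Finset.mem_image.1 hU
      exact connectedComponentIn_absorb hy hS hyS hSt

lemma IsNorm.neg {n : ℕ} {φ : (Fin n → ℝ) → ℝ} (hφ : IsNorm φ) (x : Fin n → ℝ) : φ (-x) = φ x := by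
  have := hφ.smul_eq (-1) x
  simpa using this

lemma IsNorm.map_zero {n : ℕ} {φ : (Fin n → ℝ) → ℝ} (hφ : IsNorm φ) : φ 0 = 0 :=
  (hφ.eq_zero_iff 0).2 rfl

lemma IsNorm.exists_le_norm {φ : (Fin 2 → ℝ) → ℝ} (hφ : IsNorm φ) :
    ∃ M : ℝ, 0 < M ∧ ∀ x, φ x ≤ M * ‖x‖ := by
  refine ⟨φ ![1, 0] + φ ![0, 1] + 1, ?_, fun x => ?_⟩
  · have := hφ.nonneg ![1, 0]; have := hφ.nonneg ![0, 1]; linarith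
  have hx : x = x 0 • ![1, 0] + x 1 • ![0, 1] := by
    ext i; fin_cases i <;> simp
  have h0 := norm_le_pi_norm x 0
  have h1 := norm_le_pi_norm x 1
  rw [Real.norm_eq_abs] at h0 h1
  have h2 := hφ.add_le (x 0 • ![1, 0]) (x 1 • ![0, 1])
  rw [hφ.smul_eq, hφ.smul_eq, ← hx] at h2
  have := mul_le_mul_of_nonneg_right h0 (hφ.nonneg ![1, 0])
  have := mul_le_mul_of_nonneg_right h1 (hφ.nonneg ![0, 1])
  linarith [norm_nonneg x]

lemma IsNorm.abs_sub_le {n : ℕ} {φ : (Fin n → ℝ) → ℝ} (hφ : IsNorm φ) (x y : Fin n → ℝ) :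
    |φ x - φ y| ≤ φ (x - y) := by
  have h1 := hφ.add_le (x - y) y
  have h2 := hφ.add_le (y - x) x
  have h3 := hφ.neg (x - y)
  simp only [sub_add_cancel, neg_sub] at h1 h2 h3
  rw [abs_le]
  constructor <;> linarith

lemma IsNorm.exists_norm_le {φ : (Fin 2 → ℝ) → ℝ} (hφ : IsNorm φ) :
    ∃ k : ℝ, 0 < k ∧ ∀ x, k * ‖x‖ ≤ φ x := by
  obtain ⟨M, hM, hφM⟩ := hφ.exists_le_norm
  have hc : Continuous φ := by
    rw [Metric.continuous_iff]
    intro y ε hε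
    refine ⟨ε / M, by positivity, fun x hx => ?_⟩
    rw [Real.dist_eq]
    rw [dist_eq_norm, lt_div_iff₀ hM] at hx
    linarith [hφ.abs_sub_le x y, hφM (x - y)]
  obtain ⟨z, hz, hmin⟩ := (isCompact_sphere (0 : Fin 2 → ℝ) 1).exists_isMinOn
    (NormedSpace.sphere_nonempty.2 zero_le_one) hc.continuousOn
  have hz1 : ‖z‖ = 1 := by simpa using hz
  refine ⟨φ z, lt_of_le_of_ne (hφ.nonneg z) fun h => ?_, fun x => ?_⟩
  · rw [(hφ.eq_zero_iff z).1 h.symm] at hz1; simp at hz1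
  rcases eq_or_ne x 0 with rfl | hx
  · simp [hφ.map_zero]
  have hx' : 0 < ‖x‖ := norm_pos_iff.2 hx
  have h1 : φ z ≤ φ (‖x‖⁻¹ • x) := hmin (by
    simp [norm_smul, hx'.ne'])
  rw [hφ.smul_eq, abs_of_pos (by positivity)] at h1
  calc φ z * ‖x‖ ≤ ‖x‖⁻¹ * φ x * ‖x‖ := by gcongr
    _ = φ x := by field_simp

/-- The unit vector of angle `t`. -/
def angleVec (t : ℝ) : Fin 2 → ℝ := ![Real.cos t, Real.sin t]

lemma sum_range_add_of_periodic {N : ℕ} {f : ℕ → ℝ} (hf : ∀ i, f (i + N) = f i) (k : ℕ) :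
    ∑ i ∈ Finset.range N, f (k + i) = ∑ i ∈ Finset.range N, f i := by
  induction k with
  | zero => simp
  | succ k ih =>
    rw [← ih]
    have h1 := Finset.sum_range_succ (fun i => f (k + i)) N
    have h2 := Finset.sum_range_succ' (fun i => f (k + i)) N
    have h3 : f (k + N) = f k := hf k
    have h4 : ∀ i, k + 1 + i = k + (i + 1) := fun i => by ring
    simp only [h4]
    simp only [add_zero] at h2
    linarith

lemma sum_second_difference_mul_sin (h : ℝ → ℝ) (t θ : ℝ) (n : ℕ) :
    ∑ i ∈ Finset.range n, (h (t + (i + 1) * θ) + h (t + (i - 1) * θ) -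
        2 * Real.cos θ * h (t + i * θ)) * Real.sin (i * θ) =
      h (t + n * θ) * Real.sin ((n - 1) * θ) - h (t + (n - 1) * θ) * Real.sin (n * θ)
        + h t * Real.sin θ := by
  induction n with
  | zero => simp
  | succ n ih =>
    rw [Finset.sum_range_succ, ih]
    push_cast
    have h1 : ((n : ℝ) + 1) * θ = n * θ + θ := by ring
    have h2 : ((n : ℝ) - 1) * θ = n * θ - θ := by ring
    have h3 : (n : ℝ) + 1 - 1 = n := by ring
    rw [h3, h2, h1, Real.sin_add, Real.sin_sub]
    ring

lemma sum_eq_support {ψ : (Fin 2 → ℝ) → ℝ} (hψ : IsNorm ψ) {N : ℕ} (hN : 2 ≤ N) (k : ℕ) :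
    ∑ j ∈ Finset.range N, (ψ (angleVec ((j + 1) * (Real.pi / N))) +
        ψ (angleVec ((j - 1) * (Real.pi / N))) -
        2 * Real.cos (Real.pi / N) * ψ (angleVec (j * (Real.pi / N)))) /
          (2 * Real.sin (Real.pi / N)) * |Real.sin ((k - j) * (Real.pi / N))| =
      ψ (angleVec (k * (Real.pi / N))) := by
  have hN0 : (0 : ℝ) < N := by positivity
  set θ := Real.pi / N with hθ
  have hθN : N * θ = Real.pi := by rw [hθ]; field_simp
  have hsin : 0 < Real.sin θ := by
    apply Real.sin_pos_of_pos_of_lt_pi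
    · rw [hθ]; positivity
    · rw [hθ, div_lt_iff₀ hN0]
      have : (2 : ℝ) ≤ N := by exact_mod_cast hN
      nlinarith [Real.pi_pos]
  set h : ℝ → ℝ := fun t => ψ (angleVec t) with hh
  have hper : ∀ t, h (t + Real.pi) = h t := fun t => by
    have : angleVec (t + Real.pi) = - angleVec t := by
      ext i; fin_cases i <;> simp [angleVec]
    simp only [hh, this, hψ.neg]
  set f : ℕ → ℝ := fun j => (h ((j + 1) * θ) + h ((j - 1) * θ) - 2 * Real.cos θ * h (j * θ)) /
          (2 * Real.sin θ) * |Real.sin ((k - j) * θ)| with hf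
  change ∑ j ∈ Finset.range N, f j = h (k * θ)
  have hfp : ∀ i, f (i + N) = f i := fun i => by
    simp only [hf]
    push_cast
    have e1 : ((i : ℝ) + N + 1) * θ = (i + 1) * θ + Real.pi := by rw [← hθN]; ring
    have e2 : ((i : ℝ) + N - 1) * θ = (i - 1) * θ + Real.pi := by rw [← hθN]; ring
    have e3 : ((i : ℝ) + N) * θ = i * θ + Real.pi := by rw [← hθN]; ring
    have e4 : ((k : ℝ) - (i + N)) * θ = (k - i) * θ - Real.pi := by rw [← hθN]; ring
    rw [e1, e2, e3, e4, hper, hper, hper, Real.sin_sub_pi, abs_neg]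
  rw [← sum_range_add_of_periodic hfp k]
  have key := sum_second_difference_mul_sin h (k * θ) θ N
  have hterm : ∀ i ∈ Finset.range N, f (k + i) = (h (k * θ + (i + 1) * θ) + h (k * θ + (i - 1) * θ)
      - 2 * Real.cos θ * h (k * θ + i * θ)) * Real.sin (i * θ) / (2 * Real.sin θ) := by
    intro i hi
    simp only [hf]
    push_cast
    have e1 : ((k : ℝ) + i + 1) * θ = k * θ + (i + 1) * θ := by ring
    have e2 : ((k : ℝ) + i - 1) * θ = k * θ + (i - 1) * θ := by ring
    have e3 : ((k : ℝ) + i) * θ = k * θ + i * θ := by ring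
    have e4 : ((k : ℝ) - (k + i)) * θ = - (i * θ) := by ring
    have hs : 0 ≤ Real.sin (i * θ) := by
      apply Real.sin_nonneg_of_nonneg_of_le_pi
      · have : 0 ≤ θ := by rw [hθ]; positivity
        positivity
      · rw [← hθN]
        have : (i : ℝ) ≤ N := by exact_mod_cast (Finset.mem_range.1 hi).le
        have : 0 ≤ θ := by rw [hθ]; positivity
        gcongr
    rw [e1, e2, e3, e4, Real.sin_neg, abs_neg, abs_of_nonneg hs]
    ring
  rw [Finset.sum_congr rfl hterm, ← Finset.sum_div, key]
  have e5 : ((N : ℝ) - 1) * θ = Real.pi - θ := by rw [← hθN]; ring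
  rw [hθN, hper, Real.sin_pi, e5, Real.sin_pi_sub]
  field_simp
  ring

lemma exists_angleVec_eq (x : Fin 2 → ℝ) :
    ∃ R t : ℝ, 0 ≤ R ∧ R ≤ 2 * ‖x‖ ∧ 0 ≤ t ∧ x = R • angleVec t := by
  let z : ℂ := ⟨x 0, x 1⟩
  refine ⟨‖z‖, z.arg + 2 * Real.pi, norm_nonneg _, ?_, ?_, ?_⟩
  · have h0 := norm_le_pi_norm x 0
    have h1 := norm_le_pi_norm x 1
    rw [Real.norm_eq_abs] at h0 h1
    have := Complex.norm_le_abs_re_add_abs_im z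
    simp only [z] at this ⊢
    linarith
  · linarith [Complex.neg_pi_lt_arg z, Real.pi_pos]
  · have h0 := Complex.norm_mul_cos_arg z
    have h1 := Complex.norm_mul_sin_arg z
    ext i; fin_cases i
    · simp [angleVec, z]
    · simp [angleVec, z]

lemma norm_angleVec_sub_le (s t : ℝ) : ‖angleVec s - angleVec t‖ ≤ |s - t| := by
  refine (pi_norm_le_iff_of_nonneg (abs_nonneg _)).2 fun i => ?_
  fin_cases i
  · simpa [angleVec] using Real.abs_cos_sub_cos_le s t
  · simpa [angleVec] using Real.abs_sin_sub_sin_le s t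

/-- In the plane, every norm is approximated by norms whose dual ball is a zonotope. -/
lemma IsNorm.exists_sum_abs_approx {ψ : (Fin 2 → ℝ) → ℝ} (hψ : IsNorm ψ) {δ : ℝ} (hδ : 0 < δ) :
    ∃ (n : ℕ) (g : Fin n → Fin 2 → ℝ), ∀ x, |∑ j, |x ⬝ᵥ g j| - ψ x| ≤ δ * ψ x := by
  obtain ⟨H, hH, hψH⟩ := hψ.exists_le_norm
  obtain ⟨k, hk, hkψ⟩ := hψ.exists_norm_le
  obtain ⟨M, hM⟩ := exists_nat_gt (6 * H * Real.pi / (k * δ))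
  have hM0 : (0 : ℝ) < M := lt_of_le_of_lt (by positivity) hM
  have hM1 : 1 ≤ M := by exact_mod_cast hM0
  set N := 2 * M with hN
  set θ := Real.pi / N with hθ
  have hN0 : (0 : ℝ) < N := by rw [hN]; push_cast; positivity
  have hθ0 : 0 < θ := by positivity
  have hsin : 0 < Real.sin θ := by
    apply Real.sin_pos_of_pos_of_lt_pi hθ0
    rw [hθ, div_lt_iff₀ hN0]
    have : (2 : ℝ) ≤ N := by rw [hN]; exact_mod_cast (by omega : 2 ≤ 2 * M)
    nlinarith [Real.pi_pos]
  set a : ℕ → ℝ := fun j => (ψ (angleVec ((j + 1) * θ)) + ψ (angleVec ((j - 1) * θ)) -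
        2 * Real.cos θ * ψ (angleVec (j * θ))) / (2 * Real.sin θ) with ha
  have ha0 : ∀ j, 0 ≤ a j := fun j => by
    refine div_nonneg ?_ (by positivity)
    have e : angleVec ((j + 1) * θ) + angleVec ((j - 1) * θ)
        = (2 * Real.cos θ) • angleVec (j * θ) := by
      have e1 : ((j : ℝ) + 1) * θ = j * θ + θ := by ring
      have e2 : ((j : ℝ) - 1) * θ = j * θ - θ := by ring
      rw [e1, e2]
      ext i; fin_cases i
      · simp [angleVec, Real.cos_add, Real.cos_sub]; ring
      · simp [angleVec, Real.sin_add, Real.sin_sub]; ring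
    have h1 := hψ.add_le (angleVec ((j + 1) * θ)) (angleVec ((j - 1) * θ))
    rw [e, hψ.smul_eq] at h1
    have h2 := mul_le_mul_of_nonneg_right (le_abs_self (2 * Real.cos θ))
      (hψ.nonneg (angleVec (j * θ)))
    linarith
  set g : Fin N → Fin 2 → ℝ := fun j => a j • ![-Real.sin (j * θ), Real.cos (j * θ)] with hg
  set F : (Fin 2 → ℝ) → ℝ := fun x => ∑ j, |x ⬝ᵥ g j| with hF
  have hFe : ∀ i : ℕ, F (angleVec (i * θ)) = ψ (angleVec (i * θ)) := fun i => by
    rw [← sum_eq_support hψ (by omega : 2 ≤ N) i, Finset.sum_range]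
    refine Finset.sum_congr rfl fun j _ => ?_
    have : angleVec (i * θ) ⬝ᵥ g j = a j * Real.sin ((i - j) * θ) := by
      rw [sub_mul, Real.sin_sub]
      simp [hg, angleVec, dotProduct, Fin.sum_univ_two]; ring
    rw [this, abs_mul, abs_of_nonneg (ha0 j)]
  have hFadd : ∀ x y, F (x + y) ≤ F x + F y := fun x y => by
    simp only [hF]
    rw [← Finset.sum_add_distrib]
    exact Finset.sum_le_sum fun j _ => by rw [add_dotProduct]; exact abs_add_le _ _
  have hFsmul : ∀ (c : ℝ) x, F (c • x) = |c| * F x := fun c x => by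
    simp only [hF, smul_dotProduct, smul_eq_mul, abs_mul, Finset.mul_sum]
  have hv : ∀ t, ‖angleVec t‖ ≤ 1 := fun t => by
    refine (pi_norm_le_iff_of_nonneg zero_le_one).2 fun i => ?_
    fin_cases i
    · simp [angleVec, Real.abs_cos_le_one]
    · simp [angleVec, Real.abs_sin_le_one]
  have hψv : ∀ t, ψ (angleVec t) ≤ H := fun t =>
    (hψH _).trans (by nlinarith [hv t])
  have hF0 : ∀ x, 0 ≤ F x := fun x => Finset.sum_nonneg fun j _ => abs_nonneg _
  have hFH : ∀ x, F x ≤ 2 * H * ‖x‖ := fun x => by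
    have e0 := hFe 0
    have e1 := hFe M
    have hMθ : (M : ℝ) * θ = Real.pi / 2 := by
      rw [hθ, hN]; push_cast; field_simp
    rw [hMθ] at e1
    have hx : x = x 0 • angleVec ((0 : ℕ) * θ) + x 1 • angleVec (Real.pi / 2) := by
      ext i; fin_cases i <;> simp [angleVec]
    have h0 := norm_le_pi_norm x 0
    have h1 := norm_le_pi_norm x 1
    rw [Real.norm_eq_abs] at h0 h1
    have h2 := hFadd (x 0 • angleVec ((0 : ℕ) * θ)) (x 1 • angleVec (Real.pi / 2))
    rw [← hx, hFsmul, hFsmul, e0, e1] at h2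
    have h3 := mul_le_mul h0 (hψv ((0 : ℕ) * θ)) (hψ.nonneg _) (norm_nonneg _)
    have h4 := mul_le_mul h1 (hψv (Real.pi / 2)) (hψ.nonneg _) (norm_nonneg _)
    refine h2.trans ((add_le_add h3 h4).trans (le_of_eq (by ring)))
  refine ⟨N, g, fun x => ?_⟩
  change |F x - ψ x| ≤ δ * ψ x
  obtain ⟨R, t, hR, hRx, ht, hx⟩ := exists_angleVec_eq x
  set i := ⌊t / θ⌋₊ with hi
  have hti : |t - i * θ| ≤ θ := by
    have h1 := Nat.floor_le (div_nonneg ht hθ0.le)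
    have h2 := (Nat.lt_floor_add_one (t / θ)).le
    rw [le_div_iff₀ hθ0] at h1
    rw [div_le_iff₀ hθ0] at h2
    rw [abs_of_nonneg] <;> linarith
  set y := R • angleVec (i * θ) with hy
  have hxy : ‖x - y‖ ≤ 2 * ‖x‖ * θ := by
    rw [hy]
    nth_rw 1 [hx]
    rw [← smul_sub, norm_smul, Real.norm_eq_abs, abs_of_nonneg hR]
    exact mul_le_mul hRx ((norm_angleVec_sub_le _ _).trans hti) (norm_nonneg _) (by positivity)
  have hFy : F y = ψ y := by rw [hy, hFsmul, hψ.smul_eq, hFe]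
  have h1 := hFadd (x - y) y
  have h2 := hFadd (y - x) x
  have h3 : F (y - x) = F (x - y) := by
    rw [← neg_sub, ← neg_one_smul ℝ, hFsmul]; simp
  have h4 := abs_le.1 (hψ.abs_sub_le x y)
  have h5 := hFH (x - y)
  have h6 := hψH (x - y)
  simp only [sub_add_cancel] at h1 h2
  have h7 : 3 * H * ‖x - y‖ ≤ δ * ψ x := by
    calc 3 * H * ‖x - y‖ ≤ 3 * H * (2 * ‖x‖ * θ) := by gcongr
      _ = (6 * H * θ) * ‖x‖ := by ring
      _ ≤ (δ * k) * ‖x‖ := by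
        refine mul_le_mul_of_nonneg_right ?_ (norm_nonneg _)
        rw [hθ, hN]
        push_cast
        rw [div_lt_iff₀ (by positivity)] at hM
        rw [mul_div_assoc', div_le_iff₀ (by positivity)]
        have : 0 < k * δ * M := by positivity
        nlinarith
      _ ≤ _ := by rw [mul_assoc]; gcongr; exact hkψ x
  rw [abs_le]
  constructor <;> linarith

/-- The dual norm. -/
def dualNorm (φ : (Fin 2 → ℝ) → ℝ) (x : Fin 2 → ℝ) : ℝ :=
  sSup ((fun v => x ⬝ᵥ v) '' {v | φ v ≤ 1})

lemma abs_dotProduct_le (x v : Fin 2 → ℝ) : |x ⬝ᵥ v| ≤ 2 * ‖x‖ * ‖v‖ := by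
  have h0 := norm_le_pi_norm x 0
  have h1 := norm_le_pi_norm x 1
  have h2 := norm_le_pi_norm v 0
  have h3 := norm_le_pi_norm v 1
  rw [Real.norm_eq_abs] at h0 h1 h2 h3
  simp only [dotProduct, Fin.sum_univ_two]
  refine (abs_add_le _ _).trans ?_
  rw [abs_mul, abs_mul]
  have := mul_le_mul h0 h2 (abs_nonneg _) (norm_nonneg _)
  have := mul_le_mul h1 h3 (abs_nonneg _) (norm_nonneg _)
  linarith

lemma IsNorm.dotProduct_le_dualNorm {φ : (Fin 2 → ℝ) → ℝ} (hφ : IsNorm φ) (x : Fin 2 → ℝ)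
    {v : Fin 2 → ℝ} (hv : φ v ≤ 1) : x ⬝ᵥ v ≤ dualNorm φ x := by
  obtain ⟨k, hk, hkφ⟩ := hφ.exists_norm_le
  refine le_csSup ⟨2 * ‖x‖ * k⁻¹, ?_⟩ ⟨v, hv, rfl⟩
  rintro _ ⟨w, hw, rfl⟩
  have : ‖w‖ ≤ k⁻¹ := by
    rw [← one_div, le_div_iff₀ hk, mul_comm]; exact (hkφ w).trans hw
  calc x ⬝ᵥ w ≤ 2 * ‖x‖ * ‖w‖ := (le_abs_self _).trans (abs_dotProduct_le x w)
    _ ≤ _ := by gcongr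

lemma IsNorm.dualNorm_le {φ : (Fin 2 → ℝ) → ℝ} (hφ : IsNorm φ) {x : Fin 2 → ℝ} {c : ℝ}
    (h : ∀ v, φ v ≤ 1 → x ⬝ᵥ v ≤ c) : dualNorm φ x ≤ c :=
  csSup_le ⟨_, 0, by simp [hφ.map_zero], rfl⟩ (by rintro _ ⟨v, hv, rfl⟩; exact h v hv)

lemma IsNorm.abs_dotProduct_le_dualNorm {φ : (Fin 2 → ℝ) → ℝ} (hφ : IsNorm φ) (x : Fin 2 → ℝ)
    {v : Fin 2 → ℝ} (hv : φ v ≤ 1) : |x ⬝ᵥ v| ≤ dualNorm φ x := by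
  rw [abs_le']
  refine ⟨hφ.dotProduct_le_dualNorm x hv, ?_⟩
  rw [← dotProduct_neg]
  exact hφ.dotProduct_le_dualNorm x (by rwa [hφ.neg])

lemma IsNorm.isNorm_dualNorm {φ : (Fin 2 → ℝ) → ℝ} (hφ : IsNorm φ) : IsNorm (dualNorm φ) := by
  have h0 : ∀ x, 0 ≤ dualNorm φ x := fun x => by
    simpa using hφ.dotProduct_le_dualNorm x (v := 0) (by simp [hφ.map_zero])
  have hz : dualNorm φ 0 = 0 := le_antisymm (hφ.dualNorm_le fun v _ => by simp) (h0 0)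
  have hle : ∀ (a : ℝ) x, dualNorm φ (a • x) ≤ |a| * dualNorm φ x := fun a x =>
    hφ.dualNorm_le fun v hv => by
      rw [smul_dotProduct, smul_eq_mul]
      refine (le_abs_self _).trans ?_
      rw [abs_mul]
      gcongr
      exact hφ.abs_dotProduct_le_dualNorm x hv
  refine ⟨h0, fun x => ⟨fun h => ?_, fun h => h ▸ hz⟩, fun a x => le_antisymm (hle a x) ?_,
    fun x y => hφ.dualNorm_le fun v hv => ?_⟩
  · by_contra hx
    have hp : 0 < φ x := lt_of_le_of_ne (hφ.nonneg x) fun h' => hx ((hφ.eq_zero_iff x).1 h'.symm)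
    have h1 := hφ.dotProduct_le_dualNorm x (v := (φ x)⁻¹ • x) (by
      rw [hφ.smul_eq, abs_of_pos (by positivity)]; field_simp; rfl)
    rw [h, dotProduct_smul, smul_eq_mul] at h1
    have h2 : 0 < x ⬝ᵥ x := by
      have := sq_add_sq_pos_of_ne hx
      simp only [dotProduct, Fin.sum_univ_two]; nlinarith
    have : 0 < (φ x)⁻¹ * x ⬝ᵥ x := by positivity
    linarith
  · rcases eq_or_ne a 0 with rfl | ha
    · simp [hz]
    have h1 := hle a⁻¹ (a • x)
    rw [smul_smul, inv_mul_cancel₀ ha, one_smul, abs_inv] at h1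
    have : 0 < |a| := abs_pos.2 ha
    calc |a| * dualNorm φ x ≤ |a| * (|a|⁻¹ * dualNorm φ (a • x)) := by gcongr
      _ = _ := by field_simp
  · rw [add_dotProduct]
    exact add_le_add (hφ.dotProduct_le_dualNorm x hv) (hφ.dotProduct_le_dualNorm y hv)

lemma clm_eq_dotProduct (ξ : (Fin 2 → ℝ) →ₗ[ℝ] ℝ) (v : Fin 2 → ℝ) :
    ξ v = ![ξ ![1, 0], ξ ![0, 1]] ⬝ᵥ v := by
  have hv : v = v 0 • ![1, 0] + v 1 • ![0, 1] := by
    ext i; fin_cases i <;> simp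
  nth_rw 1 [hv]
  rw [map_add, map_smul, map_smul]
  simp [dotProduct, Fin.sum_univ_two, mul_comm]

lemma IsNorm.exists_dualNorm_le_one {φ : (Fin 2 → ℝ) → ℝ} (hφ : IsNorm φ) (v : Fin 2 → ℝ) :
    ∃ x, dualNorm φ x ≤ 1 ∧ x ⬝ᵥ v = φ v := by
  rcases eq_or_ne v 0 with rfl | hv
  · exact ⟨0, hφ.dualNorm_le (by simp), by simp [hφ.map_zero]⟩
  let f : (Fin 2 → ℝ) →ₗ.[ℝ] ℝ := LinearPMap.mkSpanSingleton v (φ v) hv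
  obtain ⟨ξ, hξf, hξ⟩ := exists_extension_of_le_sublinear f φ
    (fun c hc x => by rw [hφ.smul_eq, abs_of_pos hc]) hφ.add_le (by
      rintro ⟨x, hx⟩
      obtain ⟨c, rfl⟩ := Submodule.mem_span_singleton.1 hx
      have h1 : f ⟨c • v, hx⟩ = c • φ v := LinearPMap.mkSpanSingleton'_apply v (φ v) _ c hx
      rw [h1]
      simp only [hφ.smul_eq, smul_eq_mul]
      exact mul_le_mul_of_nonneg_right (le_abs_self c) (hφ.nonneg v))
  refine ⟨![ξ ![1, 0], ξ ![0, 1]], hφ.dualNorm_le fun w hw => ?_, ?_⟩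
  · rw [← clm_eq_dotProduct]; exact (hξ w).trans hw
  · rw [← clm_eq_dotProduct]
    have h1 := hξf ⟨v, Submodule.mem_span_singleton_self v⟩
    rw [h1]
    exact LinearPMap.mkSpanSingleton_apply ℝ ℝ hv _

/-- The unit ball of a norm on the plane is squeezed between a zonotope and a slightly smaller
copy of it. -/
lemma IsNorm.exists_zonotope_approx {φ : (Fin 2 → ℝ) → ℝ} (hφ : IsNorm φ) :
    ∃ r C : ℝ, 0 < r ∧ 0 < C ∧ ∀ τ : ℝ, 0 < τ → τ ≤ 1 → ∃ (n : ℕ) (g : Fin n → Fin 2 → ℝ),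
      (∀ c : Fin n → ℝ, (∀ j, |c j| ≤ 1) → φ (∑ j, c j • g j) ≤ 1 + τ) ∧
      (∀ (ξ : (Fin 2 → ℝ) →L[ℝ] ℝ) v, φ v ≤ 1 → ξ v ≤ ∑ j, |ξ (g j)|) ∧
      (∀ x, r * ‖x‖ ≤ ∑ j, |wedge (g j) x|) ∧ ∑ j, ‖g j‖ ≤ C := by
  obtain ⟨M, hM, hφM⟩ := hφ.exists_le_norm
  obtain ⟨k, hk, hkφ⟩ := hφ.exists_norm_le
  refine ⟨M⁻¹, 4 / k, by positivity, by positivity, fun τ hτ hτ1 => ?_⟩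
  obtain ⟨n, g, hg⟩ := hφ.isNorm_dualNorm.exists_sum_abs_approx (δ := τ / 4) (by positivity)
  have hlow : ∀ x, (1 - τ / 4) * dualNorm φ x ≤ ∑ j, |x ⬝ᵥ g j| := fun x => by
    have := (abs_le.1 (hg x)).1; linarith
  have hup : ∀ x, ∑ j, |x ⬝ᵥ g j| ≤ (1 + τ / 4) * dualNorm φ x := fun x => by
    have := (abs_le.1 (hg x)).2; linarith
  have hτ4 : 0 < 1 - τ / 4 := by linarith
  set s := (1 - τ / 4)⁻¹ with hs
  have hs0 : 0 < s := by positivity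
  have hs1 : s * (1 - τ / 4) = 1 := inv_mul_cancel₀ hτ4.ne'
  have Z1 : ∀ c : Fin n → ℝ, (∀ j, |c j| ≤ 1) → φ (∑ j, c j • s • g j) ≤ 1 + τ := fun c hc => by
    obtain ⟨x, hx1, hx⟩ := hφ.exists_dualNorm_le_one (∑ j, c j • s • g j)
    rw [← hx, dotProduct_sum]
    calc ∑ j, x ⬝ᵥ (c j • s • g j) ≤ ∑ j, s * |x ⬝ᵥ g j| := by
          refine Finset.sum_le_sum fun j _ => ?_
          rw [dotProduct_smul, dotProduct_smul, smul_eq_mul, smul_eq_mul]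
          refine (le_abs_self _).trans ?_
          rw [abs_mul, abs_mul, abs_of_pos hs0]
          exact mul_le_of_le_one_left (by positivity) (hc j)
      _ = s * ∑ j, |x ⬝ᵥ g j| := by rw [Finset.mul_sum]
      _ ≤ s * ((1 + τ / 4) * 1) := by
          gcongr
          exact (hup x).trans (mul_le_mul_of_nonneg_left hx1 (by positivity))
      _ ≤ s * ((1 - τ / 4) * (1 + τ)) := by
          refine mul_le_mul_of_nonneg_left ?_ hs0.le
          nlinarith
      _ = 1 + τ := by rw [← mul_assoc, hs1, one_mul]
  have Z2 : ∀ (x v : Fin 2 → ℝ), φ v ≤ 1 → x ⬝ᵥ v ≤ ∑ j, |x ⬝ᵥ (s • g j)| := fun x v hv => by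
    calc x ⬝ᵥ v ≤ dualNorm φ x := hφ.dotProduct_le_dualNorm x hv
      _ = s * ((1 - τ / 4) * dualNorm φ x) := by rw [← mul_assoc, hs1, one_mul]
      _ ≤ s * ∑ j, |x ⬝ᵥ g j| := by gcongr; exact hlow x
      _ = _ := by
        simp only [dotProduct_smul, smul_eq_mul, abs_mul, abs_of_pos hs0, Finset.mul_sum]
  refine ⟨n, fun j => s • g j, Z1, fun ξ v hv => ?_, fun x => ?_, ?_⟩
  · have h1 : ∀ w, ξ w = ![ξ ![1, 0], ξ ![0, 1]] ⬝ᵥ w := fun w => clm_eq_dotProduct ξ.toLinearMap w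
    simp only [h1 v, h1 (s • g _)]
    exact Z2 _ v hv
  · have hw : ∀ j, wedge (s • g j) x = ![-x 1, x 0] ⬝ᵥ (s • g j) := fun j => by
      rw [wedge_apply]; simp [dotProduct, Fin.sum_univ_two]; ring
    simp only [hw]
    have key : ∀ i, |x i| ≤ M * ∑ j, |![-x 1, x 0] ⬝ᵥ (s • g j)| := by
      have h2 : ∀ v : Fin 2 → ℝ, ‖v‖ ≤ 1 →
          ![-x 1, x 0] ⬝ᵥ v ≤ M * ∑ j, |![-x 1, x 0] ⬝ᵥ (s • g j)| := fun v hv => by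
        have := Z2 ![-x 1, x 0] (M⁻¹ • v) (by
          rw [hφ.smul_eq, abs_of_pos (by positivity), inv_mul_le_one₀ hM]
          exact (hφM v).trans (mul_le_of_le_one_right hM.le hv))
        rw [dotProduct_smul, smul_eq_mul, inv_mul_le_iff₀ hM] at this
        exact this
      have hn : ∀ a b : ℝ, |a| ≤ 1 → |b| ≤ 1 → ‖![a, b]‖ ≤ 1 := fun a b ha hb => by
        refine (pi_norm_le_iff_of_nonneg zero_le_one).2 fun i => ?_
        fin_cases i <;> simpa
      intro i
      rw [abs_le']
      fin_cases i
      · exact ⟨by simpa [dotProduct, Fin.sum_univ_two] using h2 ![0, 1] (hn _ _ (by simp) (by simp)),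
          by simpa [dotProduct, Fin.sum_univ_two] using h2 ![0, -1] (hn _ _ (by simp) (by simp))⟩
      · exact ⟨by simpa [dotProduct, Fin.sum_univ_two] using h2 ![-1, 0] (hn _ _ (by simp) (by simp)),
          by simpa [dotProduct, Fin.sum_univ_two] using h2 ![1, 0] (hn _ _ (by simp) (by simp))⟩
    rw [inv_mul_le_iff₀ hM]
    refine (pi_norm_le_iff_of_nonneg ?_).2 key
    positivity
  · have hi : ∀ i, ∑ j, |(s • g j) i| ≤ 2 / k := fun i => by
      have h1 := Z1 (fun j => SignType.sign ((s • g j) i)) fun j => by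
        rcases lt_trichotomy ((s • g j) i) 0 with h | h | h
        · simp only [sign_neg h]; simp
        · simp only [h, sign_zero]; simp
        · simp only [sign_pos h]; simp
      set v := ∑ j, ((SignType.sign ((s • g j) i) : ℝ)) • s • g j with hv
      have h2 : v i = ∑ j, |(s • g j) i| := by
        rw [hv, Finset.sum_apply]
        refine Finset.sum_congr rfl fun j _ => ?_
        rw [Pi.smul_apply, smul_eq_mul]
        exact sign_mul_self _
      have h3 := (le_abs_self _).trans (norm_le_pi_norm v i)
      rw [← h2, le_div_iff₀ hk]
      nlinarith [hkφ v]
    calc ∑ j, ‖s • g j‖ ≤ ∑ j, (|(s • g j) 0| + |(s • g j) 1|) := by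
          refine Finset.sum_le_sum fun j _ => (pi_norm_le_iff_of_nonneg (by positivity)).2 fun i => ?_
          rw [Real.norm_eq_abs]
          fin_cases i
          · simp only [Fin.zero_eta]; linarith [abs_nonneg ((s • g j) 1)]
          · simp only [Fin.mk_one]; linarith [abs_nonneg ((s • g j) 0)]
      _ ≤ 2 / k + 2 / k := by rw [Finset.sum_add_distrib]; exact add_le_add (hi 0) (hi 1)
      _ = 4 / k := by ring

lemma shadow_convexHull (g : Fin 2 → ℝ) {S : Set (Fin 2 → ℝ)} (hS : IsPreconnected S) :
    shadow g (convexHull ℝ S) = shadow g S := by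
  have h1 : Convex ℝ (wedge g '' S) :=
    Real.convex_iff_isPreconnected.2 (hS.image _ (wedge g).continuous.continuousOn)
  have h2 : wedge g '' convexHull ℝ S = wedge g '' S := by
    have := (wedge g).toLinearMap.image_convexHull S
    simp only [ContinuousLinearMap.coe_coe] at this
    rw [this, h1.convexHull_eq]
  rw [shadow, shadow, h2]

lemma zonoPer_convexHull {n : ℕ} (g : Fin n → Fin 2 → ℝ) {S : Set (Fin 2 → ℝ)}
    (hS : IsPreconnected S) : zonoPer g (convexHull ℝ S) = zonoPer g S := by
  simp only [zonoPer, shadow_convexHull _ hS]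

lemma zonoPer_union_le {n : ℕ} (g : Fin n → Fin 2 → ℝ) (A B : Set (Fin 2 → ℝ)) :
    zonoPer g (A ∪ B) ≤ zonoPer g A + zonoPer g B := by
  simp only [zonoPer, ← mul_add, ← Finset.sum_add_distrib]
  gcongr with j
  simp only [shadow, image_union]
  exact measure_union_le _ _

/-- Overlapping sets can be merged until their convex hulls are disjoint. -/
lemma exists_disjoint_hulls {n : ℕ} (g : Fin n → Fin 2 → ℝ) {Ω : Set (Fin 2 → ℝ)}
    (hΩ : Convex ℝ Ω) (N : ℕ) : ∀ 𝒰 : Finset (Set (Fin 2 → ℝ)), 𝒰.card = N →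
    (∀ U ∈ 𝒰, IsOpen U ∧ IsConnected U ∧ U ⊆ Ω) →
    ∃ 𝒳 : Finset (Set (Fin 2 → ℝ)), (∀ X ∈ 𝒳, IsOpen X ∧ IsConnected X ∧ X ⊆ Ω) ∧
      (𝒳 : Set (Set (Fin 2 → ℝ))).PairwiseDisjoint (convexHull ℝ) ∧
      (⋃ U ∈ 𝒰, U) ⊆ ⋃ X ∈ 𝒳, X ∧ ∑ X ∈ 𝒳, zonoPer g X ≤ ∑ U ∈ 𝒰, zonoPer g U := by
  classical
  induction N using Nat.strong_induction_on with
  | _ N ih =>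
  intro 𝒰 hN h𝒰
  by_cases hd : (𝒰 : Set (Set (Fin 2 → ℝ))).PairwiseDisjoint (convexHull ℝ)
  · exact ⟨𝒰, h𝒰, hd, subset_rfl, le_rfl⟩
  simp only [Set.PairwiseDisjoint, Set.Pairwise, Function.onFun] at hd
  push Not at hd
  obtain ⟨A, hA, B, hB, hAB, hdis⟩ := hd
  rw [Set.not_disjoint_iff_nonempty_inter] at hdis
  simp only [Finset.mem_coe] at hA hB
  set C := convexHull ℝ A ∪ convexHull ℝ B with hC
  set 𝒱 := (𝒰.erase A).erase B with h𝒱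
  have hB' : B ∈ 𝒰.erase A := Finset.mem_erase.2 ⟨hAB.symm, hB⟩
  have hcard : (insert C 𝒱).card < N := by
    have h1 := Finset.card_insert_le C 𝒱
    have h2 : 𝒱.card + 1 = _ := Finset.card_erase_add_one hB'
    have h3 := Finset.card_erase_add_one hA
    omega
  have hCp : IsOpen C ∧ IsConnected C ∧ C ⊆ Ω := by
    obtain ⟨hAo, hAc, hAΩ⟩ := h𝒰 A hA
    obtain ⟨hBo, hBc, hBΩ⟩ := h𝒰 B hB
    refine ⟨hAo.convexHull.union hBo.convexHull, ?_,
      union_subset (convexHull_min hAΩ hΩ) (convexHull_min hBΩ hΩ)⟩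
    refine IsConnected.union hdis ⟨hAc.nonempty.convexHull, (convex_convexHull ℝ A).isPreconnected⟩
      ⟨hBc.nonempty.convexHull, (convex_convexHull ℝ B).isPreconnected⟩
  obtain ⟨𝒳, h1, h2, h3, h4⟩ := ih _ hcard (insert C 𝒱) rfl (by
    intro U hU
    rcases Finset.mem_insert.1 hU with rfl | hU
    · exact hCp
    · exact h𝒰 U (Finset.mem_of_mem_erase (Finset.mem_of_mem_erase hU)))
  refine ⟨𝒳, h1, h2, ?_, ?_⟩
  · refine Subset.trans (iUnion₂_subset fun U hU => ?_) h3
    by_cases hUA : U = A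
    · refine Subset.trans ?_ (subset_biUnion_of_mem (u := id) (Finset.mem_insert_self C 𝒱))
      rw [hUA]
      exact (subset_convexHull ℝ A).trans subset_union_left
    by_cases hUB : U = B
    · refine Subset.trans ?_ (subset_biUnion_of_mem (u := id) (Finset.mem_insert_self C 𝒱))
      rw [hUB]
      exact (subset_convexHull ℝ B).trans subset_union_right
    exact subset_biUnion_of_mem (u := id) (Finset.mem_insert_of_mem
      (Finset.mem_erase.2 ⟨hUB, Finset.mem_erase.2 ⟨hUA, hU⟩⟩))
  · refine h4.trans ?_
    rw [← Finset.add_sum_erase _ _ hA, ← Finset.add_sum_erase _ _ hB', ← add_assoc]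
    have h5 : zonoPer g C ≤ zonoPer g A + zonoPer g B := by
      refine (zonoPer_union_le g _ _).trans ?_
      rw [zonoPer_convexHull g (h𝒰 A hA).2.1.isPreconnected,
        zonoPer_convexHull g (h𝒰 B hB).2.1.isPreconnected]
    by_cases hCV : C ∈ 𝒱
    · rw [Finset.insert_eq_of_mem hCV]; exact le_add_self
    · rw [Finset.sum_insert hCV]; gcongr

/-- All one-dimensional projections of the set are intervals, up to closure. -/
def ProjConnected (S : Set (Fin 2 → ℝ)) : Prop :=
  ∀ l : (Fin 2 → ℝ) →L[ℝ] ℝ, Convex ℝ (closure (l '' S))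

lemma Convex.projConnected {S : Set (Fin 2 → ℝ)} (hS : Convex ℝ S) : ProjConnected S :=
  fun l => (hS.linear_image l.toLinearMap).closure

lemma ProjConnected.map_closure_hull {S : Set (Fin 2 → ℝ)} (hS : ProjConnected S)
    (l : (Fin 2 → ℝ) →L[ℝ] ℝ) : l '' closure (convexHull ℝ S) ⊆ closure (l '' S) := by
  have h1 : l '' convexHull ℝ S ⊆ closure (l '' S) := by
    have := l.toLinearMap.image_convexHull S
    simp only [ContinuousLinearMap.coe_coe] at this
    rw [this]
    exact convexHull_min subset_closure (hS l)
  exact (image_closure_subset_closure_image l.continuous).trans (closure_minimal h1 isClosed_closure)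

lemma ProjConnected.union {A B : Set (Fin 2 → ℝ)} (hA : ProjConnected A) (hB : ProjConnected B)
    (h : (closure (convexHull ℝ A) ∩ closure (convexHull ℝ B)).Nonempty) :
    ProjConnected (A ∪ B) := by
  obtain ⟨z, hzA, hzB⟩ := h
  intro l
  rw [image_union, closure_union, Real.convex_iff_isPreconnected]
  exact IsPreconnected.union (l z) (hA.map_closure_hull l ⟨z, hzA, rfl⟩)
    (hB.map_closure_hull l ⟨z, hzB, rfl⟩) (hA l).isPreconnected (hB l).isPreconnected

lemma ProjConnected.translate {S : Set (Fin 2 → ℝ)} (hS : ProjConnected S) (v : Fin 2 → ℝ) :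
    ProjConnected ((fun x => x + v) '' S) := by
  intro l
  have h1 : l '' ((fun x => x + v) '' S) = (Homeomorph.addRight (l v)) '' (l '' S) := by
    simp only [image_image, map_add]; rfl
  rw [h1, ← Homeomorph.image_closure]
  have := (hS l).translate (l v)
  have h2 : (Homeomorph.addRight (l v)) '' closure (l '' S) =
      (fun x => l v + x) '' closure (l '' S) := image_congr' fun x => by simp [add_comm]
  rwa [h2]

lemma eq_smul_of_wedge_eq_zero {d x : Fin 2 → ℝ} (hd : d ≠ 0) (h : wedge d x = 0) :
    ∃ t : ℝ, x = t • d := by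
  obtain ⟨s, hs⟩ := sliceMap_wedge hd x
  exact ⟨s, by rw [← hs, h]; simp [sliceMap]⟩

lemma angleVec_ne_zero (t : ℝ) : angleVec t ≠ 0 := fun h => by
  have h0 : Real.cos t = 0 := by simpa [angleVec] using congrFun h 0
  have h1 : Real.sin t = 0 := by simpa [angleVec] using congrFun h 1
  have := Real.sin_sq_add_cos_sq t
  rw [h0, h1] at this; norm_num at this

lemma abs_wedge_le (g x : Fin 2 → ℝ) : |wedge g x| ≤ 2 * ‖g‖ * ‖x‖ := by
  have : wedge g x = ![g 1, -g 0] ⬝ᵥ x := by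
    rw [wedge_apply]; simp [dotProduct, Fin.sum_univ_two]; ring
  rw [this]
  refine (abs_dotProduct_le _ _).trans ?_
  gcongr
  refine (pi_norm_le_iff_of_nonneg (norm_nonneg _)).2 fun i => ?_
  fin_cases i
  · simpa using norm_le_pi_norm g 1
  · simpa using norm_le_pi_norm g 0

lemma continuous_sSup_wedge_angleVec {A : Set (Fin 2 → ℝ)} (hA : A.Nonempty)
    (hb : Bornology.IsBounded A) : Continuous fun t => sSup (wedge (angleVec t) '' A) := by
  obtain ⟨R, hR⟩ := hb.exists_norm_le
  have hR0 : 0 ≤ R := by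
    obtain ⟨a, ha⟩ := hA
    exact (norm_nonneg a).trans (hR a ha)
  have key : ∀ s t, sSup (wedge (angleVec s) '' A) ≤ sSup (wedge (angleVec t) '' A) +
      2 * R * |s - t| := fun s t => by
    refine csSup_le (hA.image _) ?_
    rintro _ ⟨x, hx, rfl⟩
    have h1 : wedge (angleVec t) x ≤ sSup (wedge (angleVec t) '' A) :=
      le_csSup (isBounded_wedge_image _ hb).bddAbove ⟨x, hx, rfl⟩
    have h2 : wedge (angleVec s) x - wedge (angleVec t) x = wedge (angleVec s - angleVec t) x := by
      simp only [wedge_apply, Pi.sub_apply]; ring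
    have h3 := (le_abs_self _).trans (abs_wedge_le (angleVec s - angleVec t) x)
    have h4 := norm_angleVec_sub_le s t
    have h5 := hR x hx
    have h6 : 2 * ‖angleVec s - angleVec t‖ * ‖x‖ ≤ 2 * |s - t| * R := by gcongr
    linarith
  refine (LipschitzWith.of_dist_le_mul (K := (2 * R).toNNReal) fun s t => ?_).continuous
  rw [Real.dist_eq, Real.dist_eq, abs_le]
  have h1 := key s t
  have h2 := key t s
  rw [abs_sub_comm] at h2
  rw [Real.coe_toNNReal _ (by positivity)]
  constructor <;> linarith

lemma IsOpen.exists_lt_mem {S : Set ℝ} (hS : IsOpen S) {y : ℝ} (hy : y ∈ S) : ∃ z ∈ S, y < z := by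
  obtain ⟨ε, hε, h⟩ := Metric.isOpen_iff.1 hS y hy
  exact ⟨y + ε / 2, h (by rw [Metric.mem_ball, Real.dist_eq, add_sub_cancel_left,
    abs_of_pos (by positivity)]; linarith), by linarith⟩

lemma IsOpen.exists_gt_mem {S : Set ℝ} (hS : IsOpen S) {y : ℝ} (hy : y ∈ S) : ∃ z ∈ S, z < y := by
  obtain ⟨ε, hε, h⟩ := Metric.isOpen_iff.1 hS y hy
  exact ⟨y - ε / 2, h (by rw [Metric.mem_ball, Real.dist_eq, sub_sub_cancel_left, abs_neg,
    abs_of_pos (by positivity)]; linarith), by linarith⟩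

lemma subset_of_sSup_eq {S T : Set ℝ} (hSo : IsOpen S) (hS : Bornology.IsBounded S)
    (hTne : T.Nonempty) (hT : Convex ℝ T) (hsup : sSup S = sSup T)
    (hinf : sInf T ≤ sInf S) : S ⊆ T := by
  intro y hy
  obtain ⟨z, hz, hyz⟩ := hSo.exists_lt_mem hy
  obtain ⟨w, hw, hwy⟩ := hSo.exists_gt_mem hy
  have h1 : y < sSup T := hyz.trans_le (hsup ▸ le_csSup hS.bddAbove hz)
  have h2 : sInf T < y := hinf.trans_lt ((csInf_le hS.bddBelow hw).trans_lt hwy)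
  obtain ⟨a, ha, hay⟩ := exists_lt_of_lt_csSup hTne h1
  obtain ⟨b, hb, hby⟩ := exists_lt_of_csInf_lt hTne h2
  exact hT.ordConnected.out hb ha ⟨hby.le, hay.le⟩

/-- One of two disjoint open convex planar sets can be translated into the other. -/
lemma exists_direction {A B : Set (Fin 2 → ℝ)} (hA : Convex ℝ A) (hB : Convex ℝ B)
    (hAo : IsOpen A) (hBo : IsOpen B) (hAb : Bornology.IsBounded A) (hBb : Bornology.IsBounded B)
    (hAne : A.Nonempty) (hBne : B.Nonempty) (hd : Disjoint A B) :
    ∃ d : Fin 2 → ℝ, (∀ y ∈ B, ∃ t : ℝ, 0 < t ∧ y + t • d ∈ A) ∨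
      (∀ y ∈ A, ∃ t : ℝ, 0 < t ∧ y + t • d ∈ B) := by
  obtain ⟨f, u, hfA, hfB⟩ := geometric_hahn_banach_open_open hA hAo hB hBo hd
  obtain ⟨R, t₀, hR, -, -, hw⟩ := exists_angleVec_eq ![-f ![0, 1], f ![1, 0]]
  have hf : ∀ x, f x = R * wedge (angleVec t₀) x := fun x => by
    have h1 : f x = ![f ![1, 0], f ![0, 1]] ⬝ᵥ x := clm_eq_dotProduct f.toLinearMap x
    have h2 := congrFun hw 0
    have h3 := congrFun hw 1
    simp only [Matrix.cons_val_zero, Matrix.cons_val_one, Pi.smul_apply, smul_eq_mul] at h2 h3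
    rw [h1, wedge_apply]
    simp only [dotProduct, Fin.sum_univ_two, Matrix.cons_val_zero, Matrix.cons_val_one]
    linear_combination x 0 * h3 - x 1 * h2
  have hR0 : 0 < R := by
    refine lt_of_le_of_ne hR fun h => ?_
    obtain ⟨a, ha⟩ := hAne
    obtain ⟨b, hb⟩ := hBne
    have h1 := hfA a ha
    have h2 := hfB b hb
    rw [hf, ← h, zero_mul] at h1 h2
    exact absurd (h1.trans h2) (lt_irrefl _)
  have hlt : ∀ a ∈ A, ∀ b ∈ B, wedge (angleVec t₀) a ≤ wedge (angleVec t₀) b := fun a ha b hb => by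
    have := (hfA a ha).trans (hfB b hb)
    rw [hf, hf] at this
    exact (lt_of_mul_lt_mul_left this hR).le
  set M : ℝ → ℝ := fun t => sSup (wedge (angleVec t) '' A) - sSup (wedge (angleVec t) '' B) with hM
  have hMc : Continuous M :=
    (continuous_sSup_wedge_angleVec hAne hAb).sub (continuous_sSup_wedge_angleVec hBne hBb)
  have hneg : ∀ x, wedge (angleVec (t₀ + Real.pi)) x = - wedge (angleVec t₀) x := fun x => by
    simp only [wedge_apply, angleVec, Real.cos_add_pi, Real.sin_add_pi, Matrix.cons_val_zero,
      Matrix.cons_val_one]; ring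
  have hM0 : M t₀ ≤ 0 := by
    obtain ⟨b, hb⟩ := hBne
    have h1 : sSup (wedge (angleVec t₀) '' A) ≤ wedge (angleVec t₀) b :=
      csSup_le (hAne.image _) (by rintro _ ⟨a, ha, rfl⟩; exact hlt a ha b hb)
    have h2 := le_csSup (isBounded_wedge_image (angleVec t₀) hBb).bddAbove ⟨b, hb, rfl⟩
    simp only [hM]; linarith
  have hM1 : 0 ≤ M (t₀ + Real.pi) := by
    obtain ⟨a, ha⟩ := hAne
    have h1 : sSup (wedge (angleVec (t₀ + Real.pi)) '' B) ≤ wedge (angleVec (t₀ + Real.pi)) a :=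
      csSup_le (hBne.image _) (by
        rintro _ ⟨b, hb, rfl⟩; rw [hneg, hneg]; exact neg_le_neg (hlt a ha b hb))
    have h2 := le_csSup (isBounded_wedge_image (angleVec (t₀ + Real.pi)) hAb).bddAbove ⟨a, ha, rfl⟩
    simp only [hM]; linarith
  obtain ⟨t, -, ht⟩ := intermediate_value_Icc (by linarith [Real.pi_pos] : t₀ ≤ t₀ + Real.pi)
    hMc.continuousOn ⟨hM0, hM1⟩
  have hsup : sSup (wedge (angleVec t) '' A) = sSup (wedge (angleVec t) '' B) := sub_eq_zero.1 ht
  have ht0 := angleVec_ne_zero t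
  have himA : Convex ℝ (wedge (angleVec t) '' A) := hA.linear_image (wedge (angleVec t)).toLinearMap
  have himB : Convex ℝ (wedge (angleVec t) '' B) := hB.linear_image (wedge (angleVec t)).toLinearMap
  have main : ∀ (f : (Fin 2 → ℝ) →L[ℝ] ℝ) (S T : Set (Fin 2 → ℝ)) (u : ℝ), (∀ x ∈ S, f x < u) →
      (∀ x ∈ T, u < f x) → wedge (angleVec t) '' T ⊆ wedge (angleVec t) '' S →
      ∃ d : Fin 2 → ℝ, ∀ y ∈ T, ∃ s : ℝ, 0 < s ∧ y + s • d ∈ S := by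
    intro f S T u hS hT hST
    have h1 : ∀ y ∈ T, ∃ s : ℝ, y + s • angleVec t ∈ S ∧ s * f (angleVec t) < 0 := fun y hy => by
      obtain ⟨a, ha, hay⟩ := hST ⟨y, hy, rfl⟩
      obtain ⟨s, hs⟩ := eq_smul_of_wedge_eq_zero ht0 (x := a - y) (by rw [map_sub, hay, sub_self])
      have h2 : y + s • angleVec t = a := by rw [← hs]; abel
      refine ⟨s, h2 ▸ ha, ?_⟩
      have h3 := (hS a ha).trans (hT y hy)
      rw [← h2, map_add, map_smul, smul_eq_mul] at h3
      linarith
    rcases lt_trichotomy (f (angleVec t)) 0 with h | h | h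
    · refine ⟨angleVec t, fun y hy => ?_⟩
      obtain ⟨s, hs, hs'⟩ := h1 y hy
      exact ⟨s, by nlinarith, hs⟩
    · refine ⟨0, fun y hy => ?_⟩
      obtain ⟨s, hs, hs'⟩ := h1 y hy
      rw [h, mul_zero] at hs'
      exact absurd hs' (lt_irrefl _)
    · refine ⟨-angleVec t, fun y hy => ?_⟩
      obtain ⟨s, hs, hs'⟩ := h1 y hy
      exact ⟨-s, by nlinarith, by simpa using hs⟩
  rcases le_total (sInf (wedge (angleVec t) '' A)) (sInf (wedge (angleVec t) '' B)) with h | h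
  · obtain ⟨d, hd⟩ := main f A B u hfA hfB (subset_of_sSup_eq (wedge_isOpenMap ht0 _ hBo)
      (isBounded_wedge_image _ hBb) (hAne.image _) himA hsup.symm h)
    exact ⟨d, Or.inl hd⟩
  · obtain ⟨d, hd⟩ := main (-f) B A (-u) (fun x hx => neg_lt_neg (hfB x hx))
      (fun x hx => neg_lt_neg (hfA x hx)) (subset_of_sSup_eq (wedge_isOpenMap ht0 _ hAo)
      (isBounded_wedge_image _ hAb) (hBne.image _) himB hsup h)
    exact ⟨d, Or.inr hd⟩

/-- The translate of a set by `v`. -/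
def shift (v : Fin 2 → ℝ) (S : Set (Fin 2 → ℝ)) : Set (Fin 2 → ℝ) := (fun x => x + v) '' S

lemma mem_shift {v x : Fin 2 → ℝ} {S : Set (Fin 2 → ℝ)} : x ∈ shift v S ↔ x - v ∈ S := by
  constructor
  · rintro ⟨y, hy, rfl⟩; simpa
  · intro h; exact ⟨x - v, h, by simp⟩

lemma shift_zero (S : Set (Fin 2 → ℝ)) : shift 0 S = S := by ext x; simp [mem_shift]

lemma shift_shift (u v : Fin 2 → ℝ) (S : Set (Fin 2 → ℝ)) :
    shift v (shift u S) = shift (u + v) S := by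
  ext x; simp only [mem_shift]; congr! 1; abel

lemma shift_union (v : Fin 2 → ℝ) (S T : Set (Fin 2 → ℝ)) :
    shift v (S ∪ T) = shift v S ∪ shift v T := image_union _ _ _

lemma shift_mono (v : Fin 2 → ℝ) {S T : Set (Fin 2 → ℝ)} (h : S ⊆ T) : shift v S ⊆ shift v T :=
  image_mono h

lemma disjoint_shift {v : Fin 2 → ℝ} {S T : Set (Fin 2 → ℝ)} (h : Disjoint S T) :
    Disjoint (shift v S) (shift v T) := by
  rw [Set.disjoint_left] at h ⊢
  intro x hx hx'
  rw [mem_shift] at hx hx'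
  exact h hx hx'

lemma shift_eq_homeomorph (v : Fin 2 → ℝ) (S : Set (Fin 2 → ℝ)) :
    shift v S = Homeomorph.addRight v '' S := rfl

lemma IsOpen.shift {S : Set (Fin 2 → ℝ)} (hS : IsOpen S) (v : Fin 2 → ℝ) : IsOpen (shift v S) := by
  rw [shift_eq_homeomorph]; exact (Homeomorph.addRight v).isOpenMap S hS

lemma closure_shift (v : Fin 2 → ℝ) (S : Set (Fin 2 → ℝ)) :
    closure (shift v S) = shift v (closure S) := by
  rw [shift_eq_homeomorph, shift_eq_homeomorph, Homeomorph.image_closure]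

lemma Convex.shift {S : Set (Fin 2 → ℝ)} (hS : Convex ℝ S) (v : Fin 2 → ℝ) :
    Convex ℝ (shift v S) := by
  rintro x hx y hy a b ha hb hab
  rw [mem_shift] at *
  convert hS hx hy ha hb hab using 1
  rw [smul_sub, smul_sub, sub_add_sub_comm, ← add_smul, hab, one_smul]

lemma convexHull_shift (v : Fin 2 → ℝ) (S : Set (Fin 2 → ℝ)) :
    convexHull ℝ (shift v S) = shift v (convexHull ℝ S) := by
  refine Subset.antisymm (convexHull_min (shift_mono v (subset_convexHull ℝ S))
    ((convex_convexHull ℝ S).shift v)) ?_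
  rintro _ ⟨x, hx, rfl⟩
  have h1 : convexHull ℝ S ⊆ shift (-v) (convexHull ℝ (shift v S)) := by
    refine convexHull_min (fun y hy => ?_) ((convex_convexHull ℝ _).shift _)
    rw [mem_shift, sub_neg_eq_add]
    exact subset_convexHull ℝ _ ⟨y, hy, rfl⟩
  have := h1 hx
  rwa [mem_shift, sub_neg_eq_add] at this

lemma isBounded_shift {S : Set (Fin 2 → ℝ)} (hS : Bornology.IsBounded S) (v : Fin 2 → ℝ) :
    Bornology.IsBounded (shift v S) := by
  obtain ⟨R, hR⟩ := hS.exists_norm_le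
  refine (isBounded_iff_forall_norm_le).2 ⟨R + ‖v‖, ?_⟩
  rintro _ ⟨x, hx, rfl⟩
  exact (norm_add_le _ _).trans (by linarith [hR x hx])

open scoped Pointwise in
/-- Sliding an open convex set `B` in the direction `d` until it touches one of the obstacles `C i`. -/
lemma exists_slide {ι : Type*} {s : Finset ι} {C : ι → Set (Fin 2 → ℝ)} {B Ω : Set (Fin 2 → ℝ)}
    (hC : ∀ i ∈ s, IsOpen (C i) ∧ C i ⊆ Ω ∧ Bornology.IsBounded (C i) ∧ Disjoint B (C i))
    (hBne : B.Nonempty) (hBb : Bornology.IsBounded B) (hBΩ : B ⊆ Ω) (hΩ : Convex ℝ Ω)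
    {d : Fin 2 → ℝ} {a : ι} (ha : a ∈ s) (hd : ∀ y ∈ B, ∃ t : ℝ, 0 < t ∧ y + t • d ∈ C a) :
    ∃ u, shift u B ⊆ Ω ∧ (∀ i ∈ s, Disjoint (shift u B) (C i)) ∧
      ∃ k ∈ s, (closure (shift u B) ∩ closure (C k)).Nonempty := by
  set T : Set ℝ := {t | 0 ≤ t ∧ ∃ k ∈ s, (shift (t • d) B ∩ C k).Nonempty} with hT
  have hmemT : ∀ y ∈ B, ∀ t : ℝ, 0 < t → y + t • d ∈ C a → t ∈ T := fun y hy t ht h =>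
    ⟨ht.le, a, ha, y + t • d, ⟨y, hy, rfl⟩, h⟩
  have hTne : T.Nonempty := by
    obtain ⟨y, hy⟩ := hBne
    obtain ⟨t, ht, h⟩ := hd y hy
    exact ⟨t, hmemT y hy t ht h⟩
  have hTb : BddBelow T := ⟨0, fun t ht => ht.1⟩
  set t₀ := sInf T with ht₀
  have ht₀0 : 0 ≤ t₀ := le_csInf hTne fun t ht => ht.1
  refine ⟨t₀ • d, ?_, fun k hk => ?_, ?_⟩
  · rintro _ ⟨y, hy, rfl⟩
    obtain ⟨t, ht, h⟩ := hd y hy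
    have h1 : t₀ ≤ t := csInf_le hTb (hmemT y hy t ht h)
    have h2 : y + t₀ • d ∈ segment ℝ y (y + t • d) := by
      refine ⟨1 - t₀ / t, t₀ / t, ?_, by positivity, by ring, ?_⟩
      · rw [sub_nonneg, div_le_one ht]; exact h1
      · rw [smul_add, smul_smul, div_mul_cancel₀ _ ht.ne', ← add_assoc, ← add_smul]
        simp
    exact hΩ.segment_subset (hBΩ hy) ((hC a ha).2.1 h) h2
  · rw [Set.disjoint_left]
    rintro _ ⟨y, hy, rfl⟩ hyC
    obtain ⟨hCo, -, -, hdis⟩ := hC k hk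
    rcases ht₀0.eq_or_lt with h0 | h0
    · rw [← h0] at hyC
      simp only [zero_smul, add_zero] at hyC
      exact Set.disjoint_left.1 hdis hy hyC
    · have hc : Continuous fun t : ℝ => y + t • d := by fun_prop
      have hev : ∀ᶠ t in nhdsWithin t₀ (Iio t₀), y + t • d ∈ C k :=
        (hc.continuousAt.mono_left nhdsWithin_le_nhds).eventually (hCo.mem_nhds hyC)
      have hev2 : ∀ᶠ t in nhdsWithin t₀ (Iio t₀), 0 ≤ t :=
        nhdsWithin_le_nhds (Ici_mem_nhds h0)
      obtain ⟨t, ⟨h1, h2⟩, h3⟩ := ((hev.and hev2).and self_mem_nhdsWithin).exists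
      have : t₀ ≤ t := csInf_le hTb ⟨h2, k, hk, y + t • d, ⟨y, hy, rfl⟩, h1⟩
      exact absurd h3 (not_lt.2 this)
  · have hcl : IsClosed (⋃ k ∈ s, {t : ℝ | t • d ∈ closure (C k) - closure B}) := by
      refine isClosed_biUnion_finset fun k hk => ?_
      have h1 : IsClosed (closure (C k) - closure B) := by
        rw [sub_eq_add_neg]
        exact ((hC k hk).2.2.1.isCompact_closure.add hBb.isCompact_closure.neg).isClosed
      exact h1.preimage (by fun_prop : Continuous fun t : ℝ => t • d)
    have hsub : T ⊆ ⋃ k ∈ s, {t : ℝ | t • d ∈ closure (C k) - closure B} := by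
      rintro t ⟨-, k, hk, _, ⟨y, hy, rfl⟩, hyC⟩
      exact mem_iUnion₂.2 ⟨k, hk, y + t • d, subset_closure hyC, y, subset_closure hy, by simp⟩
    have h1 := closure_minimal hsub hcl (csInf_mem_closure hTne hTb)
    obtain ⟨k, hk, x, hx, y, hy, hxy⟩ := mem_iUnion₂.1 h1
    refine ⟨k, hk, x, ?_, hx⟩
    rw [closure_shift, mem_shift]
    have : x - t₀ • d = y := by rw [ht₀, ← hxy]; simp
    rwa [this]

lemma exists_move {ι : Type*} {s : Finset ι} {S : ι → Set (Fin 2 → ℝ)}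
    {Ω : Set (Fin 2 → ℝ)} (hΩ : Convex ℝ Ω)
    (hS : ∀ i ∈ s, IsOpen (S i) ∧ (S i).Nonempty ∧ Bornology.IsBounded (S i) ∧ S i ⊆ Ω)
    (hdis : (s : Set ι).PairwiseDisjoint S) (hs : 1 < s.card) :
    ∃ j ∈ s, ∃ k ∈ s, j ≠ k ∧ ∃ u, shift u (S j) ⊆ Ω ∧
      (∀ i ∈ s, i ≠ j → Disjoint (shift u (S j)) (S i)) ∧
      (closure (convexHull ℝ (shift u (S j))) ∩ closure (convexHull ℝ (S k))).Nonempty := by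
  classical
  by_cases hh : (s : Set ι).PairwiseDisjoint fun i => convexHull ℝ (S i)
  · have key : ∀ a ∈ s, ∀ b ∈ s, a ≠ b → (∃ d : Fin 2 → ℝ, ∀ y ∈ convexHull ℝ (S b),
        ∃ t : ℝ, 0 < t ∧ y + t • d ∈ convexHull ℝ (S a)) →
        ∃ j ∈ s, ∃ k ∈ s, j ≠ k ∧ ∃ u, shift u (S j) ⊆ Ω ∧
        (∀ i ∈ s, i ≠ j → Disjoint (shift u (S j)) (S i)) ∧
        (closure (convexHull ℝ (shift u (S j))) ∩ closure (convexHull ℝ (S k))).Nonempty := by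
      rintro a ha b hb hab ⟨d, hd⟩
      obtain ⟨hbo, hbne, hbb, hbΩ⟩ := hS b hb
      obtain ⟨u, h1, h2, k, hk, h3⟩ := exists_slide (s := s.erase b) (Ω := Ω)
        (C := fun i => convexHull ℝ (S i)) (B := convexHull ℝ (S b)) (fun i hi => by
          have hi' := Finset.mem_of_mem_erase hi
          obtain ⟨h1, h2, h3, h4⟩ := hS i hi'
          exact ⟨h1.convexHull, convexHull_min h4 hΩ, isBounded_convexHull.2 h3,
            hh hb hi' (Finset.ne_of_mem_erase hi).symm⟩)
        hbne.convexHull (isBounded_convexHull.2 hbb) (convexHull_min hbΩ hΩ) hΩ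
        (Finset.mem_erase.2 ⟨hab, ha⟩) hd
      refine ⟨b, hb, k, Finset.mem_of_mem_erase hk, (Finset.ne_of_mem_erase hk).symm, u,
        (shift_mono u (subset_convexHull ℝ _)).trans h1, fun i hi hib => ?_, ?_⟩
      · exact (h2 i (Finset.mem_erase.2 ⟨hib, hi⟩)).mono
          (shift_mono u (subset_convexHull ℝ _)) (subset_convexHull ℝ _)
      · rwa [convexHull_shift]
    obtain ⟨a, ha, b, hb, hab⟩ := Finset.one_lt_card.1 hs
    obtain ⟨hao, hane, hab', haΩ⟩ := hS a ha
    obtain ⟨hbo, hbne, hbb, hbΩ⟩ := hS b hb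
    obtain ⟨d, hd | hd⟩ := exists_direction (convex_convexHull ℝ (S a)) (convex_convexHull ℝ (S b))
      hao.convexHull hbo.convexHull (isBounded_convexHull.2 hab') (isBounded_convexHull.2 hbb)
      hane.convexHull hbne.convexHull (hh ha hb hab)
    · exact key a ha b hb hab ⟨d, hd⟩
    · exact key b hb a ha hab.symm ⟨d, hd⟩
  · simp only [Set.PairwiseDisjoint, Set.Pairwise, Function.onFun] at hh
    push Not at hh
    obtain ⟨j, hj, k, hk, hjk, h⟩ := hh
    rw [Set.not_disjoint_iff_nonempty_inter] at h
    refine ⟨j, hj, k, hk, hjk, 0, ?_, fun i hi hij => ?_, ?_⟩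
    · rw [shift_zero]; exact (hS j hj).2.2.2
    · rw [shift_zero]; exact hdis hj hi hij.symm
    · rw [shift_zero]
      exact h.mono (inter_subset_inter subset_closure subset_closure)

/-- Finitely many disjoint open sets inside a convex set can be translated, keeping them disjoint
and inside the convex set, so that the projections of their union are intervals up to closure. -/
lemma exists_pack {ι : Type*} {Ω : Set (Fin 2 → ℝ)} (hΩ : Convex ℝ Ω) (N : ℕ) :
    ∀ (s : Finset ι) (S : ι → Set (Fin 2 → ℝ)), s.card = N →
    (∀ i ∈ s, IsOpen (S i) ∧ (S i).Nonempty ∧ Bornology.IsBounded (S i) ∧ S i ⊆ Ω) →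
    (∀ i ∈ s, ProjConnected (S i)) → (s : Set ι).PairwiseDisjoint S →
    ∃ v : ι → Fin 2 → ℝ, (∀ i ∈ s, shift (v i) (S i) ⊆ Ω) ∧
      (s : Set ι).PairwiseDisjoint (fun i => shift (v i) (S i)) ∧
      ProjConnected (⋃ i ∈ s, shift (v i) (S i)) := by
  classical
  induction N with
  | zero =>
    intro s S hs _ _ _
    obtain rfl := Finset.card_eq_zero.1 hs
    exact ⟨0, by simp, by simp, fun l => by simp [convex_empty]⟩
  | succ N ih =>
  intro s S hs hS hSc hdis
  rcases Nat.eq_zero_or_pos N with hN | hN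
  · subst hN
    obtain ⟨i, rfl⟩ := Finset.card_eq_one.1 hs
    refine ⟨0, ?_, by simp, ?_⟩
    · simpa [shift_zero] using (hS i (by simp)).2.2.2
    · simpa [shift_zero] using hSc i (by simp)
  obtain ⟨j, hj, k, hk, hjk, u, hu1, hu2, hu3⟩ := exists_move hΩ hS hdis (by omega)
  set A := shift u (S j) with hA
  set S' : ι → Set (Fin 2 → ℝ) := Function.update S k (A ∪ S k) with hS'
  have hS'k : S' k = A ∪ S k := Function.update_self _ _ _
  have hS'i : ∀ i, i ≠ k → S' i = S i := fun i hi => Function.update_of_ne hi _ _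
  have hk' : k ∈ s.erase j := Finset.mem_erase.2 ⟨hjk.symm, hk⟩
  obtain ⟨v', hv1, hv2, hv3⟩ := ih (s.erase j) S' (by rw [Finset.card_erase_of_mem hj, hs]; rfl)
    (fun i hi => by
      have hi' := Finset.mem_of_mem_erase hi
      by_cases hik : i = k
      · subst hik
        rw [hS'k]
        obtain ⟨h1, h2, h3, h4⟩ := hS i hi'
        obtain ⟨g1, g2, g3, g4⟩ := hS j hj
        exact ⟨(g1.shift u).union h1, h2.inr, (isBounded_shift g3 u).union h3, union_subset hu1 h4⟩
      · rw [hS'i i hik]; exact hS i hi')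
    (fun i hi => by
      have hi' := Finset.mem_of_mem_erase hi
      by_cases hik : i = k
      · subst hik
        rw [hS'k]
        exact ((hSc j hj).translate u).union (hSc i hi') hu3
      · rw [hS'i i hik]; exact hSc i hi')
    (by
      have aux : ∀ i ∈ s.erase j, i ≠ k → Disjoint (S' k) (S i) := fun i hi hik => by
        rw [hS'k, Set.disjoint_union_left]
        exact ⟨hu2 i (Finset.mem_of_mem_erase hi) (Finset.ne_of_mem_erase hi),
          hdis hk (Finset.mem_of_mem_erase hi) hik.symm⟩
      intro i hi l hl hil
      simp only [Function.onFun]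
      by_cases hik : i = k
      · rw [hik, hS'i l (by rintro rfl; exact hil hik)]
        exact aux l hl (by rintro rfl; exact hil hik)
      by_cases hlk : l = k
      · rw [hlk, hS'i i hik]
        exact (aux i hi hik).symm
      rw [hS'i i hik, hS'i l hlk]
      exact hdis (Finset.mem_of_mem_erase hi) (Finset.mem_of_mem_erase hl) hil)
  set v : ι → Fin 2 → ℝ := Function.update v' j (u + v' k) with hv
  have hvj : shift (v j) (S j) = shift (v' k) A := by
    rw [hA, shift_shift, hv, Function.update_self]
  have hvi : ∀ i, i ≠ j → v i = v' i := fun i hi => Function.update_of_ne hi _ _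
  have hSub : ∀ i, S i ⊆ S' i := fun i => by
    by_cases hik : i = k
    · subst hik; rw [hS'k]; exact subset_union_right
    · rw [hS'i i hik]
  have hsubi : ∀ i, i ≠ j → shift (v i) (S i) ⊆ shift (v' i) (S' i) := fun i hi => by
    rw [hvi i hi]; exact shift_mono _ (hSub i)
  have hsubj : shift (v j) (S j) ⊆ shift (v' k) (S' k) := by
    rw [hvj, hS'k]; exact shift_mono _ subset_union_left
  have hjdis : ∀ i ∈ s, i ≠ j → Disjoint (shift (v j) (S j)) (shift (v i) (S i)) :=
    fun i hi hij => by
    by_cases hik : i = k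
    · rw [hvj, hvi i hij, hik]
      exact disjoint_shift (hu2 k hk hjk.symm)
    · exact (hv2 hk' (Finset.mem_coe.2 (Finset.mem_erase.2 ⟨hij, hi⟩)) (Ne.symm hik)).mono
        hsubj (hsubi i hij)
  refine ⟨v, fun i hi => ?_, fun i hi l hl hil => ?_, ?_⟩
  · by_cases hij : i = j
    · rw [hij]; exact hsubj.trans (hv1 k hk')
    · exact (hsubi i hij).trans (hv1 i (Finset.mem_erase.2 ⟨hij, hi⟩))
  · simp only [Function.onFun]
    by_cases hij : i = j
    · rw [hij]; exact hjdis l hl (by rintro rfl; exact hil hij)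
    by_cases hlj : l = j
    · rw [hlj]; exact (hjdis i hi hij).symm
    exact (hv2 (Finset.mem_coe.2 (Finset.mem_erase.2 ⟨hij, hi⟩))
      (Finset.mem_coe.2 (Finset.mem_erase.2 ⟨hlj, hl⟩)) hil).mono (hsubi i hij) (hsubi l hlj)
  · convert hv3 using 1
    apply Subset.antisymm
    · refine iUnion₂_subset fun i hi => ?_
      by_cases hij : i = j
      · rw [hij]
        exact hsubj.trans (subset_biUnion_of_mem (u := fun i => shift (v' i) (S' i)) hk')
      · exact (hsubi i hij).trans (subset_biUnion_of_mem (u := fun i => shift (v' i) (S' i))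
          (Finset.mem_erase.2 ⟨hij, hi⟩))
    · refine iUnion₂_subset fun i hi => ?_
      have hij := Finset.ne_of_mem_erase hi
      have hi' := Finset.mem_of_mem_erase hi
      by_cases hik : i = k
      · rw [hik, hS'k, shift_union, ← hvj, ← hvi k hjk.symm]
        exact union_subset (subset_biUnion_of_mem (u := fun i => shift (v i) (S i)) hj)
          (subset_biUnion_of_mem (u := fun i => shift (v i) (S i)) hk)
      · rw [hS'i i hik, ← hvi i hij]
        exact subset_biUnion_of_mem (u := fun i => shift (v i) (S i)) hi'

lemma measure_biUnion_add_inter_le {ι : Type*} [DecidableEq ι] {s : Finset ι} {i : ι} (hi : i ∈ s)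
    {J : ι → Set ℝ} (hJ : ∀ k ∈ s, MeasurableSet (J k)) :
    volume (⋃ k ∈ s, J k) + volume (J i ∩ ⋃ k ∈ s.erase i, J k) ≤ ∑ k ∈ s, volume (J k) := by
  have h1 : (⋃ k ∈ s, J k) = J i ∪ ⋃ k ∈ s.erase i, J k := by
    conv_lhs => rw [← Finset.insert_erase hi]
    rw [Finset.set_biUnion_insert]
  have h2 : MeasurableSet (⋃ k ∈ s.erase i, J k) :=
    Finset.measurableSet_biUnion _ fun k hk => hJ k (Finset.mem_of_mem_erase hk)
  rw [h1, measure_union_add_inter _ h2, ← Finset.add_sum_erase s _ hi]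
  gcongr
  exact measure_biUnion_finset_le _ _

lemma volume_closure_biUnion_le {ι : Type*} (s : Finset ι) {J : ι → Set ℝ}
    (hJ : ∀ k ∈ s, Convex ℝ (J k)) :
    volume (closure (⋃ k ∈ s, J k)) ≤ volume (⋃ k ∈ s, J k) := by
  have h1 : closure (⋃ k ∈ s, J k) ⊆ (⋃ k ∈ s, J k) ∪ ⋃ k ∈ s, frontier (J k) := by
    rw [s.closure_biUnion]
    refine iUnion₂_subset fun k hk x hx => ?_
    rw [closure_eq_self_union_frontier] at hx
    rcases hx with hx | hx
    · exact Or.inl (mem_iUnion₂.2 ⟨k, hk, hx⟩)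
    · exact Or.inr (mem_iUnion₂.2 ⟨k, hk, hx⟩)
  refine (measure_mono h1).trans ((measure_union_le _ _).trans ?_)
  have h2 : volume (⋃ k ∈ s, frontier (J k)) = 0 :=
    (measure_biUnion_null_iff s.countable_toSet).2 fun k hk => (hJ k hk).addHaar_frontier volume
  rw [h2, add_zero]

lemma Convex.wedge_image (g : Fin 2 → ℝ) {S : Set (Fin 2 → ℝ)} (hS : Convex ℝ S) :
    Convex ℝ (wedge g '' S) := hS.linear_image (wedge g).toLinearMap

/-- The shadow of the convex hull of a packed family of convex sets is controlled by the shadows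
of the pieces, with a gain coming from the overlaps of the latter. -/
lemma shadow_hull_add_overlap_le {ι : Type*} [DecidableEq ι] (g : Fin 2 → ℝ) {s : Finset ι}
    {i : ι} (hi : i ∈ s) {L : ι → Set (Fin 2 → ℝ)} (hL : ∀ k ∈ s, Convex ℝ (L k))
    (hp : ProjConnected (⋃ k ∈ s, L k)) :
    shadow g (convexHull ℝ (⋃ k ∈ s, L k)) +
        volume (wedge g '' L i ∩ wedge g '' ⋃ k ∈ s.erase i, L k) ≤ ∑ k ∈ s, shadow g (L k) := by
  have hc : ∀ k ∈ s, Convex ℝ (wedge g '' L k) := fun k hk => (hL k hk).wedge_image g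
  have h1 : shadow g (convexHull ℝ (⋃ k ∈ s, L k)) ≤ volume (⋃ k ∈ s, wedge g '' L k) := by
    refine le_trans (measure_mono ?_) (volume_closure_biUnion_le s hc)
    rw [← image_iUnion₂]
    exact (image_mono subset_closure).trans (hp.map_closure_hull (wedge g))
  refine le_trans (add_le_add_left h1 _) ?_
  rw [image_iUnion₂]
  exact measure_biUnion_add_inter_le hi fun k hk => (hc k hk).ordConnected.measurableSet

lemma zonoPer_hull_add_overlap_le {ι : Type*} [DecidableEq ι] {n : ℕ} (g : Fin n → Fin 2 → ℝ)
    {s : Finset ι} {i : ι} (hi : i ∈ s) {L : ι → Set (Fin 2 → ℝ)}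
    (hL : ∀ k ∈ s, Convex ℝ (L k)) (hp : ProjConnected (⋃ k ∈ s, L k)) :
    zonoPer g (convexHull ℝ (⋃ k ∈ s, L k)) +
        2 * ∑ j, volume (wedge (g j) '' L i ∩ wedge (g j) '' ⋃ k ∈ s.erase i, L k) ≤
      ∑ k ∈ s, zonoPer g (L k) := by
  simp only [zonoPer]
  rw [← mul_add, ← Finset.sum_add_distrib, ← Finset.mul_sum, Finset.sum_comm]
  gcongr with j
  exact shadow_hull_add_overlap_le (g j) hi hL hp

/-- A crude isoperimetric inequality. -/
lemma volume_le_zonoPer_sq {n : ℕ} {g : Fin n → Fin 2 → ℝ} {r : ℝ} (hr : 0 < r)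
    (hg : ∀ x, r * ‖x‖ ≤ ∑ j, |wedge (g j) x|) {X : Set (Fin 2 → ℝ)} (hX : Convex ℝ X)
    (hb : Bornology.IsBounded X) :
    (volume X).toReal ≤ ((zonoPer g X).toReal / r) ^ 2 := by
  rcases X.eq_empty_or_nonempty with rfl | ⟨x, hx⟩
  · simpa using sq_nonneg _
  set q := (zonoPer g X).toReal with hq
  have hsub : X ⊆ Metric.closedBall x (q / (2 * r)) := by
    intro y hy
    rw [mem_closedBall_iff_norm, le_div_iff₀ (by positivity)]
    have h1 : ∀ j, ENNReal.ofReal |wedge (g j) (y - x)| ≤ shadow (g j) X := by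
      intro j
      have h2 : uIcc (wedge (g j) x) (wedge (g j) y) ⊆ wedge (g j) '' X :=
        (hX.wedge_image (g j)).ordConnected.uIcc_subset (mem_image_of_mem _ hx)
          (mem_image_of_mem _ hy)
      have h3 := measure_mono (μ := volume) h2
      rwa [Real.volume_interval, ← map_sub] at h3
    have h2 : ENNReal.ofReal (2 * (r * ‖y - x‖)) ≤ zonoPer g X := by
      rw [zonoPer, ENNReal.ofReal_mul (by norm_num), ENNReal.ofReal_ofNat]
      gcongr
      refine (ENNReal.ofReal_le_ofReal (hg _)).trans ?_
      rw [ENNReal.ofReal_sum_of_nonneg fun _ _ => abs_nonneg _]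
      exact Finset.sum_le_sum fun j _ => h1 j
    have h3 := (ENNReal.ofReal_le_iff_le_toReal (zonoPer_ne_top g hb)).1 h2
    linarith
  have hq0 : 0 ≤ q := ENNReal.toReal_nonneg
  have h3 := measure_mono (μ := volume) hsub
  rw [Real.volume_pi_closedBall _ (by positivity), Fintype.card_fin] at h3
  refine ENNReal.toReal_le_of_le_ofReal (by positivity) (h3.trans_eq ?_)
  congr 2
  field_simp

/-- A convex set of large measure contains a large triangle. -/
lemma exists_wedge_ge {X : Set (Fin 2 → ℝ)} (hXo : IsOpen X) (hb : Bornology.IsBounded X)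
    {ε : ℝ} (hε : 0 < ε) (hV : ENNReal.ofReal ε ≤ volume X) :
    ∃ a ∈ X, ∃ b ∈ X, ∃ c ∈ X, ε / 16 ≤ |wedge (b - a) (c - a)| := by
  by_contra! hcon
  obtain ⟨R, hR0, hR⟩ := hb.exists_pos_norm_le
  set S : Set ℝ := {t | ∃ a ∈ X, ∃ b ∈ X, ∃ c ∈ X, t = |wedge (b - a) (c - a)|} with hS
  have hSb : BddAbove S := ⟨ε / 16, by
    rintro _ ⟨a, ha, b, hb', c, hc, rfl⟩; exact (hcon a ha b hb' c hc).le⟩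
  obtain ⟨x, hx⟩ : X.Nonempty := by
    rw [nonempty_iff_ne_empty]
    rintro rfl
    simp only [measure_empty, nonpos_iff_eq_zero, ENNReal.ofReal_eq_zero] at hV
    linarith
  obtain ⟨δ, hδ, hball⟩ := Metric.isOpen_iff.1 hXo x hx
  have hpos : 0 < sSup S := by
    have h1 : ∀ i : Fin 2, x + Pi.single i (δ / 2) ∈ X := fun i => hball (by
      rw [mem_ball_iff_norm, add_sub_cancel_left, Pi.norm_single, Real.norm_of_nonneg (by positivity)]
      linarith)
    refine lt_of_lt_of_le ?_ (le_csSup hSb ⟨x, hx, _, h1 0, _, h1 1, rfl⟩)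
    rw [abs_pos, wedge_apply]
    simp
    exact hδ.ne'
  obtain ⟨_, ⟨a, ha, b, hb', c, hc, rfl⟩, hM⟩ := exists_lt_of_lt_csSup
    (show S.Nonempty from ⟨_, x, hx, x, hx, x, hx, rfl⟩)
    (show sSup S / 2 < sSup S by linarith)
  set M := |wedge (b - a) (c - a)| with hMd
  have hM0 : 0 < M := by linarith
  have hle : ∀ u ∈ X, ∀ v ∈ X, |wedge (u - a) (v - a)| ≤ 2 * M := fun u hu v hv => by
    have := le_csSup hSb ⟨a, ha, u, hu, v, hv, rfl⟩
    linarith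
  set f : (Fin 2 → ℝ) →ₗ[ℝ] (Fin 2 → ℝ) :=
    Matrix.toLin' !![(b - a) 1, -(b - a) 0; (c - a) 1, -(c - a) 0] with hf
  have hfa : ∀ y, f y = ![wedge (b - a) y, wedge (c - a) y] := by
    intro y
    ext i
    fin_cases i <;> simp [hf, wedge_apply, Matrix.toLin'_apply, Matrix.mulVec, dotProduct,
      Fin.sum_univ_two] <;> ring
  have hdet : |LinearMap.det f| = M := by
    rw [hf, LinearMap.det_toLin', Matrix.det_fin_two_of, hMd, wedge_apply, ← abs_neg]
    congr 1
    ring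
  have hsub : X ⊆ (fun y => y + a) '' (f ⁻¹' Metric.closedBall 0 (2 * M)) := by
    intro y hy
    refine ⟨y - a, ?_, by simp⟩
    rw [mem_preimage, mem_closedBall_zero_iff, pi_norm_le_iff_of_nonneg (by positivity), hfa]
    intro i
    fin_cases i
    · simpa using hle b hb' y hy
    · simpa using hle c hc y hy
  have h1 := hV.trans (measure_mono (μ := volume) hsub)
  rw [image_add_right, measure_preimage_add_right, Measure.addHaar_preimage_linearMap _
    (by rw [← abs_pos, hdet]; exact hM0), abs_inv, hdet,
    Real.volume_pi_closedBall _ (by positivity), ← ENNReal.ofReal_mul (by positivity),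
    Fintype.card_fin, ENNReal.ofReal_le_ofReal_iff (by positivity)] at h1
  have h2 : M⁻¹ * (2 * (2 * M)) ^ 2 = 16 * M := by field_simp; ring
  have := hcon a ha b hb' c hc
  rw [h2] at h1
  linarith

/-- An open convex set of large measure contains a large ball. -/
lemma exists_ball_subset_of_volume {X : Set (Fin 2 → ℝ)} (hXo : IsOpen X) (hX : Convex ℝ X)
    {D : ℝ} (hD : 0 < D) (hb : ∀ x ∈ X, ∀ y ∈ X, ‖x - y‖ ≤ D) {ε : ℝ} (hε : 0 < ε)
    (hV : ENNReal.ofReal ε ≤ volume X) :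
    ∃ z, Metric.ball z (ε / (192 * D)) ⊆ X := by
  have hbd : Bornology.IsBounded X := Metric.isBounded_iff.2 ⟨D, fun x hx y hy => by
    rw [dist_eq_norm]; exact hb x hx y hy⟩
  obtain ⟨a, ha, b, hb', c, hc, hM⟩ := exists_wedge_ge hXo hbd hε hV
  set W := wedge (b - a) (c - a) with hW
  have hW0 : W ≠ 0 := by
    intro h; rw [h, abs_zero] at hM; linarith
  refine ⟨(1 / 3 : ℝ) • a + (1 / 3 : ℝ) • b + (1 / 3 : ℝ) • c, fun x hx => ?_⟩
  set h := x - ((1 / 3 : ℝ) • a + (1 / 3 : ℝ) • b + (1 / 3 : ℝ) • c) with hh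
  rw [mem_ball_iff_norm, lt_div_iff₀ (by positivity)] at hx
  have hbound : ∀ u, ‖u‖ ≤ D → |wedge u h / W| ≤ 1 / 6 := by
    intro u hu
    rw [abs_div, div_le_iff₀ (abs_pos.2 hW0)]
    have h1 := abs_wedge_le u h
    have h2 : ‖u‖ * ‖h‖ ≤ D * ‖h‖ := mul_le_mul_of_nonneg_right hu (norm_nonneg _)
    nlinarith
  set t := wedge (b - a) h / W with ht
  set s := - wedge (c - a) h / W with hs
  have ht1 := abs_le.1 (hbound (b - a) (hb b hb' a ha))
  have hs1 := abs_le.1 (hbound (c - a) (hb c hc a ha))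
  have hs2 : s = -(wedge (c - a) h / W) := by rw [hs, neg_div]
  have hhst : h = s • (b - a) + t • (c - a) := by
    have hWd : W = (b - a) 0 * (c - a) 1 * 1 - (b - a) 1 * (c - a) 0 ∨
        W = -((b - a) 0 * (c - a) 1 * 1 - (b - a) 1 * (c - a) 0) := by
      right; rw [hW, wedge_apply]; ring
    have hW' : W = (c - a) 0 * (b - a) 1 - (c - a) 1 * (b - a) 0 := by rw [hW, wedge_apply]
    have e1 : s * W = -(h 0 * (c - a) 1 - h 1 * (c - a) 0) := by
      rw [hs, div_mul_cancel₀ _ hW0, wedge_apply]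
    have e2 : t * W = h 0 * (b - a) 1 - h 1 * (b - a) 0 := by
      rw [ht, div_mul_cancel₀ _ hW0, wedge_apply]
    ext i
    apply mul_right_cancel₀ hW0
    fin_cases i
    · simp only [Fin.zero_eta, Pi.add_apply, Pi.smul_apply, smul_eq_mul]
      linear_combination (-(b - a) 0) * e1 - (c - a) 0 * e2 + h 0 * hW'
    · simp only [Fin.mk_one, Pi.add_apply, Pi.smul_apply, smul_eq_mul]
      linear_combination (-(b - a) 1) * e1 - (c - a) 1 * e2 + h 1 * hW'
  have hx' : x = (1 / 3 - s - t) • a + ((1 / 3 + s) • b + (1 / 3 + t) • c) := by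
    have : x = h + ((1 / 3 : ℝ) • a + (1 / 3 : ℝ) • b + (1 / 3 : ℝ) • c) := by rw [hh]; abel
    rw [this, hhst]
    module
  rw [hx', ← add_assoc]
  have := hX.sum_mem (t := Finset.univ) (w := ![1 / 3 - s - t, 1 / 3 + s, 1 / 3 + t])
    (z := ![a, b, c]) (fun i _ => by fin_cases i <;> simp <;> linarith)
    (by simp [Fin.sum_univ_three]; ring) (fun i _ => by fin_cases i <;> simpa)
  simpa [Fin.sum_univ_three] using this

lemma exists_mem_closure_diff {L : Set (Fin 2 → ℝ)} (hL : IsOpen L) {p q : Fin 2 → ℝ} (hp : p ∈ L)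
    (hq : q ∉ L) : ∃ c ∈ segment ℝ p q, c ∈ closure L ∧ c ∉ L := by
  by_contra! h
  obtain ⟨x, -, hx1, hx2⟩ := (convex_segment p q).isPreconnected L (closure L)ᶜ hL
    isClosed_closure.isOpen_compl
    (fun x hx => by
      by_cases hxc : x ∈ closure L
      · exact Or.inl (h x hx hxc)
      · exact Or.inr hxc)
    ⟨p, left_mem_segment ℝ p q, hp⟩
    ⟨q, right_mem_segment ℝ p q, fun hqc => hq (h q (right_mem_segment ℝ p q) hqc)⟩
  exact hx2 (subset_closure hx1)

lemma exists_eq_wedge (f : (Fin 2 → ℝ) →L[ℝ] ℝ) : ∃ τ, ∀ x, f x = wedge τ x := by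
  refine ⟨![-f (Pi.single 1 1), f (Pi.single 0 1)], fun x => ?_⟩
  rw [clm_eq_sum, Fin.sum_univ_two, wedge_apply]
  simp
  ring

lemma ball_subset_of_mem_segment {G : Set (Fin 2 → ℝ)} (hG : Convex ℝ G) {p q c : Fin 2 → ℝ}
    {η : ℝ} (hp : Metric.ball p η ⊆ G) (hq : Metric.ball q η ⊆ G) (hc : c ∈ segment ℝ p q) :
    Metric.ball c η ⊆ G := by
  obtain ⟨a, b, ha, hb, hab, rfl⟩ := hc
  intro x hx
  set h := x - (a • p + b • q) with hh
  have hx' : x = a • (p + h) + b • (q + h) := by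
    have : x = a • p + b • q + (a + b) • h := by rw [hab, hh]; module
    rw [this]; module
  rw [mem_ball_iff_norm] at hx
  rw [hx']
  exact hG (hp (by simpa [mem_ball_iff_norm] using hx)) (hq (by simpa [mem_ball_iff_norm] using hx))
    ha hb hab

lemma ofReal_le_shadow_ball (g z : Fin 2 → ℝ) {ρ : ℝ} (hρ : 0 < ρ) :
    ENNReal.ofReal (ρ * ‖g‖) ≤ shadow g (Metric.ball z ρ) := by
  obtain ⟨e, he1, he2⟩ : ∃ e : Fin 2 → ℝ, ‖e‖ ≤ 1 ∧ |wedge g e| = ‖g‖ := by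
    have h0 := norm_le_pi_norm g 0
    have h1 := norm_le_pi_norm g 1
    have h2 : ‖g‖ ≤ max |g 0| |g 1| := by
      rw [pi_norm_le_iff_of_nonneg (le_max_of_le_left (abs_nonneg _))]
      intro i; fin_cases i
      · exact le_max_left _ _
      · exact le_max_right _ _
    rw [Real.norm_eq_abs] at h0 h1
    rcases le_total |g 0| |g 1| with h | h
    · refine ⟨Pi.single 0 1, by simp [Pi.norm_single], ?_⟩
      rw [max_eq_right h] at h2
      rw [wedge_apply]; simp; linarith
    · refine ⟨Pi.single 1 1, by simp [Pi.norm_single], ?_⟩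
      rw [max_eq_left h] at h2
      rw [wedge_apply]; simp; linarith
  have hc := (convex_ball z ρ).wedge_image g
  have h1 : ∀ t ∈ Ioo (0 : ℝ) 1, ENNReal.ofReal (t * (ρ * ‖g‖)) ≤ shadow g (Metric.ball z ρ) := by
    intro t ht
    have h2 : uIcc (wedge g z) (wedge g (z + (t * ρ) • e)) ⊆ wedge g '' Metric.ball z ρ := by
      refine hc.ordConnected.uIcc_subset (mem_image_of_mem _ (Metric.mem_ball_self hρ))
        (mem_image_of_mem _ ?_)
      rw [mem_ball_iff_norm, add_sub_cancel_left, norm_smul, Real.norm_of_nonneg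
        (mul_nonneg ht.1.le hρ.le)]
      have : t * ρ * ‖e‖ ≤ t * ρ * 1 := mul_le_mul_of_nonneg_left he1 (mul_nonneg ht.1.le hρ.le)
      nlinarith [ht.2]
    have h3 := measure_mono (μ := volume) h2
    rw [Real.volume_interval, map_add, add_sub_cancel_left, map_smul, smul_eq_mul, abs_mul, he2,
      abs_of_nonneg (mul_nonneg ht.1.le hρ.le), mul_assoc] at h3
    exact h3
  have h4 : Tendsto (fun t : ℝ => ENNReal.ofReal (t * (ρ * ‖g‖))) (nhdsWithin 1 (Iio 1))
      (nhds (ENNReal.ofReal (ρ * ‖g‖))) := by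
    have : Continuous fun t : ℝ => ENNReal.ofReal (t * (ρ * ‖g‖)) :=
      ENNReal.continuous_ofReal.comp (by fun_prop)
    have h5 := (this.tendsto 1).mono_left (nhdsWithin_le_nhds (s := Iio 1))
    simpa using h5
  refine le_of_tendsto h4 ?_
  filter_upwards [Ioo_mem_nhdsLT (zero_lt_one' ℝ)] with t ht using h1 t ht

/-- If every line of direction `g` with offset in `W` meets `A` in a segment of parameter length
`ℓ`, then `A` has measure at least `ℓ * |W|`. -/
lemma volume_mul_le_of_slices {g : Fin 2 → ℝ} (hg : g ≠ 0) {A : Set (Fin 2 → ℝ)}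
    (hA : MeasurableSet A) {W : Set ℝ} {ℓ : ℝ}
    (h : ∀ y ∈ W, ∃ a, ∀ s ∈ Icc a (a + ℓ), sliceMap g (y, s) ∈ A) :
    ENNReal.ofReal ℓ * volume W ≤ volume A := by
  have hF : Measurable fun y : ℝ => ∫⁻ s, A.indicator (1 : (Fin 2 → ℝ) → ℝ≥0∞) (sliceMap g (y, s)) := by
    apply Measurable.lintegral_prod_right
    exact (measurable_one.indicator hA).comp (continuous_sliceMap g).measurable
  rw [← lintegral_indicator_one hA, lintegral_slice hg (measurable_one.indicator hA)]
  refine le_trans ?_ (mul_meas_ge_le_lintegral hF (ENNReal.ofReal ℓ))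
  gcongr
  intro y hy
  obtain ⟨a, ha⟩ := h y hy
  have h1 : volume (Icc a (a + ℓ)) = ENNReal.ofReal ℓ := by rw [Real.volume_Icc]; congr 1; ring
  rw [mem_ofPred_eq, ← h1, ← lintegral_indicator_one measurableSet_Icc]
  refine lintegral_mono fun s => ?_
  by_cases hs : s ∈ Icc a (a + ℓ)
  · simp [hs, ha s hs]
  · simp [hs]

lemma overlap_lower_bound {g : Fin 2 → ℝ} (hg : g ≠ 0) {L N G : Set (Fin 2 → ℝ)} (hL : IsOpen L)
    (hLc : Convex ℝ L) (hN : IsOpen N) (hG : IsOpen G) {c p τ : Fin 2 → ℝ} {η D κ δ : ℝ}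
    (hη : 0 < η) (hδ : 0 < δ) (hδ1 : δ ≤ 1) (hδκ : 8 * δ * D ≤ κ * η) (hδη : 8 * δ * D ≤ η)
    (hD : ∀ y ∈ L, ‖y - c‖ ≤ D) (hp : Metric.ball p η ⊆ L) (hcG : Metric.ball c η ⊆ G)
    (hc : c ∈ closure L) (hτ : ∀ x ∈ L, wedge τ x < wedge τ c)
    (hκ : κ * (‖τ‖ * ‖g‖) ≤ |wedge τ g|) :
    ENNReal.ofReal (δ * η * ‖g‖) ≤ volume (wedge g '' L ∩ wedge g '' N) +
      volume (G \ (L ∪ N)) * ENNReal.ofReal (2 * ‖g‖ / η) := by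
  have hg0 : 0 < ‖g‖ := norm_pos_iff.2 hg
  set B := Metric.ball (c + δ • (p - c)) (δ * η) with hB
  have hBL : ∀ x ∈ B, ∃ y ∈ L, x = c + δ • (y - c) := by
    intro x hx
    refine ⟨c + δ⁻¹ • (x - c), hp ?_, ?_⟩
    · rw [hB, mem_ball_iff_norm] at hx
      have : c + δ⁻¹ • (x - c) - p = δ⁻¹ • (x - (c + δ • (p - c))) := by
        rw [← sub_sub, smul_sub δ⁻¹ (x - c), smul_smul, inv_mul_cancel₀ hδ.ne']; module
      rw [mem_ball_iff_norm, this, norm_smul, norm_inv, Real.norm_of_nonneg hδ.le,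
        inv_mul_lt_iff₀ hδ]
      exact hx
    · rw [add_sub_cancel_left, smul_smul, mul_inv_cancel₀ hδ.ne']; module
  have hBsub : B ⊆ L := by
    intro x hx
    obtain ⟨y, hy, rfl⟩ := hBL x hx
    have := hLc.add_smul_sub_mem_interior' hc (by rwa [hL.interior_eq]) ⟨hδ, hδ1⟩
    rwa [hL.interior_eq] at this
  obtain ⟨σ, hσ, hσg⟩ : ∃ σ : ℝ, |σ| = 1 ∧ σ * wedge τ g = |wedge τ g| := by
    rcases le_total 0 (wedge τ g) with h | h
    · exact ⟨1, by simp, by rw [abs_of_nonneg h, one_mul]⟩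
    · exact ⟨-1, by simp, by rw [abs_of_nonpos h]; ring⟩
  have hσσ : σ * σ = 1 := by rw [← abs_mul_abs_self, hσ, one_mul]
  have hgap : ∀ x ∈ B, ∀ t ∈ Icc (η / (4 * ‖g‖)) (3 * η / (4 * ‖g‖)),
      x + (t * σ) • g ∈ G ∧ x + (t * σ) • g ∉ L := by
    intro x hx t ht
    have ht0 : 0 ≤ t := le_trans (by positivity) ht.1
    have ht1 : η / 4 ≤ t * ‖g‖ := by
      have := mul_le_mul_of_nonneg_right ht.1 hg0.le
      refine le_trans (le_of_eq ?_) this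
      field_simp
    have ht2 : t * ‖g‖ ≤ 3 * η / 4 := by
      have := mul_le_mul_of_nonneg_right ht.2 hg0.le
      refine this.trans (le_of_eq ?_)
      field_simp
    obtain ⟨y, hy, rfl⟩ := hBL x hx
    have hyD := hD y hy
    have hnδ : δ * ‖y - c‖ ≤ δ * D := mul_le_mul_of_nonneg_left hyD hδ.le
    constructor
    · apply hcG
      rw [mem_ball_iff_norm]
      have : c + δ • (y - c) + (t * σ) • g - c = δ • (y - c) + (t * σ) • g := by abel
      rw [this]
      refine (norm_add_le _ _).trans_lt ?_
      rw [norm_smul, norm_smul, Real.norm_of_nonneg hδ.le, norm_mul, Real.norm_of_nonneg ht0,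
        Real.norm_eq_abs σ, hσ, mul_one]
      linarith
    · intro hmem
      have h1 := hτ _ hmem
      rw [map_add, map_add, map_smul, map_smul, smul_eq_mul, smul_eq_mul, mul_assoc, hσg] at h1
      have h2 := (abs_le.1 (abs_wedge_le τ (y - c))).1
      have h3 := mul_le_mul_of_nonneg_left h2 hδ.le
      have h4 := mul_le_mul_of_nonneg_left hκ ht0
      have hτ0 := norm_nonneg τ
      rcases le_or_gt 0 κ with hκ0 | hκ0
      · have h5 : κ * ‖τ‖ * (η / 4) ≤ κ * ‖τ‖ * (t * ‖g‖) :=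
          mul_le_mul_of_nonneg_left ht1 (by positivity)
        have h6 := mul_le_mul_of_nonneg_left hnδ hτ0
        have h7 := mul_le_mul_of_nonneg_left hδκ hτ0
        nlinarith
      · have hD0 : 0 ≤ D := (norm_nonneg _).trans hyD
        have : 0 ≤ 8 * δ * D := by positivity
        nlinarith
  set W := wedge g '' B with hW
  set O := wedge g '' L ∩ wedge g '' N with hO
  have hgapW : ∀ y ∈ W \ O, ∃ a, ∀ s ∈ Icc a (a + η / (2 * ‖g‖)),
      sliceMap g (y, s) ∈ G \ (L ∪ N) := by
    rintro _ ⟨⟨x, hx, rfl⟩, hxO⟩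
    obtain ⟨s₀, hs₀⟩ := sliceMap_wedge hg x
    have hslice : ∀ s, sliceMap g (wedge g x, s) = x + (s - s₀) • g := by
      intro s
      conv_rhs => rw [← hs₀]
      simp only [sliceMap]
      module
    have hnotN : ∀ s, sliceMap g (wedge g x, s) ∉ N := fun s hs =>
      hxO ⟨mem_image_of_mem _ (hBsub hx), _, hs, wedge_sliceMap hg _⟩
    have key : ∀ s, σ * (s - s₀) ∈ Icc (η / (4 * ‖g‖)) (3 * η / (4 * ‖g‖)) →
        sliceMap g (wedge g x, s) ∈ G \ (L ∪ N) := by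
      intro s hs
      have h1 := hgap x hx _ hs
      have h2 : σ * (s - s₀) * σ = s - s₀ := by
        linear_combination (s - s₀) * hσσ
      rw [h2, ← hslice] at h1
      exact ⟨h1.1, fun h => h.elim h1.2 (hnotN s)⟩
    have e1 : η / (2 * ‖g‖) = 2 * (η / (4 * ‖g‖)) := by field_simp; norm_num
    have e2 : 3 * η / (4 * ‖g‖) = 3 * (η / (4 * ‖g‖)) := by ring
    rw [e1]
    rw [e2] at key
    rcases (abs_eq zero_le_one).1 hσ with h | h
    · refine ⟨s₀ + η / (4 * ‖g‖), fun s hs => key s ?_⟩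
      rw [h]; constructor <;> linarith [hs.1, hs.2]
    · refine ⟨s₀ - 3 * (η / (4 * ‖g‖)), fun s hs => key s ?_⟩
      rw [h]; constructor <;> linarith [hs.1, hs.2]
  have h1 := volume_mul_le_of_slices hg (hG.measurableSet.diff (hL.union hN).measurableSet) hgapW
  have h2 : ENNReal.ofReal (δ * η * ‖g‖) ≤ volume W :=
    ofReal_le_shadow_ball g _ (by positivity)
  refine h2.trans ?_
  have h3 : volume W ≤ volume O + volume (W \ O) := by
    refine (measure_mono (t := O ∪ W \ O) ?_).trans (measure_union_le _ _)
    rw [union_sdiff_self]; exact subset_union_right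
  refine h3.trans ?_
  gcongr
  calc volume (W \ O) = (ENNReal.ofReal (η / (2 * ‖g‖)) * volume (W \ O)) *
        ENNReal.ofReal (2 * ‖g‖ / η) := by
        rw [mul_right_comm, ← ENNReal.ofReal_mul (by positivity)]
        have : η / (2 * ‖g‖) * (2 * ‖g‖ / η) = 1 := by field_simp
        rw [this, ENNReal.ofReal_one, one_mul]
    _ ≤ _ := by gcongr

/-- If an open convex set `L ⊂ G` and a point of `G` outside of `L` both have some room around
them, then the overlaps and the gap cannot both be small. -/
lemma overlap_sum_lower_bound {r C η D : ℝ} (hr : 0 < r) (hC : 0 < C) (hη : 0 < η) (hD : 0 < D) :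
    ∃ c₁ c₂ : ℝ, 0 < c₁ ∧ 0 < c₂ ∧ ∀ (n : ℕ) (g : Fin n → Fin 2 → ℝ),
      (∀ x, r * ‖x‖ ≤ ∑ j, |wedge (g j) x|) → ∑ j, ‖g j‖ ≤ C →
      ∀ (L N G : Set (Fin 2 → ℝ)) (p q : Fin 2 → ℝ), IsOpen L → Convex ℝ L → IsOpen N → IsOpen G →
        Convex ℝ G → L ⊆ G → (∀ x ∈ G, ∀ y ∈ G, ‖x - y‖ ≤ D) → Metric.ball p η ⊆ L → q ∉ L →
        Metric.ball q η ⊆ G →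
        ENNReal.ofReal c₁ ≤ ∑ j, volume (wedge (g j) '' L ∩ wedge (g j) '' N) +
          volume (G \ (L ∪ N)) * ENNReal.ofReal c₂ := by
  classical
  set κ := r / (2 * C) with hκ
  have hκ0 : 0 < κ := by positivity
  set δ := min 1 (min (κ * η / (8 * D)) (η / (8 * D))) with hδ
  have hδ0 : 0 < δ := by positivity
  have hδ1 : δ ≤ κ * η / (8 * D) := (min_le_right _ _).trans (min_le_left _ _)
  have hδ2 : δ ≤ η / (8 * D) := (min_le_right _ _).trans (min_le_right _ _)
  rw [le_div_iff₀ (by positivity)] at hδ1 hδ2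
  refine ⟨δ * η * (r / 4), 2 * C / η, by positivity, by positivity, ?_⟩
  intro n g hg hgC L N G p q hL hLc hN hG hGc hLG hGD hp hq hqG
  have hpL : p ∈ L := hp (Metric.mem_ball_self hη)
  obtain ⟨c, hcs, hcL, hcnL⟩ := exists_mem_closure_diff hL hpL hq
  have hcG := ball_subset_of_mem_segment hGc (hp.trans hLG) hqG hcs
  obtain ⟨f, hf⟩ := geometric_hahn_banach_open_point hLc hL hcnL
  obtain ⟨τ, hτ⟩ := exists_eq_wedge f
  simp only [hτ] at hf
  have hτ0 : 0 < ‖τ‖ := by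
    rw [norm_pos_iff]
    rintro rfl
    simpa [wedge_apply] using hf p hpL
  set S := Finset.univ.filter fun j => κ * (‖τ‖ * ‖g j‖) < |wedge τ (g j)| with hS
  have hswap : ∀ j, |wedge (g j) τ| = |wedge τ (g j)| := by
    intro j; rw [wedge_apply, wedge_apply, ← abs_neg]; congr 1; ring
  have hsum : r / 4 ≤ ∑ j ∈ S, ‖g j‖ := by
    have h1 : r * ‖τ‖ ≤ ∑ j ∈ S, 2 * ‖τ‖ * ‖g j‖ + ∑ j, κ * (‖τ‖ * ‖g j‖) := by
      refine (hg τ).trans ?_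
      rw [← Finset.sum_filter_add_sum_filter_not Finset.univ
        (fun j => κ * (‖τ‖ * ‖g j‖) < |wedge τ (g j)|)]
      refine add_le_add (Finset.sum_le_sum fun j _ => ?_) ?_
      · rw [hswap]; exact abs_wedge_le τ (g j)
      · refine (Finset.sum_le_sum fun j hj => ?_).trans
          (Finset.sum_le_sum_of_subset_of_nonneg (Finset.filter_subset _ _)
            fun j _ _ => by positivity)
        rw [hswap]; exact not_lt.1 (Finset.mem_filter.1 hj).2
    rw [← Finset.mul_sum, ← Finset.mul_sum, ← Finset.mul_sum] at h1
    have h2 : κ * (‖τ‖ * ∑ j, ‖g j‖) ≤ κ * (‖τ‖ * C) := by gcongr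
    have h3 : κ * (‖τ‖ * C) = r * ‖τ‖ / 2 := by rw [hκ]; field_simp
    have h4 : ‖τ‖ * (r / 4) ≤ ‖τ‖ * ∑ j ∈ S, ‖g j‖ := by linarith
    exact le_of_mul_le_mul_left h4 hτ0
  have hj : ∀ j ∈ S, ENNReal.ofReal (δ * η * ‖g j‖) ≤
      volume (wedge (g j) '' L ∩ wedge (g j) '' N) +
        volume (G \ (L ∪ N)) * ENNReal.ofReal (2 * ‖g j‖ / η) := by
    intro j hj
    have hjS := (Finset.mem_filter.1 hj).2
    have hgj : g j ≠ 0 := by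
      intro h0; rw [h0] at hjS; simp at hjS
    refine overlap_lower_bound hgj hL hLc hN hG hη hδ0 (min_le_left _ _) (by linarith)
      (by linarith) (fun y hy => hGD y (hLG hy) c ?_) hp hcG hcL hf hjS.le
    exact hcG (Metric.mem_ball_self hη)
  calc ENNReal.ofReal (δ * η * (r / 4)) ≤ ENNReal.ofReal (∑ j ∈ S, δ * η * ‖g j‖) := by
        rw [← Finset.mul_sum]
        gcongr
    _ = ∑ j ∈ S, ENNReal.ofReal (δ * η * ‖g j‖) :=
        ENNReal.ofReal_sum_of_nonneg fun j _ => by positivity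
    _ ≤ ∑ j ∈ S, (volume (wedge (g j) '' L ∩ wedge (g j) '' N) +
        volume (G \ (L ∪ N)) * ENNReal.ofReal (2 * ‖g j‖ / η)) := Finset.sum_le_sum hj
    _ ≤ ∑ j, (volume (wedge (g j) '' L ∩ wedge (g j) '' N) +
        volume (G \ (L ∪ N)) * ENNReal.ofReal (2 * ‖g j‖ / η)) :=
        Finset.sum_le_sum_of_subset (Finset.subset_univ S)
    _ ≤ _ := by
        rw [Finset.sum_add_distrib, ← Finset.mul_sum,
          ← ENNReal.ofReal_sum_of_nonneg fun j _ => by positivity, ← Finset.sum_div,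
          ← Finset.mul_sum]
        gcongr

lemma homothety_eq (c : Fin 2 → ℝ) (t : ℝ) (x : Fin 2 → ℝ) :
    AffineMap.homothety c t x = c + t • (x - c) := by
  rw [AffineMap.homothety_apply, vsub_eq_sub, vadd_eq_add, add_comm]

lemma volume_homothety (c : Fin 2 → ℝ) {t : ℝ} (A : Set (Fin 2 → ℝ)) :
    volume (AffineMap.homothety c t '' A) = ENNReal.ofReal (t ^ 2) * volume A := by
  rw [Measure.addHaar_image_homothety]
  simp

lemma shadow_homothety (g c : Fin 2 → ℝ) {t : ℝ} (ht : 0 ≤ t) (A : Set (Fin 2 → ℝ)) :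
    shadow g (AffineMap.homothety c t '' A) = ENNReal.ofReal t * shadow g A := by
  have h : wedge g '' (AffineMap.homothety c t '' A) =
      AffineMap.homothety (wedge g c) t '' (wedge g '' A) := by
    rw [image_image, image_image]
    refine image_congr fun x _ => ?_
    rw [homothety_eq, AffineMap.homothety_apply, map_add, map_smul, map_sub]
    simp [add_comm]
  rw [shadow, h, Measure.addHaar_image_homothety]
  simp [abs_of_nonneg ht, shadow]

lemma zonoPer_homothety {n : ℕ} (g : Fin n → Fin 2 → ℝ) (c : Fin 2 → ℝ) {t : ℝ} (ht : 0 ≤ t)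
    (A : Set (Fin 2 → ℝ)) :
    zonoPer g (AffineMap.homothety c t '' A) = ENNReal.ofReal t * zonoPer g A := by
  simp only [zonoPer, shadow_homothety _ c ht, ← Finset.mul_sum]
  ring

lemma isBounded_homothety (c : Fin 2 → ℝ) (t : ℝ) {A : Set (Fin 2 → ℝ)}
    (hA : Bornology.IsBounded A) : Bornology.IsBounded (AffineMap.homothety c t '' A) := by
  obtain ⟨R, hR⟩ := hA.exists_norm_le
  refine isBounded_iff_forall_norm_le.2 ⟨‖c‖ + |t| * (R + ‖c‖), ?_⟩
  rintro _ ⟨x, hx, rfl⟩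
  rw [homothety_eq]
  refine (norm_add_le _ _).trans ?_
  rw [norm_smul, Real.norm_eq_abs]
  gcongr
  exact (norm_sub_le _ _).trans (by linarith [hR x hx])

lemma Convex.homothety_subset {Ω : Set (Fin 2 → ℝ)} (hΩ : Convex ℝ Ω) {c : Fin 2 → ℝ} (hc : c ∈ Ω)
    {t : ℝ} (h0 : 0 ≤ t) (h1 : t ≤ 1) : AffineMap.homothety c t '' Ω ⊆ Ω := by
  rintro _ ⟨x, hx, rfl⟩
  rw [homothety_eq]
  exact hΩ.add_smul_sub_mem hc hx ⟨h0, h1⟩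

/-- A neighbourhood of a convex set is contained in a slight dilation. -/
lemma mem_homothety_of_dist {Ω : Set (Fin 2 → ℝ)} (hΩ : Convex ℝ Ω) {c : Fin 2 → ℝ} {ρ κ ε : ℝ}
    (hc : Metric.ball c ρ ⊆ Ω) (hκ : 0 < κ) (hε : ε ≤ κ * ρ) {x y : Fin 2 → ℝ} (hy : y ∈ Ω)
    (hxy : dist x y < ε) : x ∈ AffineMap.homothety c (1 + κ) '' Ω := by
  have h1 : c + κ⁻¹ • (x - y) ∈ Ω := by
    apply hc
    rw [mem_ball_iff_norm, add_sub_cancel_left, norm_smul, norm_inv, Real.norm_of_nonneg hκ.le,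
      inv_mul_lt_iff₀ hκ, ← dist_eq_norm]
    linarith
  have hk : (1 + κ) ≠ 0 := by positivity
  refine ⟨(1 / (1 + κ)) • y + (κ / (1 + κ)) • (c + κ⁻¹ • (x - y)),
    hΩ hy h1 (by positivity) (by positivity) (by field_simp), ?_⟩
  rw [homothety_eq]
  ext i
  simp
  field_simp
  ring

lemma shadow_ball_le (g z : Fin 2 → ℝ) (ρ : ℝ) :
    shadow g (Metric.ball z ρ) ≤ ENNReal.ofReal (4 * ρ * ‖g‖) := by
  have h : wedge g '' Metric.ball z ρ ⊆ Metric.closedBall (wedge g z) (2 * ‖g‖ * ρ) := by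
    rintro _ ⟨x, hx, rfl⟩
    rw [mem_ball_iff_norm] at hx
    rw [mem_closedBall_iff_norm, ← map_sub, Real.norm_eq_abs]
    refine (abs_wedge_le g _).trans ?_
    gcongr
  refine (measure_mono h).trans_eq ?_
  rw [Real.volume_closedBall]
  congr 1; ring

lemma zonoPer_ball_le {n : ℕ} {g : Fin n → Fin 2 → ℝ} {C : ℝ} (hC : ∑ j, ‖g j‖ ≤ C)
    (z : Fin 2 → ℝ) {ρ : ℝ} (hρ : 0 ≤ ρ) :
    zonoPer g (Metric.ball z ρ) ≤ ENNReal.ofReal (8 * ρ * C) := by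
  have h1 : ∑ j, shadow (g j) (Metric.ball z ρ) ≤ ENNReal.ofReal (4 * ρ * C) := by
    refine (Finset.sum_le_sum fun j _ => shadow_ball_le (g j) z ρ).trans ?_
    rw [← ENNReal.ofReal_sum_of_nonneg fun j _ => by positivity, ← Finset.mul_sum]
    gcongr
  rw [zonoPer]
  calc _ ≤ 2 * ENNReal.ofReal (4 * ρ * C) := by gcongr
    _ = _ := by
      rw [← ENNReal.ofReal_ofNat, ← ENNReal.ofReal_mul (by norm_num)]
      congr 1; ring

/-- Comparison of a minimizer with a convex set which is slightly larger than `Ω`, after rescaling. -/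
lemma IsIsopMinimizer.le_zonoPer {φ : (Fin 2 → ℝ) → ℝ} {Ω E : Set (Fin 2 → ℝ)} {m : ℝ} (hm : 0 < m)
    (hE : IsIsopMinimizer φ Ω m E) (hΩ : Convex ℝ Ω) {n : ℕ} {g : Fin n → Fin 2 → ℝ}
    (hg : ∀ (ξ : (Fin 2 → ℝ) →L[ℝ] ℝ) v, φ v ≤ 1 → ξ v ≤ ∑ j, |ξ (g j)|) {G : Set (Fin 2 → ℝ)}
    (hGo : IsOpen G) (hGc : Convex ℝ G) (hGb : Bornology.IsBounded G) {c : Fin 2 → ℝ} (hc : c ∈ Ω)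
    {κ : ℝ} (hκ : 0 ≤ κ) (hGΩ : G ⊆ AffineMap.homothety c (1 + κ) '' Ω)
    (hA : (1 + κ) ^ 2 * m ≤ (volume G).toReal) :
    anisoPerimeter φ E ≤ ENNReal.ofReal (√(m / (volume G).toReal)) * zonoPer g G := by
  set A := (volume G).toReal with hAd
  have hA0 : 0 < A := lt_of_lt_of_le (by positivity) hA
  set t := √(m / A) with ht
  have ht0 : 0 < t := Real.sqrt_pos.2 (by positivity)
  have ht2 : t ^ 2 = m / A := Real.sq_sqrt (by positivity)
  have htκ : t * (1 + κ) ≤ 1 := by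
    rw [← abs_of_nonneg (by positivity : 0 ≤ t * (1 + κ)), ← sq_le_one_iff_abs_le_one, mul_pow, ht2,
      div_mul_eq_mul_div, div_le_one hA0]
    linarith
  rw [← zonoPer_homothety g c ht0.le]
  refine (hE.2.2.2 (AffineMap.homothety c t '' G) ?_ ?_ ?_).trans
    (anisoPerimeter_le_zonoPer hg ?_ (isBounded_homothety c t hGb) (hGc.affine_image _))
  · exact (AffineMap.homothety_isOpenMap c t ht0.ne' G hGo).measurableSet
  · refine (image_mono hGΩ).trans (Subset.trans ?_ (hΩ.homothety_subset hc
      (by positivity : 0 ≤ t * (1 + κ)) htκ))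
    rw [AffineMap.homothety_mul, AffineMap.coe_comp, image_comp]
  · rw [volume_homothety, ENNReal.toReal_mul, ENNReal.toReal_ofReal (by positivity), ht2,
      ← hAd, div_mul_cancel₀ _ hA0.ne']
  · exact AffineMap.homothety_isOpenMap c t ht0.ne' G hGo

lemma IsIsopMinimizer.anisoPerimeter_ne_top {φ : (Fin 2 → ℝ) → ℝ} (hφ : IsNorm φ)
    {Ω E : Set (Fin 2 → ℝ)} {m : ℝ} (hm : 0 < m) (hm1 : m ≤ (volume Ω).toReal)
    (hE : IsIsopMinimizer φ Ω m E) (hΩo : IsOpen Ω) (hΩb : Bornology.IsBounded Ω)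
    (hΩ : Convex ℝ Ω) : anisoPerimeter φ E ≠ ⊤ := by
  obtain ⟨c, hc⟩ : Ω.Nonempty := by
    rw [nonempty_iff_ne_empty]
    rintro rfl
    simp at hm1
    linarith
  obtain ⟨r, C, -, -, h⟩ := hφ.exists_zonotope_approx
  obtain ⟨n, g, -, hg, -, -⟩ := h 1 one_pos le_rfl
  refine ne_top_of_le_ne_top ?_ (hE.le_zonoPer hm hΩ hg hΩo hΩ hΩb hc le_rfl (by simp) (by simpa))
  exact ENNReal.mul_ne_top ENNReal.ofReal_ne_top (zonoPer_ne_top g hΩb)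

lemma volume_shift (v : Fin 2 → ℝ) (S : Set (Fin 2 → ℝ)) : volume (shift v S) = volume S := by
  rw [shift, image_add_right, measure_preimage_add_right]

lemma zonoPer_shift {n : ℕ} (g : Fin n → Fin 2 → ℝ) (v : Fin 2 → ℝ) (S : Set (Fin 2 → ℝ)) :
    zonoPer g (shift v S) = zonoPer g S := by
  simp only [zonoPer]
  congr 1
  exact Finset.sum_congr rfl fun j _ => shadow_vadd (g j) v S

/-- Near a minimizer `E` there is a disjoint family of convex sets `H i`, of almost the same total
perimeter, which can be translated to a family `L i` packed in a convex set `G` for which the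
comparison with `E` is almost sharp. -/
lemma IsIsopMinimizer.exists_packing {φ : (Fin 2 → ℝ) → ℝ} (hφ : IsNorm φ)
    {Ω E : Set (Fin 2 → ℝ)} {m : ℝ} (hm : 0 < m) (hm1 : m < (volume Ω).toReal)
    (hE : IsIsopMinimizer φ Ω m E) (hΩo : IsOpen Ω) (hΩb : Bornology.IsBounded Ω)
    (hΩ : Convex ℝ Ω) {p : ℝ} (hp : p = (anisoPerimeter φ E).toReal) :
    ∃ r C D : ℝ, 0 < r ∧ 0 < C ∧ 0 < D ∧ ∀ β, 0 < β → β ≤ 1 →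
      ∃ (n : ℕ) (g : Fin n → Fin 2 → ℝ) (s : Finset (Set (Fin 2 → ℝ)))
        (H L : Set (Fin 2 → ℝ) → Set (Fin 2 → ℝ)) (G : Set (Fin 2 → ℝ)),
        (∀ x, r * ‖x‖ ≤ ∑ j, |wedge (g j) x|) ∧ ∑ j, ‖g j‖ ≤ C ∧
        (∀ i ∈ s, IsOpen (H i) ∧ Convex ℝ (H i) ∧ Bornology.IsBounded (H i)) ∧
        (∀ i ∈ s, IsOpen (L i) ∧ Convex ℝ (L i) ∧ L i ⊆ G ∧ volume (L i) = volume (H i)) ∧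
        (s : Set (Set (Fin 2 → ℝ))).PairwiseDisjoint H ∧
        (s : Set (Set (Fin 2 → ℝ))).PairwiseDisjoint L ∧
        volume (E \ ⋃ i ∈ s, H i) ≤ ENNReal.ofReal β ∧
        ∑ i ∈ s, zonoPer g (H i) ≤ ENNReal.ofReal (p + 2 * β) ∧
        IsOpen G ∧ Convex ℝ G ∧ (∀ x ∈ G, ∀ y ∈ G, ‖x - y‖ ≤ D) ∧
        (∀ i ∈ s, ∑ j, volume (wedge (g j) '' L i ∩ wedge (g j) '' ⋃ k ∈ s \ {i}, L k) ≤
          ENNReal.ofReal β) ∧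
        p ^ 2 * (volume G).toReal ≤ m * (p + 2 * β) ^ 2 ∧
        ENNReal.ofReal m ≤ ∑ i ∈ s, volume (H i) := by
  classical
  have hPtop := hE.anisoPerimeter_ne_top hφ hm hm1.le hΩo hΩb hΩ
  obtain ⟨hEm, hEΩ, hEv, -⟩ := id hE
  have hp0 : 0 ≤ p := by rw [hp]; exact ENNReal.toReal_nonneg
  have hpE : anisoPerimeter φ E = ENNReal.ofReal p := by rw [hp, ENNReal.ofReal_toReal hPtop]
  have hEb := hΩb.subset hEΩ
  have hEv' : volume E = ENNReal.ofReal m := by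
    rw [← hEv, ENNReal.ofReal_toReal hEb.measure_lt_top.ne]
  have hdiff : volume (Ω \ E) ≠ 0 := by
    intro h0
    have h1 : volume Ω ≤ volume E := by
      calc volume Ω ≤ volume (Ω \ E ∪ E) := measure_mono (by rw [sdiff_union_self]; simp)
        _ ≤ _ := measure_union_le _ _
        _ = volume E := by rw [h0, zero_add]
    have h2 := ENNReal.toReal_mono hEb.measure_lt_top.ne h1
    linarith
  obtain ⟨x₀, hx₀, hx₀pos⟩ := exists_mem_forall_mem_nhdsWithin_pos_measure hdiff
  obtain ⟨ρ, hρ, hρΩ⟩ := Metric.isOpen_iff.1 hΩo x₀ hx₀.1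
  obtain ⟨r, C, hr, hC, hzon⟩ := hφ.exists_zonotope_approx
  obtain ⟨D, hD⟩ := Metric.isBounded_iff.1 (isBounded_homothety x₀ (2 : ℝ) hΩb)
  refine ⟨r, C, max D 1, hr, hC, by positivity, fun β hβ hβ1 => ?_⟩
  set σ := min ρ (β / (8 * C)) with hσ
  have hσ0 : 0 < σ := by positivity
  have hσβ : 8 * σ * C ≤ β := by
    have h1 : σ ≤ β / (8 * C) := min_le_right _ _
    rw [le_div_iff₀ (by positivity)] at h1
    linarith
  set B := Metric.ball x₀ σ with hB
  have hBΩ : B ⊆ Ω := (Metric.ball_subset_ball (min_le_left _ _)).trans hρΩ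
  have hBpos : 0 < volume (B \ E) := by
    refine (hx₀pos (B ∩ (Ω \ E)) (inter_comm _ _ ▸ inter_mem_nhdsWithin _
      (Metric.ball_mem_nhds x₀ hσ0))).trans_le (measure_mono ?_)
    exact fun x hx => ⟨hx.1, hx.2.2⟩
  have hBfin : volume (B \ E) ≠ ⊤ :=
    ((hΩb.subset hBΩ).subset sdiff_subset).measure_lt_top.ne
  set b := (volume (B \ E)).toReal with hb
  have hb0 : 0 < b := ENNReal.toReal_pos hBpos.ne' hBfin
  set κ := min 1 (b / (6 * m)) with hκ
  have hκ0 : 0 < κ := by positivity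
  have hκ1 : κ ≤ 1 := min_le_left _ _
  have hκb : (1 + κ) ^ 2 * m ≤ m + b / 2 := by
    have h1 : κ ≤ b / (6 * m) := min_le_right _ _
    rw [le_div_iff₀ (by positivity)] at h1
    nlinarith
  set τ := min 1 (β / (2 * (p + 1))) with hτ
  have hτ0 : 0 < τ := by positivity
  have hτp : τ * p ≤ β / 2 := by
    have h1 : τ ≤ β / (2 * (p + 1)) := min_le_right _ _
    rw [le_div_iff₀ (by positivity)] at h1
    nlinarith
  set ε := min (β / 2) (min (κ * ρ) (b / 2)) with hε
  have hε0 : 0 < ε := by positivity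
  have hεβ : ε ≤ β / 2 := min_le_left _ _
  have hεκ : ε ≤ κ * ρ := (min_le_right _ _).trans (min_le_left _ _)
  have hεb : ε ≤ b / 2 := (min_le_right _ _).trans (min_le_right _ _)
  obtain ⟨n, g, hg1, hg2, hg3, hg4⟩ := hzon τ hτ0 (min_le_left _ _)
  obtain ⟨𝒰, h𝒰, h𝒰E, h𝒰P⟩ := exists_open_connected_approx hφ (by positivity : 0 < 1 + τ) hg1 hEm
    hEb hPtop hε0
  set Ω' := AffineMap.homothety x₀ (1 + κ) '' Ω with hΩ'
  have hΩ'c : Convex ℝ Ω' := hΩ.affine_image _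
  have hΩ'b : Bornology.IsBounded Ω' := isBounded_homothety _ _ hΩb
  have hΩ'2 : Ω' ⊆ AffineMap.homothety x₀ (2 : ℝ) '' Ω := by
    have h1 : (1 + κ : ℝ) = 2 * ((1 + κ) / 2) := by ring
    rw [hΩ', h1, AffineMap.homothety_mul, AffineMap.coe_comp, image_comp]
    exact image_mono (hΩ.homothety_subset hx₀.1 (by positivity) (by linarith))
  have hmem : ∀ x, (∃ y ∈ Ω, dist x y < ε) → x ∈ Ω' := fun x ⟨y, hy, hxy⟩ =>
    mem_homothety_of_dist hΩ hρΩ hκ0 hεκ hy hxy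
  obtain ⟨𝒳, h𝒳, h𝒳d, h𝒳U, h𝒳P⟩ := exists_disjoint_hulls g hΩ'c _ (insert B 𝒰) rfl (by
    intro U hU
    rcases Finset.mem_insert.1 hU with rfl | hU
    · exact ⟨Metric.isOpen_ball, (convex_ball x₀ σ).isConnected (Metric.nonempty_ball.2 hσ0),
        fun x hx => hmem x ⟨x, hBΩ hx, by simpa using hε0⟩⟩
    · obtain ⟨h1, h2, h3⟩ := h𝒰 U hU
      refine ⟨h1, h2, fun x hx => hmem x ?_⟩
      obtain ⟨y, hy, hxy⟩ := h3 x hx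
      exact ⟨y, hEΩ hy, hxy⟩)
  have hHΩ : ∀ X ∈ 𝒳, convexHull ℝ X ⊆ Ω' := fun X hX => convexHull_min (h𝒳 X hX).2.2 hΩ'c
  have hHo : ∀ X ∈ 𝒳, IsOpen (convexHull ℝ X) := fun X hX => (h𝒳 X hX).1.convexHull
  have hHc : ∀ X ∈ 𝒳, Convex ℝ (convexHull ℝ X) := fun X _ => convex_convexHull ℝ X
  obtain ⟨v, hvΩ, hvd, hvp⟩ := exists_pack hΩ'c _ 𝒳 (convexHull ℝ) rfl
    (fun X hX => ⟨hHo X hX, (h𝒳 X hX).2.1.nonempty.convexHull, hΩ'b.subset (hHΩ X hX), hHΩ X hX⟩)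
    (fun X hX => (hHc X hX).projConnected) h𝒳d
  set H : Set (Fin 2 → ℝ) → Set (Fin 2 → ℝ) := fun X => convexHull ℝ X with hH
  set L : Set (Fin 2 → ℝ) → Set (Fin 2 → ℝ) := fun X => shift (v X) (convexHull ℝ X) with hL
  have hLo : ∀ X ∈ 𝒳, IsOpen (L X) := fun X hX => (hHo X hX).shift _
  have hLc : ∀ X ∈ 𝒳, Convex ℝ (L X) := fun X hX => (hHc X hX).shift _
  set G := convexHull ℝ (⋃ k ∈ 𝒳, L k) with hG
  have hGo : IsOpen G := (isOpen_biUnion fun k hk => hLo k hk).convexHull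
  have hGΩ : G ⊆ Ω' := convexHull_min (iUnion₂_subset hvΩ) hΩ'c
  have hGb := hΩ'b.subset hGΩ
  have hGtop : volume G ≠ ⊤ := hGb.measure_lt_top.ne
  have hUE : volume (E \ ⋃ U ∈ insert B 𝒰, U) ≤ ENNReal.ofReal ε := by
    refine (measure_mono ?_).trans h𝒰E
    refine sdiff_subset_sdiff_right ?_
    rw [Finset.set_biUnion_insert]; exact subset_union_right
  have hXH : (⋃ X ∈ 𝒳, X) ⊆ ⋃ X ∈ 𝒳, H X := iUnion₂_mono fun X _ => subset_convexHull ℝ X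
  have hEH : volume (E \ ⋃ X ∈ 𝒳, H X) ≤ ENNReal.ofReal ε :=
    (measure_mono (sdiff_subset_sdiff_right (h𝒳U.trans hXH))).trans hUE
  have hHvol : volume (⋃ X ∈ 𝒳, H X) = ∑ X ∈ 𝒳, volume (H X) :=
    measure_biUnion_finset h𝒳d fun X hX => (hHo X hX).measurableSet
  have hLvol : volume (⋃ X ∈ 𝒳, L X) = ∑ X ∈ 𝒳, volume (H X) := by
    rw [measure_biUnion_finset hvd fun X hX => (hLo X hX).measurableSet]
    exact Finset.sum_congr rfl fun X _ => volume_shift _ _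
  have hbig : ENNReal.ofReal (m + b / 2) ≤ ∑ X ∈ 𝒳, volume (H X) := by
    have hBH : B ⊆ ⋃ X ∈ 𝒳, H X := by
      refine Subset.trans ?_ (h𝒳U.trans hXH)
      rw [Finset.set_biUnion_insert]; exact subset_union_left
    have h1 : volume (E ∪ B \ E) = ENNReal.ofReal (m + b) := by
      rw [measure_union' disjoint_sdiff_right hEm, hEv', ENNReal.ofReal_add hm.le hb0.le, hb,
        ENNReal.ofReal_toReal hBfin]
    have h2 : E ∪ B \ E ⊆ (E \ ⋃ X ∈ 𝒳, H X) ∪ ⋃ X ∈ 𝒳, H X := by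
      rw [sdiff_union_self]
      exact union_subset_union_right _ (sdiff_subset.trans hBH)
    have h3 := (measure_mono (μ := volume) h2).trans (measure_union_le _ _)
    rw [h1, hHvol] at h3
    have h4 : ENNReal.ofReal (m + b) = ENNReal.ofReal ε + ENNReal.ofReal (m + b - ε) := by
      rw [← ENNReal.ofReal_add hε0.le (by linarith)]; congr 1; ring
    rw [h4] at h3
    have h5 := h3.trans (add_le_add_left hEH _)
    rw [ENNReal.add_le_add_iff_left ENNReal.ofReal_ne_top] at h5
    exact (ENNReal.ofReal_le_ofReal (by linarith)).trans h5
  have hGvol : ENNReal.ofReal (m + b / 2) ≤ volume G := by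
    rw [← hLvol] at hbig
    exact hbig.trans (measure_mono (subset_convexHull ℝ _))
  have hGA : m + b / 2 ≤ (volume G).toReal := (ENNReal.ofReal_le_iff_le_toReal hGtop).1 hGvol
  have hper : ∑ X ∈ 𝒳, zonoPer g (H X) ≤ ENNReal.ofReal (p + 2 * β) := by
    calc ∑ X ∈ 𝒳, zonoPer g (H X) = ∑ X ∈ 𝒳, zonoPer g X :=
          Finset.sum_congr rfl fun X hX => zonoPer_convexHull g (h𝒳 X hX).2.1.isPreconnected
      _ ≤ ∑ U ∈ insert B 𝒰, zonoPer g U := h𝒳P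
      _ ≤ zonoPer g B + ∑ U ∈ 𝒰, zonoPer g U := by
          by_cases hB𝒰 : B ∈ 𝒰
          · rw [Finset.insert_eq_of_mem hB𝒰]; exact le_add_self
          · rw [Finset.sum_insert hB𝒰]
      _ ≤ ENNReal.ofReal β + ENNReal.ofReal ((1 + τ) * p + ε) := by
          gcongr
          · exact (zonoPer_ball_le hg4 x₀ hσ0.le).trans (ENNReal.ofReal_le_ofReal hσβ)
          · rw [hp]; exact h𝒰P
      _ = ENNReal.ofReal (β + ((1 + τ) * p + ε)) := by
          rw [ENNReal.ofReal_add hβ.le (by positivity)]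
      _ ≤ _ := ENNReal.ofReal_le_ofReal (by linarith)
  have hcomp := hE.le_zonoPer hm hΩ hg2 hGo (convex_convexHull ℝ _) hGb hx₀.1 hκ0.le hGΩ
    (hκb.trans hGA)
  have hA0 : 0 < (volume G).toReal := by linarith
  have hover : ∀ i ∈ 𝒳, zonoPer g G +
      2 * ∑ j, volume (wedge (g j) '' L i ∩ wedge (g j) '' ⋃ k ∈ 𝒳 \ {i}, L k) ≤
        ENNReal.ofReal (p + 2 * β) := by
    intro i hi
    have h1 := zonoPer_hull_add_overlap_le g hi hLc hvp
    rw [Finset.erase_eq] at h1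
    refine h1.trans (le_trans (le_of_eq ?_) hper)
    exact Finset.sum_congr rfl fun X _ => zonoPer_shift g _ _
  have hne : 𝒳.Nonempty := by
    rw [Finset.nonempty_iff_ne_empty]
    rintro h0
    rw [h0, Finset.sum_empty, nonpos_iff_eq_zero, ENNReal.ofReal_eq_zero] at hbig
    linarith
  have hGper : zonoPer g G ≤ ENNReal.ofReal (p + 2 * β) := by
    obtain ⟨i, hi⟩ := hne
    exact le_self_add.trans (hover i hi)
  refine ⟨n, g, 𝒳, H, L, G, hg3, hg4, fun i hi => ⟨hHo i hi, hHc i hi, hΩ'b.subset (hHΩ i hi)⟩,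
    fun i hi => ⟨hLo i hi, hLc i hi, ?_, volume_shift _ _⟩, h𝒳d, hvd,
    hEH.trans (ENNReal.ofReal_le_ofReal (by linarith)), hper, hGo, convex_convexHull ℝ _, ?_, ?_, ?_,
    (ENNReal.ofReal_le_ofReal (by linarith)).trans hbig⟩
  · exact (subset_biUnion_of_mem (u := L) (Finset.mem_coe.2 hi)).trans (subset_convexHull ℝ _)
  · intro x hx y hy
    rw [← dist_eq_norm]
    exact (hD (hΩ'2 (hGΩ hx)) (hΩ'2 (hGΩ hy))).trans (le_max_left _ _)
  · intro i hi
    have h1 : ENNReal.ofReal p ≤ zonoPer g G := by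
      rw [← hpE]
      refine hcomp.trans ?_
      have : ENNReal.ofReal √(m / (volume G).toReal) ≤ 1 := by
        rw [← ENNReal.ofReal_one]
        refine ENNReal.ofReal_le_ofReal (Real.sqrt_le_one.2 ?_)
        rw [div_le_one hA0]; linarith
      calc _ ≤ 1 * zonoPer g G := by gcongr
        _ = _ := one_mul _
    have h2 := (add_le_add_left h1 _).trans (hover i hi)
    rw [ENNReal.ofReal_add hp0 (by positivity), ENNReal.add_le_add_iff_left ENNReal.ofReal_ne_top,
      ENNReal.ofReal_mul (by norm_num), ENNReal.ofReal_ofNat] at h2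
    exact (ENNReal.mul_le_mul_iff_right (by norm_num) (by norm_num)).1 h2
  · have h1 : ENNReal.ofReal p ≤ ENNReal.ofReal (√(m / (volume G).toReal) * (p + 2 * β)) := by
      rw [← hpE, ENNReal.ofReal_mul (Real.sqrt_nonneg _)]
      exact hcomp.trans (by gcongr)
    rw [ENNReal.ofReal_le_ofReal_iff (by positivity)] at h1
    have h2 : p ^ 2 ≤ m / (volume G).toReal * (p + 2 * β) ^ 2 := by
      have h3 := pow_le_pow_left₀ hp0 h1 2
      rwa [mul_pow, Real.sq_sqrt (by positivity)] at h3
    rw [div_mul_eq_mul_div, le_div_iff₀ hA0] at h2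
    exact h2

/-- In a finite family satisfying an isoperimetric inequality, some member is not small. -/
lemma exists_large_of_sum {ι : Type*} {s T : Finset ι} {V Q : ι → ℝ} {r P c : ℝ} (hr : 0 < r)
    (hP : 0 < P) (hc : 0 < c) (hV : ∀ i ∈ s, 0 ≤ V i) (hQ : ∀ i ∈ s, 0 ≤ Q i)
    (hVQ : ∀ i ∈ s, V i ≤ (Q i / r) ^ 2) (hQP : ∑ i ∈ s, Q i ≤ P) (hT : T ⊆ s)
    (hcT : c ≤ ∑ i ∈ T, V i) : ∃ i ∈ T, (c * r / (2 * P)) ^ 2 ≤ V i := by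
  by_contra! h
  have h1 : ∀ i ∈ T, V i ≤ c * r / (2 * P) * (Q i / r) := by
    intro i hi
    have h2 : √(V i) ≤ c * r / (2 * P) := Real.sqrt_le_iff.2 ⟨by positivity, (h i hi).le⟩
    have h3 : √(V i) ≤ Q i / r :=
      Real.sqrt_le_iff.2 ⟨div_nonneg (hQ i (hT hi)) hr.le, hVQ i (hT hi)⟩
    rw [← Real.mul_self_sqrt (hV i (hT hi))]
    exact mul_le_mul h2 h3 (Real.sqrt_nonneg _) (by positivity)
  have h2 : ∑ i ∈ T, V i ≤ c * r / (2 * P) * (P / r) := by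
    refine (Finset.sum_le_sum h1).trans ?_
    rw [← Finset.mul_sum, ← Finset.sum_div]
    have h3 : ∑ i ∈ T, Q i ≤ P :=
      (Finset.sum_le_sum_of_subset_of_nonneg hT fun i hi _ => hQ i hi).trans hQP
    gcongr
  have h3 : c * r / (2 * P) * (P / r) = c / 2 := by field_simp
  linarith

lemma IsIsopMinimizer.exists_convex_approx {φ : (Fin 2 → ℝ) → ℝ} (hφ : IsNorm φ)
    {Ω E : Set (Fin 2 → ℝ)} {m : ℝ} (hm : 0 < m) (hm1 : m < (volume Ω).toReal)
    (hE : IsIsopMinimizer φ Ω m E) (hΩo : IsOpen Ω) (hΩb : Bornology.IsBounded Ω)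
    (hΩ : Convex ℝ Ω) {c : ℝ} (hc : 0 < c) :
    ∃ K : Set (Fin 2 → ℝ), Convex ℝ K ∧ volume (E \ K) + volume (K \ E) ≤ ENNReal.ofReal c := by
  classical
  obtain ⟨hEm, hEΩ, hEv, -⟩ := id hE
  have hEb := hΩb.subset hEΩ
  have hEfin : volume E ≠ ⊤ := hEb.measure_lt_top.ne
  obtain ⟨p, hp⟩ : ∃ p, p = (anisoPerimeter φ E).toReal := ⟨_, rfl⟩
  have hp0 : 0 ≤ p := by rw [hp]; exact ENNReal.toReal_nonneg
  obtain ⟨r, C, D, hr, hC, hD, key⟩ := hE.exists_packing hφ hm hm1 hΩo hΩb hΩ hp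
  have hQreal : ∀ {n : ℕ} {g : Fin n → Fin 2 → ℝ} {s : Finset (Set (Fin 2 → ℝ))}
      {H : Set (Fin 2 → ℝ) → Set (Fin 2 → ℝ)} {P : ℝ}, 0 ≤ P →
      (∀ i ∈ s, IsOpen (H i) ∧ Convex ℝ (H i) ∧ Bornology.IsBounded (H i)) →
      ∑ i ∈ s, zonoPer g (H i) ≤ ENNReal.ofReal P → ∑ i ∈ s, (zonoPer g (H i)).toReal ≤ P := by
    intro n g s H P hP hH hs
    rw [← ENNReal.toReal_sum fun i hi => zonoPer_ne_top g (hH i hi).2.2]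
    exact ENNReal.toReal_le_of_le_ofReal hP hs
  have hVreal : ∀ {s : Finset (Set (Fin 2 → ℝ))} {H : Set (Fin 2 → ℝ) → Set (Fin 2 → ℝ)},
      (∀ i ∈ s, IsOpen (H i) ∧ Convex ℝ (H i) ∧ Bornology.IsBounded (H i)) →
      ENNReal.ofReal m ≤ ∑ i ∈ s, volume (H i) → m ≤ ∑ i ∈ s, (volume (H i)).toReal := by
    intro s H hH hs
    have hfin : ∀ i ∈ s, volume (H i) ≠ ⊤ := fun i hi => (hH i hi).2.2.measure_lt_top.ne
    rw [← ENNReal.toReal_sum hfin]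
    exact (ENNReal.ofReal_le_iff_le_toReal (ENNReal.sum_ne_top.2 hfin)).1 hs
  have hppos : 0 < p := by
    refine hp0.lt_of_ne fun h0 => ?_
    set w := √(m * r ^ 2 / 2) with hw
    have hw0 : 0 < w := Real.sqrt_pos.2 (by positivity)
    have hw2 : w ^ 2 = m * r ^ 2 / 2 := Real.sq_sqrt (by positivity)
    set β := min 1 (w / 4) with hβ
    have hβ0 : 0 < β := by positivity
    have hβw : β ≤ w / 4 := min_le_right _ _
    obtain ⟨n, g, s, H, L, G, hg1, hg2, hH, hL, hHd, hLd, hEH, hper, hGo, hGc, hGD, hov, hA, hV⟩ :=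
      key β hβ0 (min_le_left _ _)
    rw [← h0, zero_add] at hper
    have hQs := hQreal (by positivity) hH hper
    have hVQ : ∀ i ∈ s, (volume (H i)).toReal ≤ ((zonoPer g (H i)).toReal / r) ^ 2 := fun i hi =>
      volume_le_zonoPer_sq hr hg1 (hH i hi).2.1 (hH i hi).2.2
    obtain ⟨i, hi, hVi⟩ := exists_large_of_sum (T := s) hr (by positivity : 0 < 2 * β) hm
      (fun i _ => ENNReal.toReal_nonneg) (fun i _ => ENNReal.toReal_nonneg) hVQ hQs
      Subset.rfl (hVreal hH hV)
    have h1 : (zonoPer g (H i)).toReal ≤ 2 * β :=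
      (Finset.single_le_sum (f := fun i => (zonoPer g (H i)).toReal)
        (fun i _ => ENNReal.toReal_nonneg) hi).trans hQs
    have h2 : m * r / (2 * (2 * β)) ≤ 2 * β / r := by
      refine le_of_sq_le_sq ?_ (by positivity)
      refine hVi.trans ((hVQ i hi).trans ?_)
      gcongr
    rw [div_le_div_iff₀ (by positivity) hr] at h2
    nlinarith
  set c' := min c m / 4 with hc'
  have hmin : 0 < min c m := lt_min hc hm
  have hc'0 : 0 < c' := by positivity
  have hc'c : c' ≤ c / 4 := by rw [hc']; linarith [min_le_left c m]
  have hc'm : c' ≤ m / 4 := by rw [hc']; linarith [min_le_right c m]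
  set ε₀ := (c' * r / (2 * (p + 2))) ^ 2 with hε₀
  have hε₀0 : 0 < ε₀ := by positivity
  set η := ε₀ / (192 * D) with hη
  have hη0 : 0 < η := by positivity
  obtain ⟨c₁, c₂, hc₁, hc₂, hrig⟩ := overlap_sum_lower_bound hr hC hη0 hD
  obtain ⟨β, hβ0, hβ1, hθc, hθ₁⟩ : ∃ β : ℝ, 0 < β ∧ β ≤ 1 ∧
      m * ((p + 2 * β) ^ 2 / p ^ 2 - 1) + β < c / 4 ∧
      β + (m * ((p + 2 * β) ^ 2 / p ^ 2 - 1)) * c₂ < c₁ := by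
    have hcont1 : Continuous fun β : ℝ => m * ((p + 2 * β) ^ 2 / p ^ 2 - 1) + β := by fun_prop
    have hcont2 : Continuous fun β : ℝ => β + (m * ((p + 2 * β) ^ 2 / p ^ 2 - 1)) * c₂ := by
      fun_prop
    have h1 := hcont1.tendsto 0
    have h2 := hcont2.tendsto 0
    have e : m * ((p + 2 * 0) ^ 2 / p ^ 2 - 1) = 0 := by
      rw [mul_zero, add_zero, div_self (by positivity), sub_self, mul_zero]
    rw [e, zero_add] at h1
    rw [e, zero_mul, zero_add] at h2
    have h3 := (h1.eventually_lt_const (by positivity : (0 : ℝ) < c / 4)).and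
      (h2.eventually_lt_const hc₁)
    obtain ⟨β, ⟨hb1, hb2⟩, hb3⟩ := ((h3.filter_mono (nhdsWithin_le_nhds (s := Ioi 0))).and
      (Ioc_mem_nhdsGT zero_lt_one)).exists
    exact ⟨β, hb3.1, hb3.2, hb1, hb2⟩
  obtain ⟨n, g, s, H, L, G, hg1, hg2, hH, hL, hHd, hLd, hEH, hper, hGo, hGc, hGD, hov, hA, hV⟩ :=
    key β hβ0 hβ1
  have hGb : Bornology.IsBounded G := Metric.isBounded_iff.2 ⟨D, fun x hx y hy => by
    rw [dist_eq_norm]; exact hGD x hx y hy⟩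
  have hGfin : volume G ≠ ⊤ := hGb.measure_lt_top.ne
  have hHfin : ∀ i ∈ s, volume (H i) ≠ ⊤ := fun i hi => (hH i hi).2.2.measure_lt_top.ne
  have hmV := hVreal hH hV
  have hQs := hQreal (by positivity) hH hper
  have hVQ : ∀ i ∈ s, (volume (H i)).toReal ≤ ((zonoPer g (H i)).toReal / r) ^ 2 := fun i hi =>
    volume_le_zonoPer_sq hr hg1 (hH i hi).2.1 (hH i hi).2.2
  have hLG : (⋃ i ∈ s, L i) ⊆ G := iUnion₂_subset fun i hi => (hL i hi).2.2.1
  have hLmeas : MeasurableSet (⋃ i ∈ s, L i) :=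
    (isOpen_biUnion fun i hi => (hL i hi).1).measurableSet
  have hHmeas : MeasurableSet (⋃ i ∈ s, H i) :=
    (isOpen_biUnion fun i hi => (hH i hi).1).measurableSet
  have hsum : (∑ i ∈ s, volume (H i)).toReal = ∑ i ∈ s, (volume (H i)).toReal :=
    ENNReal.toReal_sum hHfin
  have hLvol : volume.real (⋃ i ∈ s, L i) = ∑ i ∈ s, (volume (H i)).toReal := by
    rw [← hsum, measureReal_def, measure_biUnion_finset hLd fun i hi => (hL i hi).1.measurableSet]
    congr 1
    exact Finset.sum_congr rfl fun i hi => (hL i hi).2.2.2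
  have hHvol : volume.real (⋃ i ∈ s, H i) = ∑ i ∈ s, (volume (H i)).toReal := by
    rw [← hsum, measureReal_def, measure_biUnion_finset hHd fun i hi => (hH i hi).1.measurableSet]
  have hHUfin : volume (⋃ i ∈ s, H i) ≠ ⊤ := by
    rw [measure_biUnion_finset hHd fun i hi => (hH i hi).1.measurableSet]
    exact ENNReal.sum_ne_top.2 hHfin
  set γ := m * ((p + 2 * β) ^ 2 / p ^ 2 - 1) with hγ
  have hAγ : volume.real G ≤ m + γ := by
    have h1 : volume.real G ≤ m * (p + 2 * β) ^ 2 / p ^ 2 := by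
      rw [le_div_iff₀ (by positivity)]
      rw [measureReal_def]
      linarith
    have h2 : m + γ = m * (p + 2 * β) ^ 2 / p ^ 2 := by rw [hγ]; ring
    rwa [h2]
  have hVA : ∑ i ∈ s, (volume (H i)).toReal ≤ volume.real G := by
    rw [← hLvol]; exact measureReal_mono hLG hGfin
  have hgap : volume (G \ ⋃ i ∈ s, L i) ≤ ENNReal.ofReal γ := by
    rw [← ENNReal.ofReal_toReal (measure_ne_top_of_subset sdiff_subset hGfin)]
    refine ENNReal.ofReal_le_ofReal ?_
    rw [← measureReal_def, measureReal_sdiff hLG hLmeas hGfin, hLvol]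
    linarith
  -- one piece carries almost all the mass
  obtain ⟨i, hi, hVi⟩ : ∃ i ∈ s, m - c' ≤ (volume (H i)).toReal := by
    have hlarge : ∀ T ⊆ s, c' ≤ ∑ i ∈ T, (volume (H i)).toReal →
        ∃ i ∈ T, ε₀ ≤ (volume (H i)).toReal := by
      intro T hT hcT
      refine exists_large_of_sum hr (by positivity : 0 < p + 2) hc'0
        (fun i _ => ENNReal.toReal_nonneg) (fun i _ => ENNReal.toReal_nonneg) hVQ
        (hQs.trans (by linarith)) hT hcT
    obtain ⟨i, hi, hVi⟩ := hlarge s Subset.rfl (by linarith)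
    refine ⟨i, hi, ?_⟩
    by_contra! hlt
    obtain ⟨k, hk, hVk⟩ := hlarge (s \ {i}) Finset.sdiff_subset (by
      have h1 := Finset.sum_sdiff (f := fun i => (volume (H i)).toReal)
        (Finset.singleton_subset_iff.2 hi)
      rw [Finset.sum_singleton] at h1
      linarith)
    have hks := (Finset.mem_sdiff.1 hk).1
    have hki : k ≠ i := fun h => (Finset.mem_sdiff.1 hk).2 (Finset.mem_singleton.2 h)
    have hball : ∀ k ∈ s, ε₀ ≤ (volume (H k)).toReal → ∃ z, Metric.ball z η ⊆ L k := by
      intro k hk hVk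
      refine exists_ball_subset_of_volume (hL k hk).1 (hL k hk).2.1 hD
        (fun x hx y hy => hGD x ((hL k hk).2.2.1 hx) y ((hL k hk).2.2.1 hy)) hε₀0 ?_
      rw [(hL k hk).2.2.2]
      exact (ENNReal.ofReal_le_iff_le_toReal (hHfin k hk)).2 hVk
    obtain ⟨z, hz⟩ := hball i hi hVi
    obtain ⟨q, hq⟩ := hball k hks hVk
    have hqL : q ∉ L i := fun h =>
      Set.disjoint_left.1 (hLd hks hi hki) (hq (Metric.mem_ball_self hη0)) h
    have h1 := hrig n g hg1 hg2 (L i) (⋃ k ∈ s \ {i}, L k) G z q (hL i hi).1 (hL i hi).2.1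
      (isOpen_biUnion fun k hk => (hL k (Finset.mem_sdiff.1 hk).1).1) hGo hGc (hL i hi).2.2.1 hGD hz
      hqL (hq.trans (hL k hks).2.2.1)
    have h2 : L i ∪ ⋃ k ∈ s \ {i}, L k = ⋃ k ∈ s, L k := by
      rw [← Finset.erase_eq, ← Finset.set_biUnion_insert, Finset.insert_erase hi]
    rw [h2] at h1
    have h3 : ENNReal.ofReal c₁ ≤ ENNReal.ofReal β + ENNReal.ofReal γ * ENNReal.ofReal c₂ :=
      h1.trans (add_le_add (hov i hi) (by gcongr))
    have hγ0 : 0 ≤ γ := by linarith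
    rw [← ENNReal.ofReal_mul hγ0, ← ENNReal.ofReal_add hβ0.le (by positivity),
      ENNReal.ofReal_le_ofReal_iff (by positivity)] at h3
    linarith
  refine ⟨H i, (hH i hi).2.1, ?_⟩
  have hHi : H i ⊆ ⋃ i ∈ s, H i := subset_biUnion_of_mem (u := H) (Finset.mem_coe.2 hi)
  have hEreal : volume.real E = m := hEv
  have hEHr : volume.real (E \ ⋃ i ∈ s, H i) ≤ β := ENNReal.toReal_le_of_le_ofReal hβ0.le hEH
  have e1 := measureReal_sdiff_add_inter (s := E) hHmeas hEfin
  have e2 := measureReal_sdiff_add_inter (s := ⋃ i ∈ s, H i) hEm hHUfin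
  have e3 : volume.real (H i \ E) ≤ volume.real ((⋃ i ∈ s, H i) \ E) :=
    measureReal_mono (sdiff_subset_sdiff_left hHi) (measure_ne_top_of_subset sdiff_subset hHUfin)
  have e4 := measureReal_sdiff_add_inter (s := H i) hEm (hHfin i hi)
  have e5 := measureReal_sdiff_add_inter (s := E) (hH i hi).1.measurableSet hEfin
  rw [inter_comm] at e2 e4
  have hVi' : m - c' ≤ volume.real (H i) := hVi
  rw [← ENNReal.ofReal_toReal (measure_ne_top_of_subset sdiff_subset hEfin),
    ← ENNReal.ofReal_toReal (measure_ne_top_of_subset sdiff_subset (hHfin i hi)),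
    ← ENNReal.ofReal_add ENNReal.toReal_nonneg ENNReal.toReal_nonneg]
  refine ENNReal.ofReal_le_ofReal ?_
  rw [← measureReal_def, ← measureReal_def]
  linarith

lemma densityPoints_congr {n : ℕ} {A B : Set (Fin n → ℝ)} (h : A =ᵐ[volume] B) :
    densityPoints A = densityPoints B := by
  have : ∀ (x : Fin n → ℝ) (r : ℝ),
      volume (A ∩ Metric.ball x r) = volume (B ∩ Metric.ball x r) := fun x r =>
    measure_congr (h.inter (ae_eq_refl _))
  simp only [densityPoints, this]

lemma interior_subset_densityPoints {n : ℕ} (A : Set (Fin n → ℝ)) :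
    interior A ⊆ densityPoints A := by
  intro x hx
  obtain ⟨ε, hε, hball⟩ := Metric.isOpen_iff.1 isOpen_interior x hx
  refine (tendsto_const_nhds (x := (1 : ℝ≥0∞))).congr' ?_
  filter_upwards [Ioo_mem_nhdsGT hε] with r hr
  rw [inter_eq_self_of_subset_right
    ((Metric.ball_subset_ball hr.2.le).trans (hball.trans interior_subset))]
  exact (ENNReal.div_self (Metric.measure_ball_pos volume x hr.1).ne'
    measure_ball_lt_top.ne).symm

/-- An open half-plane through the centre of a ball contains at most half of the ball. -/
lemma volume_halfspace_inter_ball_le {n : ℕ} (f : (Fin n → ℝ) →L[ℝ] ℝ) (x : Fin n → ℝ) (r : ℝ) :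
    2 * volume ({y | f y < f x} ∩ Metric.ball x r) ≤ volume (Metric.ball x r) := by
  set S := {y | f y < f x} ∩ Metric.ball x r with hS
  have hSm : MeasurableSet S :=
    (isOpen_lt f.continuous continuous_const).measurableSet.inter Metric.isOpen_ball.measurableSet
  have hmp : MeasurePreserving (fun y : Fin n → ℝ => x + x - y) volume volume :=
    Measure.measurePreserving_sub_left volume (x + x)
  have hvol : volume ((fun y : Fin n → ℝ => x + x - y) ⁻¹' S) = volume S :=
    hmp.measure_preimage hSm.nullMeasurableSet
  have hdisj : Disjoint S ((fun y : Fin n → ℝ => x + x - y) ⁻¹' S) := by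
    rw [Set.disjoint_left]
    rintro y ⟨hy, -⟩ ⟨hy', -⟩
    simp only [mem_ofPred_eq, map_sub, map_add] at hy hy'
    linarith
  have hsub : S ∪ ((fun y : Fin n → ℝ => x + x - y) ⁻¹' S) ⊆ Metric.ball x r := by
    rintro y (hy | hy)
    · exact hy.2
    · have := hy.2
      rw [mem_ball_iff_norm] at this ⊢
      rwa [show x + x - y - x = -(y - x) by abel, norm_neg] at this
  calc 2 * volume S = volume (S ∪ ((fun y : Fin n → ℝ => x + x - y) ⁻¹' S)) := by
        rw [measure_union hdisj (hmp.measurable hSm), hvol, two_mul]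
    _ ≤ _ := measure_mono hsub

/-- The density-one points of a convex set are its interior points. -/
lemma Convex.densityPoints_eq_interior {n : ℕ} {C : Set (Fin n → ℝ)} (hC : Convex ℝ C) :
    densityPoints C = interior C := by
  refine Subset.antisymm (fun x hx => ?_) (interior_subset_densityPoints C)
  by_contra hxC
  obtain ⟨f, hf⟩ := geometric_hahn_banach_open_point hC.interior isOpen_interior hxC
  have hae : C =ᵐ[volume] interior C := by
    have h0 : volume (frontier C) = 0 := hC.addHaar_frontier volume
    exact (interior_ae_eq_of_null_frontier h0).symm
  rw [densityPoints_congr hae] at hx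
  have hle : ∀ᶠ r in nhdsWithin (0 : ℝ) (Ioi 0),
      volume (interior C ∩ Metric.ball x r) / volume (Metric.ball x r) ≤ 2⁻¹ := by
    filter_upwards [self_mem_nhdsWithin] with r hr
    have h0 := (Metric.measure_ball_pos volume x (mem_Ioi.1 hr)).ne'
    rw [ENNReal.div_le_iff h0 measure_ball_lt_top.ne]
    have h1 : 2 * volume (interior C ∩ Metric.ball x r) ≤ volume (Metric.ball x r) :=
      (mul_le_mul_right (measure_mono (inter_subset_inter_left _ fun y hy => hf y hy)) 2).trans
        (volume_halfspace_inter_ball_le f x r)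
    rwa [← ENNReal.div_eq_inv_mul, ENNReal.le_div_iff_mul_le (by simp) (by simp), mul_comm]
  have h12 : (1 : ℝ≥0∞) ≤ 2⁻¹ := le_of_tendsto hx hle
  exact absurd h12 (not_le.2 ENNReal.one_half_lt_one)

/-- A set that can be approximated in measure by convex sets is a.e. equal to a convex set. -/
lemma exists_convex_ae_eq {n : ℕ} {A : Set (Fin n → ℝ)}
    (h : ∀ c : ℝ, 0 < c → ∃ K, Convex ℝ K ∧ volume (A \ K) + volume (K \ A) ≤ ENNReal.ofReal c) :
    ∃ C, Convex ℝ C ∧ A =ᵐ[volume] C := by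
  choose K hK hKv using fun k : ℕ => h ((1 / 2 : ℝ) ^ k) (by positivity)
  have hsum : ∑' k, volume ((A \ K k) ∪ (K k \ A)) ≠ ⊤ := by
    refine ne_top_of_le_ne_top ?_ (ENNReal.tsum_le_tsum fun k =>
      (measure_union_le _ _).trans (hKv k))
    rw [← ENNReal.ofReal_tsum_of_nonneg (fun k => by positivity) summable_geometric_two]
    exact ENNReal.ofReal_ne_top
  refine ⟨⋃ N, ⋂ k ≥ N, K k, ?_, ?_⟩
  · refine Directed.convex_iUnion ?_ fun N => convex_iInter₂ fun k _ => hK k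
    refine Monotone.directed_le fun N M hNM => ?_
    exact biInter_subset_biInter_left fun k hk => hNM.trans hk
  · filter_upwards [ae_eventually_notMem hsum] with x hx
    obtain ⟨N, hN⟩ := eventually_atTop.1 hx
    refine propext (show x ∈ A ↔ x ∈ ⋃ N, ⋂ k ≥ N, K k from ?_)
    simp only [mem_iUnion, mem_iInter]
    constructor
    · intro hxA
      refine ⟨N, fun k hk => ?_⟩
      by_contra hxk
      exact hN k hk (Or.inl ⟨hxA, hxk⟩)
    · rintro ⟨M, hM⟩
      by_contra hxA
      exact hN (max N M) (le_max_left _ _) (Or.inr ⟨hM _ (le_max_right _ _), hxA⟩)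

/-- Any minimizer of the constrained isoperimetric problem (10) in a
bounded convex open set `Ω ⊆ ℝ²` is convex, in the sense that its set of points of
Lebesgue density `1` is convex. -/
theorem isop_minimizer_convex (φ : (Fin 2 → ℝ) → ℝ) (hφ : IsNorm φ)
    (Ω : Set (Fin 2 → ℝ)) (hΩopen : IsOpen Ω) (hΩbdd : Bornology.IsBounded Ω)
    (hΩconv : Convex ℝ Ω) (m : ℝ) (hm0 : 0 < m) (hm1 : m < (volume Ω).toReal)
    (E : Set (Fin 2 → ℝ)) (hE : IsIsopMinimizer φ Ω m E) :
    Convex ℝ (densityPoints E) := by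
  obtain ⟨C, hC, hEC⟩ := exists_convex_ae_eq fun c hc =>
    IsIsopMinimizer.exists_convex_approx hφ hm0 hm1 hE hΩopen hΩbdd hΩconv hc
  rw [densityPoints_congr hEC, hC.densityPoints_eq_interior]
  exact hC.interior

end
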